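/- arXiv:0706.3218 — 3 statements merged into one kernel-verified Lean document; each statement's English description precedes it below -/
import Mathlib

section
/- Let n ≥ 1 and 0 ≤ i ≤ n. For every g ∈ F, if l_∞(g x_i⁻¹) = l_∞(g) − 1, then l_n(g x_i⁻¹) = l_n(g) − 1. -/
/-- The defining relations of Thompson's group `F` in the infinite presentation
`⟨x_k, k ≥ 0 | x_i⁻¹ x_j x_i = x_{j+1} for i < j⟩`. -/
def thompsonRels : Set (FreeGroup ℕ) :=
  {w | ∃ i j : ℕ, i < j ∧
    w = (FreeGroup.of i)⁻¹ * FreeGroup.of j * FreeGroup.of i * (FreeGroup.of (j + 1))⁻¹}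

/-- Thompson's group `F`. -/
abbrev ThompsonF := PresentedGroup thompsonRels

/-- The standard infinite family of generators `x_i` of Thompson's group `F`. -/
def x (i : ℕ) : ThompsonF := PresentedGroup.of i

/-- The word length of `g` with respect to a generating set `S`:
the least `m` such that `g` is a product of `m` elements of `S ∪ S⁻¹`. -/
noncomputable def wordLength {G : Type*} [Group G] (S : Set G) (g : G) : ℕ :=
  sInf {m | ∃ l : List G, l.length = m ∧ (∀ a ∈ l, a ∈ S ∨ a⁻¹ ∈ S) ∧ l.prod = g}

/-- The consecutive generating set `X_n = {x_0, x_1, …, x_n}`. -/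
def Xset (n : ℕ) : Set ThompsonF := {g | ∃ i ≤ n, g = x i}

/-- `l_n(g)`: word length of `g` with respect to `X_n`. -/
noncomputable def ln (n : ℕ) (g : ThompsonF) : ℕ := wordLength (Xset n) g

/-- `l_∞(g)`: word length of `g` with respect to the infinite generating set `{x_i | i ≥ 0}`. -/
noncomputable def linf (g : ThompsonF) : ℕ := wordLength (Set.range x) g

/-- The word metric `d_n(g,h) = l_n(g⁻¹ h)`. -/
noncomputable def dn (n : ℕ) (g h : ThompsonF) : ℕ := ln n (g⁻¹ * h)

/-! ### Word length -/

section WordLength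

variable {G : Type*} [Group G] {S : Set G}

lemma wordLength_prod_le {l : List G} (hl : ∀ a ∈ l, a ∈ S ∨ a⁻¹ ∈ S) :
    wordLength S l.prod ≤ l.length :=
  Nat.sInf_le ⟨l, rfl, hl, rfl⟩

lemma exists_list_length_eq_wordLength (hS : Subgroup.closure S = ⊤) (g : G) :
    ∃ l : List G, l.length = wordLength S g ∧ (∀ a ∈ l, a ∈ S ∨ a⁻¹ ∈ S) ∧ l.prod = g := by
  have hmem : g ∈ Submonoid.closure (S ∪ S⁻¹) := by
    rw [← Subgroup.closure_toSubmonoid, hS]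
    trivial
  obtain ⟨l, hl, hg⟩ := Submonoid.exists_list_of_mem_closure hmem
  exact Nat.sInf_mem (s := {m | ∃ l : List G, l.length = m ∧ (∀ a ∈ l, a ∈ S ∨ a⁻¹ ∈ S) ∧
    l.prod = g}) ⟨l.length, l, rfl, hl, hg⟩

lemma wordLength_mul_le (hS : Subgroup.closure S = ⊤) (g : G) {a : G} (ha : a ∈ S) :
    wordLength S (g * a) ≤ wordLength S g + 1 := by
  obtain ⟨l, hlen, hl, rfl⟩ := exists_list_length_eq_wordLength hS g
  have h := wordLength_prod_le (S := S) (l := l ++ [a]) (by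
    intro b hb
    rcases List.mem_append.1 hb with hb | hb
    · exact hl b hb
    · exact Or.inl (List.mem_singleton.1 hb ▸ ha))
  simpa [hlen] using h

end WordLength

/-! ### Generators and relations of `F` -/

lemma x_mul_x {i j : ℕ} (hij : i < j) : x j * x i = x i * x (j + 1) := by
  have h := PresentedGroup.one_of_mem (rels := thompsonRels)
    (x := (FreeGroup.of i)⁻¹ * FreeGroup.of j * FreeGroup.of i * (FreeGroup.of (j + 1))⁻¹)
    ⟨i, j, hij, rfl⟩
  have h' : (x i)⁻¹ * x j * x i * (x (j + 1))⁻¹ = 1 := by simpa [x, PresentedGroup.of] using h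
  rw [mul_inv_eq_one] at h'
  rw [← h']
  group

/-- A family of elements satisfying the relations of `F` extends to a homomorphism. -/
lemma exists_hom_of_relations {G : Type*} [Group G] (f : ℕ → G)
    (hf : ∀ i j, i < j → f j * f i = f i * f (j + 1)) :
    ∃ φ : ThompsonF →* G, ∀ i, φ (x i) = f i := by
  refine ⟨PresentedGroup.toGroup (f := f) ?_, fun i => PresentedGroup.toGroup.of _⟩
  rintro r ⟨i, j, hij, rfl⟩
  simp [mul_assoc, ← mul_assoc (f j), hf i j hij]

lemma closure_range_x : Subgroup.closure (Set.range x) = ⊤ :=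
  PresentedGroup.closure_range_of thompsonRels

lemma x_mem_Xset {n i : ℕ} (hi : i ≤ n) : x i ∈ Xset n := ⟨i, hi, rfl⟩

lemma closure_Xset {n : ℕ} (hn : 1 ≤ n) : Subgroup.closure (Xset n) = ⊤ := by
  have h0 : x 0 ∈ Subgroup.closure (Xset n) := Subgroup.subset_closure (x_mem_Xset n.zero_le)
  have hsucc : ∀ j, x (j + 1) ∈ Subgroup.closure (Xset n) := by
    intro j
    induction j with
    | zero => exact Subgroup.subset_closure (x_mem_Xset hn)
    | succ j ih =>
      have h : x (j + 1 + 1) = (x 0)⁻¹ * (x (j + 1) * x 0) := by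
        rw [x_mul_x j.succ_pos]
        group
      rw [h]
      exact mul_mem (inv_mem h0) (mul_mem ih h0)
  rw [eq_top_iff, ← closure_range_x, Subgroup.closure_le]
  rintro _ ⟨_ | j, rfl⟩
  exacts [h0, hsucc j]

/-- Words in the generators representing the same element have lengths of equal parity. -/
lemma exists_parity : ∃ ε : ThompsonF →* Multiplicative (ZMod 2),
    (∀ i, ε (x i) = .ofAdd 1) ∧ ∀ (n : ℕ) (l : List ThompsonF),
      (∀ a ∈ l, a ∈ Xset n ∨ a⁻¹ ∈ Xset n) → ε l.prod = .ofAdd (l.length : ZMod 2) := by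
  obtain ⟨ε, hε⟩ := exists_hom_of_relations (fun _ => (.ofAdd 1 : Multiplicative (ZMod 2)))
    fun _ _ _ => rfl
  refine ⟨ε, hε, fun n l hl => ?_⟩
  induction l with
  | nil => simp
  | cons a l ih =>
    have ha : ε a = .ofAdd 1 := by
      rcases hl a List.mem_cons_self with ⟨i, -, h⟩ | ⟨i, -, h⟩
      · rw [h, hε]
      · rw [← inv_inv a, h, map_inv, hε]
        decide
    rw [List.prod_cons, map_mul, ha, ih fun b hb => hl b (List.mem_cons_of_mem a hb),
      List.length_cons, Nat.cast_succ, add_comm, ofAdd_add]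

/-! ### Deleting leaves

A sequence `s : ℕ → ℕ` encodes a forest with infinitely many roots, some of whose subtrees have
been deleted: `0` stands for a deleted tree, and `Nat.pair a b` for the tree with subtrees `a` and
`b`. The generator `x j` acts by joining the trees at the roots `j` and `j + 1`; after the deleted
trees are discarded, this is the action of another generator or of the identity. -/

/-- Join the trees at the roots `j` and `j + 1`. -/
def joinAt (j : ℕ) : Equiv.Perm (ℕ → ℕ) where
  toFun s m := if m < j then s m else if m = j then Nat.pair (s j) (s (j + 1)) else s (m + 1)
  invFun t m := if m < j then t m else if m = j then (Nat.unpair (t j)).1 else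
    if m = j + 1 then (Nat.unpair (t j)).2 else t (m - 1)
  left_inv s := by
    funext m
    rcases lt_trichotomy m j with h | rfl | h
    · simp [h]
    · simp
    · rcases eq_or_ne m (j + 1) with rfl | h'
      · simp
      · simp [h', show ¬ m < j by omega, show m ≠ j by omega, show ¬ m - 1 < j by omega,
          show m - 1 ≠ j by omega, show m - 1 + 1 = m by omega]
  right_inv t := by
    funext m
    rcases lt_trichotomy m j with h | rfl | h
    · simp [h]
    · simp
    · simp [show ¬ m < j by omega, show m ≠ j by omega, show ¬ m + 1 < j by omega,
        show m + 1 ≠ j by omega]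

lemma joinAt_of_lt {j m : ℕ} (s : ℕ → ℕ) (h : m < j) : joinAt j s m = s m := by
  simp [joinAt, h]

lemma joinAt_self (j : ℕ) (s : ℕ → ℕ) : joinAt j s j = Nat.pair (s j) (s (j + 1)) := by
  simp [joinAt]

lemma joinAt_of_gt {j m : ℕ} (s : ℕ → ℕ) (h : j < m) : joinAt j s m = s (m + 1) := by
  simp [joinAt, show ¬ m < j by omega, show m ≠ j by omega]

lemma pair_eq_zero_iff {a b : ℕ} : Nat.pair a b = 0 ↔ a = 0 ∧ b = 0 := by
  rw [← Nat.pair_eq_pair]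
  rfl

lemma joinAt_joinAt {i j : ℕ} (hij : i < j) (s : ℕ → ℕ) :
    joinAt j (joinAt i s) = joinAt i (joinAt (j + 1) s) := by
  funext m
  rcases lt_trichotomy m i with h | rfl | h
  · simp (disch := omega) only [joinAt_of_lt]
  · simp (disch := omega) only [joinAt_of_lt, joinAt_self]
  · rcases lt_trichotomy m j with h' | rfl | h'
    · simp (disch := omega) only [joinAt_of_lt, joinAt_of_gt]
    · simp (disch := omega) only [joinAt_self, joinAt_of_gt]
    · simp (disch := omega) only [joinAt_of_gt]

/-- The number of roots before `j` whose tree is not deleted. -/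
def keptBefore (s : ℕ → ℕ) (j : ℕ) : ℕ := Nat.count (fun m => s m ≠ 0) j

/-- What remains of the generator `x j` at `s` after the deleted trees are discarded. -/
noncomputable def keptGen (s : ℕ → ℕ) (j : ℕ) : ThompsonF :=
  if s j ≠ 0 ∧ s (j + 1) ≠ 0 then x (keptBefore s j) else 1

lemma keptBefore_succ (s : ℕ → ℕ) (j : ℕ) :
    keptBefore s (j + 1) = keptBefore s j + if s j ≠ 0 then 1 else 0 :=
  Nat.count_succ _ _

lemma keptBefore_le (s : ℕ → ℕ) (j : ℕ) : keptBefore s j ≤ j := Nat.count_le _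

lemma keptBefore_joinAt_of_le {i j : ℕ} (hij : i ≤ j) (s : ℕ → ℕ) :
    keptBefore (joinAt j s) i = keptBefore s i := by
  induction i with
  | zero => rfl
  | succ i ih =>
    rw [keptBefore_succ, keptBefore_succ, ih (by omega), joinAt_of_lt s (by omega)]

lemma keptBefore_joinAt_of_gt {i j : ℕ} (hij : i < j) (s : ℕ → ℕ) :
    keptBefore (joinAt i s) j + (if s i ≠ 0 ∧ s (i + 1) ≠ 0 then 1 else 0) =
      keptBefore s (j + 1) := by
  induction j, hij using Nat.le_induction with
  | base =>
    rw [keptBefore_succ, keptBefore_succ, keptBefore_succ, keptBefore_joinAt_of_le le_rfl,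
      joinAt_self]
    by_cases h : s i = 0 <;> by_cases h' : s (i + 1) = 0 <;> simp [h, h', pair_eq_zero_iff]
  | succ j hj ih =>
    rw [keptBefore_succ, keptBefore_succ s (j + 1), ← ih, joinAt_of_gt s (by omega)]
    omega

lemma keptBefore_lt_keptBefore {s : ℕ → ℕ} {i j : ℕ} (hij : i < j) (hi : s i ≠ 0) :
    keptBefore s i < keptBefore s j :=
  Nat.count_strict_mono hi hij

lemma keptGen_mul_keptGen {i j : ℕ} (hij : i < j) (s : ℕ → ℕ) :
    keptGen (joinAt i s) j * keptGen s i = keptGen (joinAt (j + 1) s) i * keptGen s (j + 1) := by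
  have hcount := keptBefore_joinAt_of_gt hij s
  have hlt : s i ≠ 0 ∧ s (i + 1) ≠ 0 → keptBefore s i < keptBefore (joinAt i s) j := by
    intro h
    rw [← keptBefore_joinAt_of_le le_rfl s]
    refine keptBefore_lt_keptBefore hij ?_
    rw [joinAt_self, Ne, pair_eq_zero_iff]
    tauto
  simp (disch := omega) only [keptGen, joinAt_of_lt, joinAt_of_gt, keptBefore_joinAt_of_le]
  rw [← hcount]
  by_cases hi : s i ≠ 0 ∧ s (i + 1) ≠ 0
  · by_cases hj : s (j + 1) ≠ 0 ∧ s (j + 1 + 1) ≠ 0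
    · simp only [if_pos hi, if_pos hj]
      exact x_mul_x (hlt hi)
    · simp only [if_neg hj, one_mul, mul_one]
  · simp only [if_neg hi, one_mul, mul_one, add_zero]

/-- The action of `x j` on forests with deletions, recording what remains of it. -/
noncomputable def deletionPerm (j : ℕ) : Equiv.Perm ((ℕ → ℕ) × ThompsonF) where
  toFun a := (joinAt j a.1, keptGen a.1 j * a.2)
  invFun a := ((joinAt j).symm a.1, (keptGen ((joinAt j).symm a.1) j)⁻¹ * a.2)
  left_inv a := by simp
  right_inv a := by simp

lemma exists_deletion_hom : ∃ Φ : ThompsonF →* Equiv.Perm ((ℕ → ℕ) × ThompsonF),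
    ∀ i, Φ (x i) = deletionPerm i := by
  refine exists_hom_of_relations deletionPerm fun i j hij => Equiv.ext fun ⟨s, u⟩ => ?_
  refine Prod.ext (joinAt_joinAt hij s) ?_
  change keptGen (joinAt i s) j * (keptGen s i * u) =
    keptGen (joinAt (j + 1) s) i * (keptGen s (j + 1) * u)
  rw [← mul_assoc, keptGen_mul_keptGen hij, mul_assoc]

/-- The action of `F` on forests with deletions, recording what remains of each element. -/
noncomputable def deletionHom : ThompsonF →* Equiv.Perm ((ℕ → ℕ) × ThompsonF) :=
  exists_deletion_hom.choose

lemma deletionHom_x (i : ℕ) (s : ℕ → ℕ) (u : ThompsonF) :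
    deletionHom (x i) (s, u) = (joinAt i s, keptGen s i * u) := by
  rw [deletionHom, exists_deletion_hom.choose_spec i]
  rfl

lemma deletionHom_x_inv (i : ℕ) (s : ℕ → ℕ) (u : ThompsonF) :
    deletionHom (x i)⁻¹ (s, u) =
      ((joinAt i).symm s, (keptGen ((joinAt i).symm s) i)⁻¹ * u) := by
  rw [map_inv, deletionHom, exists_deletion_hom.choose_spec i]
  rfl

lemma keptGen_mem (n : ℕ) (s : ℕ → ℕ) {j : ℕ} (hj : j ≤ n) :
    keptGen s j ∈ Xset n ∨ keptGen s j = 1 := by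
  unfold keptGen
  split_ifs
  · exact Or.inl (x_mem_Xset ((keptBefore_le s j).trans hj))
  · exact Or.inr rfl

lemma exists_deletionHom_letter {n : ℕ} {a : ThompsonF} (ha : a ∈ Xset n ∨ a⁻¹ ∈ Xset n)
    (s : ℕ → ℕ) (u : ThompsonF) :
    ∃ t b, deletionHom a (s, u) = (t, b * u) ∧ ((b ∈ Xset n ∨ b⁻¹ ∈ Xset n) ∨ b = 1) := by
  rcases ha with ⟨i, hi, rfl⟩ | ⟨i, hi, h⟩
  · refine ⟨_, _, deletionHom_x i s u, ?_⟩
    have := keptGen_mem n s hi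
    tauto
  · rw [← inv_inv a, h]
    refine ⟨_, _, deletionHom_x_inv i s u, ?_⟩
    have := keptGen_mem n ((joinAt i).symm s) hi
    rw [inv_inv, inv_eq_one]
    tauto

/-- Deletion does not lengthen words over `X_n`. -/
lemma exists_deletionHom_prod {n : ℕ} {l : List ThompsonF}
    (hl : ∀ a ∈ l, a ∈ Xset n ∨ a⁻¹ ∈ Xset n) (s : ℕ → ℕ) (u : ThompsonF) :
    ∃ (t : ℕ → ℕ) (l' : List ThompsonF), deletionHom l.prod (s, u) = (t, l'.prod * u) ∧ l'.length ≤ l.length ∧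
      ∀ a ∈ l', a ∈ Xset n ∨ a⁻¹ ∈ Xset n := by
  induction l with
  | nil => exact ⟨s, [], by simp⟩
  | cons a l ih =>
    obtain ⟨t, l', h, hlen, hl'⟩ := ih fun b hb => hl b (List.mem_cons_of_mem a hb)
    obtain ⟨t', b, h', hb⟩ := exists_deletionHom_letter (hl a List.mem_cons_self) t (l'.prod * u)
    rw [List.prod_cons, map_mul, Equiv.Perm.mul_apply, h, h']
    rcases hb with hb | rfl
    · refine ⟨t', b :: l', by simp [mul_assoc], by simpa using hlen, ?_⟩
      simpa using ⟨hb, hl'⟩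
    · exact ⟨t', l', by simp, by simp; omega, hl'⟩

/-! ### Positive words -/

/-- The product of the generators with the given indices. -/
def posWord (w : List ℕ) : ThompsonF := (w.map x).prod

@[simp] lemma posWord_nil : posWord [] = 1 := rfl

@[simp] lemma posWord_cons (j : ℕ) (w : List ℕ) : posWord (j :: w) = x j * posWord w := by
  simp [posWord]

/-- Positive words survive unchanged if nothing is deleted. -/
lemma deletionHom_posWord_snd (w : List ℕ) {s : ℕ → ℕ} (hs : ∀ m, s m ≠ 0) (u : ThompsonF) :
    (∀ m, (deletionHom (posWord w) (s, u)).1 m ≠ 0) ∧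
      (deletionHom (posWord w) (s, u)).2 = posWord w * u := by
  induction w with
  | nil => simpa using hs
  | cons j w ih =>
    rw [posWord_cons, map_mul, Equiv.Perm.mul_apply]
    generalize deletionHom (posWord w) (s, u) = a at ih
    obtain ⟨t, v⟩ := a
    obtain ⟨ht, rfl⟩ := ih
    rw [deletionHom_x]
    have hcount : keptBefore t j = j := Nat.count_iff_forall.2 fun m _ => ht m
    refine ⟨fun m => ?_, ?_⟩
    · rcases lt_trichotomy m j with h | rfl | h
      · simpa only [joinAt_of_lt t h] using ht m
      · simpa only [joinAt_self, Ne, pair_eq_zero_iff] using fun h => ht _ h.1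
      · simpa only [joinAt_of_gt t h] using ht (m + 1)
    · simp [keptGen, ht, hcount, mul_assoc]

/-- `(x i)⁻¹` either cancels in a positive word, or can be moved through it to the right; in the
latter case the tree at the root `k + 1` travels to the root `i + 1`. -/
lemma posWord_cancel_or_push (w : List ℕ) (i : ℕ) :
    (∃ w' : List ℕ, w'.length + 1 = w.length ∧ x i * posWord w' = posWord w) ∨
    ∃ (w' : List ℕ) (k : ℕ), w'.length = w.length ∧ x i * posWord w' = posWord w * x k ∧
      ∀ (s : ℕ → ℕ) (u : ThompsonF), s (k + 1) = 0 →
        (deletionHom (posWord w') (s, u)).1 (i + 1) = 0 := by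
  induction w generalizing i with
  | nil => exact Or.inr ⟨[], i, by simp⟩
  | cons j w ih =>
    rcases lt_trichotomy j i with h | rfl | h
    · rcases ih (i + 1) with ⟨w', hlen, hw⟩ | ⟨w', k, hlen, hw, hdel⟩
      · refine Or.inl ⟨j :: w', by simpa using hlen, ?_⟩
        simp only [posWord_cons]
        rw [← hw, ← mul_assoc, x_mul_x h, mul_assoc]
      · refine Or.inr ⟨j :: w', k, by simpa using hlen, ?_, fun s u hs => ?_⟩
        · simp only [posWord_cons]
          rw [mul_assoc, ← hw, ← mul_assoc, x_mul_x h, mul_assoc]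
        · rw [posWord_cons, map_mul, Equiv.Perm.mul_apply, deletionHom_x]
          exact (joinAt_of_gt _ (by omega)).trans (hdel s u hs)
    · exact Or.inl ⟨w, by simp⟩
    · rcases ih i with ⟨w', hlen, hw⟩ | ⟨w', k, hlen, hw, hdel⟩
      · refine Or.inl ⟨(j + 1) :: w', by simpa using hlen, ?_⟩
        simp only [posWord_cons]
        rw [← hw, ← mul_assoc, ← mul_assoc, x_mul_x h]
      · refine Or.inr ⟨(j + 1) :: w', k, by simpa using hlen, ?_, fun s u hs => ?_⟩
        · simp only [posWord_cons]
          rw [mul_assoc, ← hw, ← mul_assoc, ← mul_assoc, x_mul_x h]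
        · rw [posWord_cons, map_mul, Equiv.Perm.mul_apply, deletionHom_x]
          exact (joinAt_of_lt _ (by omega)).trans (hdel s u hs)

lemma exists_posWord_fraction_of_list {l : List ThompsonF}
    (hl : ∀ a ∈ l, a ∈ Set.range x ∨ a⁻¹ ∈ Set.range x) :
    ∃ p q : List ℕ, p.length + q.length ≤ l.length ∧ l.prod = posWord p * (posWord q)⁻¹ := by
  induction l with
  | nil => exact ⟨[], [], by simp⟩
  | cons a l ih =>
    obtain ⟨p, q, hlen, h⟩ := ih fun b hb => hl b (List.mem_cons_of_mem a hb)
    rw [List.prod_cons, h, List.length_cons]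
    rcases hl a List.mem_cons_self with ⟨i, rfl⟩ | ⟨i, hi⟩
    · exact ⟨i :: p, q, by rw [List.length_cons]; omega, by simp [mul_assoc]⟩
    · obtain rfl : a = (x i)⁻¹ := by rw [hi, inv_inv]
      rcases posWord_cancel_or_push p i with ⟨p', hp, hw⟩ | ⟨p', k, hp, hw, -⟩
      · exact ⟨p', q, by omega, by rw [← hw]; group⟩
      · refine ⟨p', q ++ [k], by simp; omega, ?_⟩
        have hq : posWord (q ++ [k]) = posWord q * x k := by simp [posWord]
        rw [hq, eq_mul_inv_of_mul_eq hw.symm]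
        group

/-- Every element of `F` is a fraction of positive words realising its length `l_∞`. -/
lemma exists_posWord_fraction (g : ThompsonF) :
    ∃ p q : List ℕ, p.length + q.length ≤ linf g ∧ g = posWord p * (posWord q)⁻¹ := by
  obtain ⟨l, hlen, hl, rfl⟩ := exists_list_length_eq_wordLength closure_range_x g
  rw [linf, ← hlen]
  exact exists_posWord_fraction_of_list hl

lemma linf_posWord_fraction_le (p q : List ℕ) :
    linf (posWord p * (posWord q)⁻¹) ≤ p.length + q.length := by
  have h := wordLength_prod_le (S := Set.range x)
    (l := p.map x ++ ((q.map x).map (·⁻¹)).reverse) (by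
      intro a ha
      simp only [List.mem_append, List.mem_reverse, List.mem_map] at ha
      rcases ha with ⟨i, -, rfl⟩ | ⟨_, ⟨i, -, rfl⟩, rfl⟩
      · exact Or.inl ⟨i, rfl⟩
      · exact Or.inr ⟨i, (inv_inv _).symm⟩)
  rw [List.prod_append, ← List.prod_inv_reverse] at h
  simpa [linf, posWord] using h

/-- If right multiplication by `(x i)⁻¹` shortens `g` with respect to the infinite generating set,
then deleting a suitable leaf turns `g` into `g * (x i)⁻¹`. -/
lemma exists_deletionHom_eq_mul_x_inv {i : ℕ} {g : ThompsonF}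
    (h : linf (g * (x i)⁻¹) < linf g) :
    ∃ (s : ℕ → ℕ) (u : ThompsonF), (deletionHom g (s, u)).2 = g * (x i)⁻¹ * u := by
  obtain ⟨p, q, hlen, hg⟩ := exists_posWord_fraction (g * (x i)⁻¹)
  have hg' : g = posWord p * (posWord q)⁻¹ * x i := by rw [← hg]; group
  rcases posWord_cancel_or_push q i with ⟨q', hq, hw⟩ | ⟨q', k, hq, hw, hdel⟩
  · have hle := linf_posWord_fraction_le p q'
    have : g = posWord p * (posWord q')⁻¹ := by rw [hg', ← hw]; group
    rw [← this] at hle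
    omega
  · let e : ℕ → ℕ := fun m => if m = k + 1 then 0 else 1
    have hk : keptGen e k = 1 := by simp [keptGen, e]
    have hfull : ∀ m, joinAt k e m ≠ 0 := by
      intro m
      rcases lt_trichotomy m k with h | rfl | h
      · simp [joinAt_of_lt e h, e, show m ≠ k + 1 by omega]
      · simp [joinAt_self, pair_eq_zero_iff, e]
      · simp [joinAt_of_gt e h, e, show m ≠ k by omega]
    have hword : ∀ w : List ℕ, (deletionHom (posWord w * x k) (e, 1)).2 = posWord w := by
      intro w
      rw [map_mul, Equiv.Perm.mul_apply, deletionHom_x, hk,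
        (deletionHom_posWord_snd w hfull _).2, mul_one, mul_one]
    have hzero := hdel e 1 (by simp [e])
    have hqk := hword q
    rw [← hw, map_mul, Equiv.Perm.mul_apply] at hqk
    obtain ⟨s, u, hsu⟩ : ∃ s u, deletionHom (posWord q') (e, 1) = (s, u) := ⟨_, _, rfl⟩
    rw [hsu] at hzero hqk
    have hu : u = posWord q := by
      have hi : keptGen s i = 1 := if_neg fun h => h.2 hzero
      rw [deletionHom_x, hi, one_mul] at hqk
      exact hqk
    refine ⟨s, u, ?_⟩
    have hgq : g * posWord q' = posWord p * x k := by
      rw [hg', mul_assoc, hw]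
      group
    rw [← hsu, ← Equiv.Perm.mul_apply, ← map_mul, hgq, hword, hg, hu]
    group

theorem ln_decreases_of_linf_decreases (n : ℕ) (hn : 1 ≤ n) (i : ℕ) (hi : i ≤ n)
    (g : ThompsonF) (h : linf (g * (x i)⁻¹) + 1 = linf g) :
    ln n (g * (x i)⁻¹) + 1 = ln n g := by
  have hS := closure_Xset hn
  have hupper : ln n g ≤ ln n (g * (x i)⁻¹) + 1 := by
    simpa [ln] using wordLength_mul_le hS (g * (x i)⁻¹) (x_mem_Xset hi)
  obtain ⟨l, hlen, hl, hg⟩ := exists_list_length_eq_wordLength hS g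
  have hlower : ln n (g * (x i)⁻¹) ≤ ln n g := by
    obtain ⟨s, u, hsu⟩ := exists_deletionHom_eq_mul_x_inv (i := i) (g := g) (by omega)
    obtain ⟨t, l', ht, hlen', hl'⟩ := exists_deletionHom_prod hl s u
    rw [← hg, ht, hg] at hsu
    rw [← mul_right_cancel hsu, ln, ln, ← hlen]
    exact (wordLength_prod_le hl').trans hlen'
  have hne : ln n (g * (x i)⁻¹) ≠ ln n g := by
    intro heq
    obtain ⟨l', hlen', hl', hg'⟩ := exists_list_length_eq_wordLength hS (g * (x i)⁻¹)
    obtain ⟨ε, hε, hparity⟩ := exists_parity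
    have h1 := hparity n l hl
    have h2 := hparity n l' hl'
    have hlen_eq : l'.length = l.length := by rw [hlen, hlen']; exact heq
    rw [hg', map_mul, map_inv, hε, hlen_eq, ← h1, hg, mul_eq_left] at h2
    exact absurd h2 (by decide)
  omega
end

section
/- For every n ≥ 1, Thompson's group F is not almost convex with respect to the generating set X_n = {x_0, x_1, …, x_n}: for every constant L there exist a positive integer m and elements x, y ∈ F with l_n(x) ≤ m, l_n(y) ≤ m, and d_n(x, y) ≤ 2, such that there is no sequence x = z_0, z_1, …, z_j = y with j ≤ L, each z_{t+1} = z_t s_t for some s_t ∈ X_n ∪ X_n⁻¹, and l_n(z_t) ≤ m for all 0 ≤ t ≤ j. -/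
namespace ThompsonF

/-! ### The piecewise linear action of `F` on `ℚ` -/

/-- The homeomorphism of the line attached to `x_i`: a translation for `i = 0`, and for `i ≥ 1` the
map that stretches `[i - 1, i]` to `[i - 1, i + 1]` and translates everything to the right. -/
def expand : ℕ → ℚ → ℚ
  | 0, c => c + 1
  | i + 1, c => if c ≤ i then c else if c ≤ i + 1 then 2 * c - i else c + 1

/-- The inverse of `expand i`. -/
def contract : ℕ → ℚ → ℚ
  | 0, c => c - 1
  | i + 1, c => if c ≤ i then c else if c ≤ i + 2 then (c + i) / 2 else c - 1

theorem contract_expand (i : ℕ) (c : ℚ) : contract i (expand i c) = c := by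
  cases i <;> simp only [expand, contract] <;> (try split_ifs) <;> linarith

theorem expand_contract (i : ℕ) (c : ℚ) : expand i (contract i c) = c := by
  cases i <;> simp only [expand, contract] <;> (try split_ifs) <;> linarith

theorem expand_expand {i j : ℕ} (hij : i < j) (c : ℚ) :
    expand i (expand j c) = expand (j + 1) (expand i c) := by
  obtain ⟨j, rfl⟩ : ∃ k, j = k + 1 := ⟨j - 1, by omega⟩
  have hj : (0 : ℚ) ≤ j := by positivity
  cases i with
  | zero =>
    simp only [expand]
    push_cast
    split_ifs <;> linarith
  | succ i =>
    have hij' : (i : ℚ) + 1 ≤ j := by exact_mod_cast (by omega : i + 1 ≤ j)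
    simp only [expand]
    push_cast
    split_ifs <;> linarith

/-- `expand i` as a permutation of `ℚ`. -/
def expandPerm (i : ℕ) : Equiv.Perm ℚ :=
  ⟨expand i, contract i, contract_expand i, expand_contract i⟩

/-- The right action of `F` on `ℚ`. -/
def actionHom : ThompsonF →* (Equiv.Perm ℚ)ᵐᵒᵖ :=
  PresentedGroup.toGroup (f := fun i => MulOpposite.op (expandPerm i)) (by
    rintro _ ⟨i, j, hij, rfl⟩
    simp only [map_mul, map_inv, FreeGroup.lift_apply_of]
    rw [mul_inv_eq_one, mul_assoc, inv_mul_eq_iff_eq_mul]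
    apply MulOpposite.unop_injective
    ext c
    simp only [MulOpposite.unop_mul, MulOpposite.unop_op, Equiv.Perm.mul_apply]
    exact expand_expand hij c)

/-- The image of the point `c` under the right action of `g`. -/
def act (g : ThompsonF) (c : ℚ) : ℚ := (actionHom g).unop c

theorem act_mul (g h : ThompsonF) (c : ℚ) : act (g * h) c = act h (act g c) := by
  simp [act]

theorem act_x (i : ℕ) (c : ℚ) : act (x i) c = expand i c := by
  simp [act, actionHom, x, expandPerm]

theorem act_x_inv (i : ℕ) (c : ℚ) : act (x i)⁻¹ c = contract i c := by
  simp [act, actionHom, x, expandPerm]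

/-! ### Words and trajectories -/

/-- The element of `F` denoted by a letter: `(i, true)` is `x_i`, and `(i, false)` its inverse. -/
def letterVal (s : ℕ × Bool) : ThompsonF := if s.2 then x s.1 else (x s.1)⁻¹

/-- The element of `F` denoted by a word. -/
def wordVal (w : List (ℕ × Bool)) : ThompsonF := (w.map letterVal).prod

/-- The map of the line attached to a letter. -/
def move (s : ℕ × Bool) : ℚ → ℚ := if s.2 then expand s.1 else contract s.1

/-- The position of the point `c` after applying the letters of a word from left to right. -/
def traj : List (ℕ × Bool) → ℚ → ℚ
  | [], c => c
  | s :: w, c => traj w (move s c)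

theorem traj_cons (s : ℕ × Bool) (w : List (ℕ × Bool)) (c : ℚ) :
    traj (s :: w) c = traj w (move s c) := rfl

theorem act_letterVal (s : ℕ × Bool) (c : ℚ) : act (letterVal s) c = move s c := by
  obtain ⟨i, b⟩ := s
  cases b
  · simp [letterVal, move, act_x_inv]
  · simp [letterVal, move, act_x]

theorem wordVal_append (v w : List (ℕ × Bool)) : wordVal (v ++ w) = wordVal v * wordVal w := by
  simp [wordVal]

theorem act_wordVal (w : List (ℕ × Bool)) (c : ℚ) : act (wordVal w) c = traj w c := by
  induction w generalizing c with
  | nil => simp [wordVal, traj, act]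
  | cons s w ih =>
    have : wordVal (s :: w) = letterVal s * wordVal w := by simp [wordVal]
    rw [this, act_mul, act_letterVal, ih, traj]

theorem traj_append (v w : List (ℕ × Bool)) (c : ℚ) : traj (v ++ w) c = traj w (traj v c) := by
  induction v generalizing c with
  | nil => rfl
  | cons s v ih => exact ih _

theorem strictMono_expand (i : ℕ) : StrictMono (expand i) := by
  intro a b hab
  cases i <;> simp only [expand] <;> (try split_ifs) <;> linarith

theorem strictMono_contract (i : ℕ) : StrictMono (contract i) := by
  intro a b hab
  cases i <;> simp only [contract] <;> (try split_ifs) <;> linarith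

theorem strictMono_move (s : ℕ × Bool) : StrictMono (move s) := by
  unfold move
  split_ifs
  exacts [strictMono_expand _, strictMono_contract _]

theorem strictMono_traj (w : List (ℕ × Bool)) : StrictMono (traj w) := by
  induction w with
  | nil => exact strictMono_id
  | cons s w ih => exact ih.comp (strictMono_move s)

/-! ### Charging letters to points -/

/-- The unique position whose point is charged for a letter: the points separating the two trees
that are joined or split, or the point that the pointer (the origin) hops over. -/
def chargedPos : ℕ × Bool → ℚ
  | (0, true) => 0
  | (0, false) => 1
  | (i + 1, true) => i + 1 / 2
  | (i + 1, false) => i + 1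

/-- The number of letters of a word that are charged to the point starting at `c`. -/
def charge : List (ℕ × Bool) → ℚ → ℕ
  | [], _ => 0
  | s :: w, c => (if c = chargedPos s then 1 else 0) + charge w (move s c)

theorem charge_append (v w : List (ℕ × Bool)) (c : ℚ) :
    charge (v ++ w) c = charge v c + charge w (traj v c) := by
  induction v generalizing c with
  | nil => simp [charge, traj]
  | cons s v ih => simp [charge, traj, ih, add_assoc]

theorem sum_charge_le_length (w : List (ℕ × Bool)) (A : Finset ℚ) :
    ∑ c ∈ A, charge w c ≤ w.length := by
  induction w generalizing A with
  | nil => simp [charge]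
  | cons s w ih =>
    have hinj : Set.InjOn (move s) A := (strictMono_move s).injective.injOn
    have h := ih (A.image (move s))
    rw [Finset.sum_image hinj] at h
    simp only [charge, Finset.sum_add_distrib, Finset.sum_ite_eq', List.length_cons]
    split_ifs <;> omega

theorem exists_split_of_charge_ne_zero {w : List (ℕ × Bool)} {c : ℚ} (h : charge w c ≠ 0) :
    ∃ v s u, w = v ++ s :: u ∧ charge v c = 0 ∧ traj v c = chargedPos s := by
  induction w generalizing c with
  | nil => simp [charge] at h
  | cons s w ih =>
    by_cases hc : c = chargedPos s
    · exact ⟨[], s, w, rfl, rfl, hc⟩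
    · simp only [charge, if_neg hc, zero_add] at h
      obtain ⟨v, r, u, rfl, hv, ht⟩ := ih h
      exact ⟨s :: v, r, u, rfl, by simp [charge, hc, hv], ht⟩

/-- `c` is a positive integer. -/
def PosInt (c : ℚ) : Prop := ∃ k : ℤ, 0 < k ∧ c = k

/-- `c` is a nonpositive integer. -/
def NonposInt (c : ℚ) : Prop := ∃ k : ℤ, k ≤ 0 ∧ c = k

theorem PosInt.one_le {c : ℚ} (h : PosInt c) : 1 ≤ c := by
  obtain ⟨k, hk, rfl⟩ := h
  exact_mod_cast hk

theorem posInt_add_one_iff (c : ℚ) : PosInt (c + 1) ↔ PosInt c ∨ c = 0 := by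
  constructor
  · rintro ⟨k, hk, h⟩
    obtain hk' | hk' : k = 1 ∨ 0 < k - 1 := by omega
    · exact Or.inr (by subst hk'; push_cast at h; linarith)
    · exact Or.inl ⟨k - 1, hk', by push_cast; linarith⟩
  · rintro (⟨k, hk, rfl⟩ | rfl)
    · exact ⟨k + 1, by omega, by push_cast; ring⟩
    · exact ⟨1, by omega, by norm_num⟩

theorem posInt_natCast_add_one (i : ℕ) : PosInt (i + 1) := ⟨i + 1, by omega, by push_cast; ring⟩

theorem not_posInt_of_lt_of_lt {i : ℕ} {c : ℚ} (h : (i : ℚ) < c) (h' : c < i + 1) : ¬ PosInt c := by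
  rintro ⟨k, -, rfl⟩
  have h₁ : (i : ℤ) < k := by exact_mod_cast h
  have h₂ : k < i + 1 := by exact_mod_cast h'
  omega

theorem posInt_expand_iff (i : ℕ) (c : ℚ) :
    PosInt (expand i c) ↔ (PosInt c ↔ c ≠ chargedPos (i, true)) := by
  cases i with
  | zero =>
    rw [expand, chargedPos, posInt_add_one_iff]
    by_cases hc : c = 0
    · subst hc
      simp only [or_true, ne_eq, not_true_eq_false, iff_false, true_iff]
      exact fun h => absurd h.one_le (by norm_num)
    · simp [hc]
  | succ i =>
    have hi : (0 : ℚ) ≤ i := by positivity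
    simp only [expand, chargedPos]
    split_ifs with h₁ h₂
    · have : c ≠ i + 1 / 2 := by linarith
      simp only [ne_eq, this, not_false_eq_true, iff_true]
    · rcases eq_or_lt_of_le h₂ with rfl | h₃
      · have h₄ : 2 * ((i : ℚ) + 1) - i = ((i + 1 : ℕ) : ℚ) + 1 := by push_cast; ring
        simp only [h₄, posInt_natCast_add_one, true_iff]
        intro h
        linarith
      · simp only [not_posInt_of_lt_of_lt (not_le.1 h₁) h₃, false_iff, not_not]
        constructor
        · rintro ⟨k, -, hk⟩
          have h₄ : (i : ℤ) < k := by
            have : (i : ℚ) < k := by linarith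
            exact_mod_cast this
          have h₅ : k < i + 2 := by
            have : (k : ℚ) < i + 2 := by linarith
            exact_mod_cast this
          obtain rfl : k = i + 1 := by omega
          push_cast at hk
          linarith
        · rintro rfl
          have h₄ : 2 * ((i : ℚ) + 1 / 2) - i = i + 1 := by ring
          rw [h₄]
          exact posInt_natCast_add_one i
    · have h₃ : c ≠ i + 1 / 2 := by intro h; linarith
      have h₄ : c ≠ 0 := by intro h; linarith
      simp only [posInt_add_one_iff, h₄, or_false, ne_eq, h₃, not_false_eq_true, iff_true]

theorem expand_eq_chargedPos_iff (i : ℕ) (c : ℚ) :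
    expand i c = chargedPos (i, false) ↔ c = chargedPos (i, true) := by
  cases i with
  | zero => simp [expand, chargedPos]
  | succ i =>
    simp only [expand, chargedPos]
    split_ifs <;> constructor <;> intro h <;> linarith

theorem posInt_move_iff (s : ℕ × Bool) (c : ℚ) :
    PosInt (move s c) ↔ (PosInt c ↔ c ≠ chargedPos s) := by
  obtain ⟨i, b⟩ := s
  cases b
  · obtain ⟨d, rfl⟩ : ∃ d, c = expand i d := ⟨contract i c, (expand_contract i c).symm⟩
    simp only [move, Bool.false_eq_true, if_false, contract_expand, posInt_expand_iff, ne_eq,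
      expand_eq_chargedPos_iff]
    tauto
  · simp [move, posInt_expand_iff]

theorem NonposInt.move {s : ℕ × Bool} {c : ℚ} (h : NonposInt c) (hc : c ≠ chargedPos s) :
    NonposInt (move s c) := by
  obtain ⟨k, hk, rfl⟩ := h
  have hk' : (k : ℚ) ≤ 0 := by exact_mod_cast hk
  obtain ⟨i, b⟩ := s
  cases i with
  | zero =>
    cases b
    · exact ⟨k - 1, by omega, by simp [ThompsonF.move, contract]⟩
    · have : k ≠ 0 := by simpa [chargedPos] using hc
      exact ⟨k + 1, by omega, by simp [ThompsonF.move, expand]⟩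
  | succ i =>
    have hi : (k : ℚ) ≤ i := hk'.trans (by positivity)
    refine ⟨k, hk, ?_⟩
    cases b <;> simp [ThompsonF.move, expand, contract, hi]

theorem posInt_traj_iff (w : List (ℕ × Bool)) (c : ℚ) :
    PosInt (traj w c) ↔ (PosInt c ↔ Even (charge w c)) := by
  induction w generalizing c with
  | nil => simp [traj, charge]
  | cons s w ih =>
    rw [traj, ih, posInt_move_iff, charge]
    by_cases hc : c = chargedPos s
    · simp only [hc, ne_eq, not_true_eq_false, if_true, iff_false, Nat.even_add, Nat.not_even_one,
        false_iff]
      tauto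
    · simp [hc]

theorem NonposInt.traj {w : List (ℕ × Bool)} {c : ℚ} (h : NonposInt c) (hc : charge w c = 0) :
    NonposInt (traj w c) := by
  induction w generalizing c with
  | nil => exact h
  | cons s w ih =>
    simp only [charge, Nat.add_eq_zero_iff, ite_eq_right_iff, one_ne_zero, imp_false] at hc
    exact ih (h.move hc.1) hc.2

/-! ### Joins happen in a prescribed order -/

/-- `c` is a dyadic non-integer with denominator `2 ^ (e + 1)`, and `c'` lies beyond the right end
of the dyadic interval of which `c` is the midpoint. -/
def Rel (c c' : ℚ) : Prop :=
  ∃ (e : ℕ) (m : ℤ), c * 2 ^ (e + 1) = 2 * m + 1 ∧ c + 1 / 2 ^ (e + 1) ≤ c'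

theorem add_le_of_odd_numerator {c : ℚ} {e : ℕ} {m k : ℤ} (h : c * 2 ^ (e + 1) = 2 * m + 1)
    (hc : c ≤ k) : c + 1 / 2 ^ (e + 1) ≤ k := by
  have h2 : (0 : ℚ) < 2 ^ (e + 1) := by positivity
  have h₁ : ((2 * m + 1 : ℤ) : ℚ) ≤ ((2 * (2 ^ e * k) : ℤ) : ℚ) := by
    push_cast
    rw [← h]
    calc c * 2 ^ (e + 1) ≤ k * 2 ^ (e + 1) := by gcongr
      _ = _ := by ring
  have h₂ : 2 * m + 1 ≤ 2 * (2 ^ e * k) := by exact_mod_cast h₁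
  have h₃ : 2 * m + 2 ≤ 2 * (2 ^ e * k) := by omega
  have h₄ : ((2 * m + 2 : ℤ) : ℚ) ≤ ((2 * (2 ^ e * k) : ℤ) : ℚ) := by exact_mod_cast h₃
  push_cast at h₄
  rw [← mul_le_mul_iff_left₀ h2, add_mul, h, one_div_mul_cancel h2.ne']
  calc (2 * m + 1 + 1 : ℚ) = 2 * m + 2 := by ring
    _ ≤ 2 * (2 ^ e * k) := h₄
    _ = _ := by ring

theorem Rel.expand {i : ℕ} {c c' : ℚ} (h : Rel c c') (hc : c ≠ chargedPos (i, true)) :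
    Rel (expand i c) (expand i c') := by
  obtain ⟨e, m, hm, hle⟩ := h
  have hmono := (strictMono_expand i).monotone hle
  have hδ : (0 : ℚ) < 1 / 2 ^ (e + 1) := by positivity
  cases i with
  | zero =>
    refine ⟨e, m + 2 ^ e, ?_, ?_⟩
    · simp only [ThompsonF.expand]
      rw [add_mul, hm]
      push_cast
      ring
    · simp only [ThompsonF.expand]
      linarith
  | succ i =>
    by_cases h₁ : c ≤ i
    · have h₂ : c + 1 / 2 ^ (e + 1) ≤ i := by exact_mod_cast add_le_of_odd_numerator (k := i) hm h₁
      refine ⟨e, m, ?_, ?_⟩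
      · simpa [ThompsonF.expand, h₁] using hm
      · simpa only [ThompsonF.expand, if_pos h₁, if_pos h₂] using hmono
    · by_cases h₂ : c ≤ i + 1
      · have h₃ : c + 1 / 2 ^ (e + 1) ≤ i + 1 := by
          exact_mod_cast add_le_of_odd_numerator (k := i + 1) hm (by exact_mod_cast h₂)
        have h₄ : ¬ c + 1 / 2 ^ (e + 1) ≤ i := by linarith
        cases e with
        | zero =>
          exfalso
          apply hc
          simp only [zero_add, pow_one] at *
          have h₅ : (i : ℤ) ≤ m := by
            have h₆ : (2 * (i : ℤ) : ℚ) < ((2 * m + 1 : ℤ) : ℚ) := by push_cast; linarith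
            have : 2 * (i : ℤ) < 2 * m + 1 := by exact_mod_cast h₆
            omega
          have h₆ : m ≤ i := by
            have h₆ : ((2 * m + 1 : ℤ) : ℚ) ≤ (2 * (i : ℤ) + 2 : ℚ) := by push_cast; linarith
            have : 2 * m + 1 ≤ 2 * (i : ℤ) + 2 := by exact_mod_cast h₆
            omega
          obtain rfl : m = i := by omega
          simp only [chargedPos]
          push_cast at hm
          linarith
        | succ e =>
          refine ⟨e, m - i * 2 ^ e, ?_, ?_⟩
          · simp only [ThompsonF.expand, if_neg h₁, if_pos h₂]
            rw [pow_succ] at hm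
            push_cast
            rw [sub_mul, mul_assoc, mul_comm 2, mul_assoc, hm, pow_succ]
            ring
          · simp only [ThompsonF.expand, if_neg h₁, if_pos h₂, if_neg h₄, if_pos h₃] at hmono ⊢
            have : (1 : ℚ) / 2 ^ (e + 1) = 2 * (1 / 2 ^ (e + 1 + 1)) := by
              rw [pow_succ _ (e + 1)]
              field_simp
            linarith
      · have h₃ : ¬ c + 1 / 2 ^ (e + 1) ≤ i := by linarith
        have h₄ : ¬ c + 1 / 2 ^ (e + 1) ≤ i + 1 := by linarith
        simp only [ThompsonF.expand, if_neg h₃, if_neg h₄] at hmono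
        refine ⟨e, m + 2 ^ e, ?_, ?_⟩
        · simp only [ThompsonF.expand, if_neg h₁, if_neg h₂]
          rw [add_mul, hm]
          push_cast
          ring
        · simp only [ThompsonF.expand, if_neg h₁, if_neg h₂] at hmono ⊢
          linarith

theorem Rel.contract {i : ℕ} {c c' : ℚ} (h : Rel c c') : Rel (contract i c) (contract i c') := by
  obtain ⟨e, m, hm, hle⟩ := h
  have hmono := (strictMono_contract i).monotone hle
  have hδ : (0 : ℚ) < 1 / 2 ^ (e + 1) := by positivity
  cases i with
  | zero =>
    refine ⟨e, m - 2 ^ e, ?_, ?_⟩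
    · simp only [ThompsonF.contract]
      rw [sub_mul, hm]
      push_cast
      ring
    · simp only [ThompsonF.contract]
      linarith
  | succ i =>
    by_cases h₁ : c ≤ i
    · have h₂ : c + 1 / 2 ^ (e + 1) ≤ i := by exact_mod_cast add_le_of_odd_numerator (k := i) hm h₁
      refine ⟨e, m, ?_, ?_⟩
      · simpa [ThompsonF.contract, h₁] using hm
      · simpa only [ThompsonF.contract, if_pos h₁, if_pos h₂] using hmono
    · by_cases h₂ : c ≤ i + 2
      · have h₃ : c + 1 / 2 ^ (e + 1) ≤ i + 2 := by
          exact_mod_cast add_le_of_odd_numerator (k := i + 2) hm (by exact_mod_cast h₂)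
        have h₄ : ¬ c + 1 / 2 ^ (e + 1) ≤ i := by linarith
        refine ⟨e + 1, m + i * 2 ^ e, ?_, ?_⟩
        · simp only [ThompsonF.contract, if_neg h₁, if_pos h₂]
          rw [pow_succ, mul_comm _ (2 : ℚ), ← mul_assoc, div_mul_cancel₀ _ two_ne_zero, add_mul, hm]
          push_cast
          ring
        · simp only [ThompsonF.contract, if_neg h₁, if_pos h₂, if_neg h₄, if_pos h₃] at hmono ⊢
          have : (1 : ℚ) / 2 ^ (e + 1 + 1) = (1 / 2 ^ (e + 1)) / 2 := by
            rw [pow_succ _ (e + 1)]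
            field_simp
          linarith
      · have h₃ : ¬ c + 1 / 2 ^ (e + 1) ≤ i := by linarith
        have h₄ : ¬ c + 1 / 2 ^ (e + 1) ≤ i + 2 := by linarith
        simp only [ThompsonF.contract, if_neg h₃, if_neg h₄] at hmono
        refine ⟨e, m - 2 ^ e, ?_, ?_⟩
        · simp only [ThompsonF.contract, if_neg h₁, if_neg h₂]
          rw [sub_mul, hm]
          push_cast
          ring
        · simp only [ThompsonF.contract, if_neg h₁, if_neg h₂] at hmono ⊢
          linarith

theorem Rel.traj {w : List (ℕ × Bool)} {c c' : ℚ} (h : Rel c c') (hc : charge w c = 0) :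
    Rel (traj w c) (traj w c') := by
  induction w generalizing c c' with
  | nil => exact h
  | cons s w ih =>
    simp only [charge, Nat.add_eq_zero_iff, ite_eq_right_iff, one_ne_zero, imp_false] at hc
    refine ih ?_ hc.2
    obtain ⟨i, b⟩ := s
    cases b
    · exact h.contract
    · exact h.expand hc.1

theorem PosInt.add_one_le {c c' : ℚ} (h : PosInt c) (h' : PosInt c') (hlt : c < c') :
    c + 1 ≤ c' := by
  obtain ⟨k, -, rfl⟩ := h
  obtain ⟨k', -, rfl⟩ := h'
  exact_mod_cast (by exact_mod_cast hlt : k < k')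

theorem PosInt.traj {w : List (ℕ × Bool)} {c : ℚ} (h : PosInt c) (hc : charge w c = 0) :
    PosInt (traj w c) := by
  simp [posInt_traj_iff, h, hc]

/-- A letter charged to a positive integer is either the hop `x_0⁻¹` or a join `x_{i + 1}⁻¹`. -/
theorem eq_of_posInt_chargedPos {s : ℕ × Bool} (h : PosInt (chargedPos s)) :
    (s = (0, false) ∧ chargedPos s = 1) ∨ ∃ i : ℕ, s = (i + 1, false) ∧ chargedPos s = i + 1 := by
  match s with
  | (0, true) => exact absurd h.one_le (by norm_num [chargedPos])
  | (0, false) => exact Or.inl ⟨rfl, rfl⟩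
  | (i + 1, true) =>
    refine absurd h (not_posInt_of_lt_of_lt (i := i) ?_ ?_) <;> simp only [chargedPos] <;> linarith
  | (i + 1, false) => exact Or.inr ⟨i, rfl, rfl⟩

theorem chargedPos_le_of_posInt {n : ℕ} (hn : 1 ≤ n) {s : ℕ × Bool} (hs : s.1 ≤ n)
    (h : PosInt (chargedPos s)) : chargedPos s ≤ n := by
  obtain ⟨-, hs'⟩ | ⟨i, rfl, hs'⟩ := eq_of_posInt_chargedPos h
  · rw [hs']
    exact_mod_cast hn
  · rw [hs']
    exact_mod_cast hs

theorem rel_of_charge_eq_one {v u : List (ℕ × Bool)} {c c' : ℚ} (hc : PosInt c) (hc' : PosInt c')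
    (hlt : c < c') (h₁ : charge (v ++ u) c = 1) (hpos : 0 < traj (v ++ u) c)
    (hv : charge v c ≠ 0) (hv' : charge v c' = 0) :
    Rel (traj (v ++ u) c) (traj (v ++ u) c') := by
  obtain ⟨r, s, q, rfl, hr, hs⟩ := exists_split_of_charge_ne_zero hv
  have hr' : charge r c' = 0 := by
    rw [charge_append] at hv'
    omega
  have hP := hc.traj hr
  have hP' := hc'.traj hr'
  have hd := hP.add_one_le hP' (strictMono_traj r hlt)
  rw [List.append_assoc, List.cons_append] at h₁ hpos ⊢
  rw [charge_append, hr, zero_add, charge, if_pos hs, Nat.add_eq_left] at h₁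
  simp only [traj_append r, traj_cons] at hpos ⊢
  rw [hs] at hP
  obtain ⟨rfl, hs'⟩ | ⟨i, rfl, hs'⟩ := eq_of_posInt_chargedPos hP
  · have h0 : NonposInt (move (0, false) (traj r c)) :=
      ⟨0, le_rfl, by rw [hs, hs']; simp [move, contract]⟩
    obtain ⟨k, hk, hk'⟩ := h0.traj h₁
    rw [hk'] at hpos
    exact absurd (by exact_mod_cast hpos : 0 < k) (by omega)
  · refine Rel.traj ⟨0, i, ?_, ?_⟩ h₁
    · rw [hs, hs']
      simp only [move, contract, Bool.false_eq_true, if_false]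
      push_cast
      split_ifs <;> linarith
    · have h₂ := (strictMono_move (i + 1, false)).monotone hd
      refine le_trans ?_ h₂
      rw [hs, hs']
      simp only [move, contract, Bool.false_eq_true, if_false]
      split_ifs <;> linarith

/-! ### Intact blocks -/

theorem move_dyadic (s : ℕ × Bool) {d : ℕ} (hd : 1 ≤ d) (M : ℤ) : ∃ (d' : ℕ) (M' : ℤ), d ≤ d' + 1 ∧
    ∀ t : ℚ, 0 ≤ t → t ≤ 1 → move s ((M + t) / 2 ^ d) = (M' + t) / 2 ^ d' := by
  obtain ⟨d, rfl⟩ : ∃ e, d = e + 1 := ⟨d - 1, by omega⟩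
  have h2 : (0 : ℚ) < 2 ^ (d + 1) := by positivity
  have hle {k : ℤ} (hk : M + 1 ≤ k * 2 ^ (d + 1)) {t : ℚ} (ht : t ≤ 1) :
      (M + t) / 2 ^ (d + 1) ≤ k := by
    rw [div_le_iff₀ h2]
    have : ((M + 1 : ℤ) : ℚ) ≤ ((k * 2 ^ (d + 1) : ℤ) : ℚ) := by exact_mod_cast hk
    push_cast at this
    linarith
  have hge {k : ℤ} (hk : ¬ M + 1 ≤ k * 2 ^ (d + 1)) {t : ℚ} (ht : 0 ≤ t) :
      k ≤ (M + t) / 2 ^ (d + 1) := by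
    rw [le_div_iff₀ h2]
    have : ((k * 2 ^ (d + 1) : ℤ) : ℚ) ≤ (M : ℚ) := by
      exact_mod_cast (by omega : k * 2 ^ (d + 1) ≤ M)
    push_cast at this
    linarith
  obtain ⟨i, b⟩ := s
  cases i with
  | zero =>
    cases b
    · refine ⟨d + 1, M - 2 ^ (d + 1), by omega, fun t _ _ => ?_⟩
      simp only [move, contract, Bool.false_eq_true, if_false]
      push_cast
      field_simp
      ring
    · refine ⟨d + 1, M + 2 ^ (d + 1), by omega, fun t _ _ => ?_⟩
      simp only [move, expand, if_true]
      push_cast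
      field_simp
      ring
  | succ i =>
    by_cases h₁ : M + 1 ≤ i * 2 ^ (d + 1)
    · refine ⟨d + 1, M, by omega, fun t _ ht => ?_⟩
      have := hle h₁ ht
      push_cast at this
      cases b <;> simp [move, expand, contract, this]
    cases b
    · by_cases h₂ : M + 1 ≤ (i + 2 : ℤ) * 2 ^ (d + 1)
      · refine ⟨d + 2, M + i * 2 ^ (d + 1), by omega, fun t ht ht' => ?_⟩
        have h₃ := hge h₁ ht
        have h₄ := hle h₂ ht'
        push_cast at h₃ h₄ ⊢
        have h₅ : (M + i * 2 ^ (d + 1) + t : ℚ) / 2 ^ (d + 2) =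
            ((M + t) / 2 ^ (d + 1) + i) / 2 := by
          rw [pow_succ _ (d + 1)]
          field_simp
          ring
        rw [h₅]
        simp only [move, contract, Bool.false_eq_true, if_false]
        split_ifs <;> linarith
      · refine ⟨d + 1, M - 2 ^ (d + 1), by omega, fun t ht ht' => ?_⟩
        have h₄ := hge h₂ ht
        push_cast at h₄ ⊢
        have h₅ : (M - 2 ^ (d + 1) + t : ℚ) / 2 ^ (d + 1) = (M + t) / 2 ^ (d + 1) - 1 := by
          field_simp
          ring
        rw [h₅]
        simp only [move, contract, Bool.false_eq_true, if_false]
        split_ifs <;> linarith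
    · by_cases h₂ : M + 1 ≤ (i + 1 : ℤ) * 2 ^ (d + 1)
      · refine ⟨d, M - i * 2 ^ d, by omega, fun t ht ht' => ?_⟩
        have h₃ := hge h₁ ht
        have h₄ := hle h₂ ht'
        push_cast at h₃ h₄ ⊢
        have h₅ : (M - i * 2 ^ d + t : ℚ) / 2 ^ d = 2 * ((M + t) / 2 ^ (d + 1)) - i := by
          rw [pow_succ]
          field_simp
          ring
        rw [h₅]
        simp only [move, expand, if_true]
        split_ifs <;> linarith
      · refine ⟨d + 1, M + 2 ^ (d + 1), by omega, fun t ht ht' => ?_⟩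
        have h₄ := hge h₂ ht
        push_cast at h₄ ⊢
        have h₅ : (M + 2 ^ (d + 1) + t : ℚ) / 2 ^ (d + 1) = (M + t) / 2 ^ (d + 1) + 1 := by
          field_simp
          ring
        rw [h₅]
        simp only [move, expand, if_true]
        split_ifs <;> linarith

/-- The map `f` sends `σ, σ + 1, …, σ + n` to the left end, the midpoint, the midpoint of the right
half, … of a dyadic interval of length `2 ^ (-d)`. -/
def Intact (n : ℕ) (f : ℚ → ℚ) (σ : ℚ) (d : ℕ) : Prop :=
  ∃ M : ℤ, ∀ k : ℕ, k ≤ n → f (σ + k) = (M + (1 - 1 / 2 ^ k)) / 2 ^ d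

theorem Intact.move {n : ℕ} {f : ℚ → ℚ} {σ : ℚ} {d : ℕ} (h : Intact n f σ d) (hd : 1 ≤ d)
    (s : ℕ × Bool) : ∃ d', d ≤ d' + 1 ∧ Intact n (fun c => move s (f c)) σ d' := by
  obtain ⟨M, hM⟩ := h
  obtain ⟨d', M', hd', h'⟩ := move_dyadic s hd M
  refine ⟨d', hd', M', fun k hk => ?_⟩
  have h₁ : (0 : ℚ) < 1 / 2 ^ k := by positivity
  have h₂ : (1 : ℚ) / 2 ^ k ≤ 1 := by
    rw [div_le_one (by positivity)]
    exact one_le_pow₀ (by norm_num)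
  simp only [hM k hk]
  exact h' _ (by linarith) (by linarith)

theorem Intact.mul_two_pow {n : ℕ} {f : ℚ → ℚ} {σ : ℚ} {d : ℕ} (h : Intact n f σ d) :
    ∃ M : ℤ, ∀ k : ℕ, k ≤ n → f (σ + k) * 2 ^ (d + k) = ((M * 2 ^ k - 1 : ℤ) : ℚ) ∧
      f (σ + k) < M / 2 ^ d := by
  obtain ⟨M, hM⟩ := h
  refine ⟨M + 1, fun k hk => ?_⟩
  rw [hM k hk]
  constructor
  · rw [pow_add]
    push_cast
    field_simp
    ring
  · have h₁ : (0 : ℚ) < 1 / 2 ^ k := by positivity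
    push_cast
    gcongr
    linarith

theorem Intact.not_posInt {n : ℕ} {f : ℚ → ℚ} {σ : ℚ} {d k : ℕ} (h : Intact n f σ d)
    (hk : k ≠ 0) (hkn : k ≤ n) : ¬ PosInt (f (σ + k)) := by
  obtain ⟨M, hM⟩ := h.mul_two_pow
  rintro ⟨j, -, hj⟩
  have h₁ := (hM k hkn).1
  rw [hj] at h₁
  have h₂ : j * 2 ^ (d + k) = M * 2 ^ k - 1 := by exact_mod_cast h₁
  obtain ⟨k, rfl⟩ := Nat.exists_eq_succ_of_ne_zero hk
  have h₃ : 2 * (j * 2 ^ (d + k)) = 2 * (M * 2 ^ k) - 1 := by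
    rw [Nat.succ_eq_add_one, ← add_assoc, pow_succ, pow_succ] at h₂
    linarith
  omega

theorem Intact.not_rel {n : ℕ} {f : ℚ → ℚ} {σ : ℚ} {d k k' : ℕ} (h : Intact n f σ d)
    (hk : k ≤ n) (hk' : k' ≤ n) : ¬ Rel (f (σ + k)) (f (σ + k')) := by
  obtain ⟨M, hM⟩ := h.mul_two_pow
  rintro ⟨e, m, hm, hle⟩
  have h₁ := (hM k hk).1
  have h₂ := (hM k' hk').2
  have he : e + 1 ≤ d + k := by
    by_contra hlt
    obtain ⟨r, hr⟩ : ∃ r, e + 1 = d + k + (r + 1) := ⟨e - (d + k), by omega⟩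
    rw [hr, pow_add, ← mul_assoc, h₁] at hm
    have h₃ : (M * 2 ^ k - 1) * 2 ^ (r + 1) = 2 * m + 1 := by exact_mod_cast hm
    have h₄ : 2 * ((M * 2 ^ k - 1) * 2 ^ r) = 2 * m + 1 := by
      rw [← h₃]
      ring
    omega
  have h₃ : (1 : ℚ) / 2 ^ (d + k) ≤ 1 / 2 ^ (e + 1) :=
    one_div_le_one_div_of_le (by positivity) (pow_le_pow_right₀ (by norm_num) he)
  have h₄ : f (σ + k) + 1 / 2 ^ (d + k) = M / 2 ^ d := by
    rw [← eq_div_iff (by positivity)] at h₁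
    rw [h₁, pow_add]
    push_cast
    field_simp
    ring
  linarith

/-- The charges of the first points of an intact block: either there is a surplus of two among
`σ + 1, …, σ + n`, or the point `σ` is charged twice and gets close to the origin. -/
theorem Intact.charge_dichotomy {n : ℕ} (hn : 1 ≤ n) {w : List (ℕ × Bool)}
    (hw : ∀ s ∈ w, s.1 ≤ n) {σ : ℚ} {d : ℕ} (hσ : PosInt σ) (hpos : 0 < traj w σ)
    (h : Intact n (traj w) σ d) :
    (∀ k ∈ Finset.Icc 1 n, 1 ≤ charge w (σ + k)) ∧
    (n + 2 ≤ ∑ k ∈ Finset.Icc 1 n, charge w (σ + k) ∨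
      2 ≤ charge w σ ∧ ∃ v u, w = v ++ u ∧ traj v σ < 1) := by
  have hP (k : ℕ) : PosInt (σ + k) := by
    obtain ⟨j, hj, rfl⟩ := hσ
    exact ⟨j + k, by omega, by push_cast; ring⟩
  have hodd (k : ℕ) (hk : k ∈ Finset.Icc 1 n) : ¬ Even (charge w (σ + k)) := by
    obtain ⟨h₁, h₂⟩ := Finset.mem_Icc.1 hk
    have h₃ := h.not_posInt (by omega) h₂
    rw [posInt_traj_iff] at h₃
    exact fun h₄ => h₃ (by simp [hP, h₄])
  have hpos1 (k : ℕ) (hk : k ∈ Finset.Icc 1 n) : 1 ≤ charge w (σ + k) := by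
    by_contra hlt
    exact hodd k hk (by simp [(by omega : charge w (σ + k) = 0)])
  refine ⟨hpos1, ?_⟩
  by_cases hall : ∃ k ∈ Finset.Icc 1 n, charge w (σ + k) ≠ 1
  · left
    obtain ⟨k, hk, hk1⟩ := hall
    have hk3 : 3 ≤ charge w (σ + k) := by
      have h₁ := hodd k hk
      have h₂ : charge w (σ + k) ≠ 2 := fun h => h₁ (by simp [h])
      have := hpos1 k hk
      omega
    rw [← Finset.add_sum_erase _ _ hk]
    have hcard : ((Finset.Icc 1 n).erase k).card = n - 1 := by simp [Finset.card_erase_of_mem hk]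
    have := Finset.card_nsmul_le_sum ((Finset.Icc 1 n).erase k)
      (fun k : ℕ => charge w (σ + k)) 1 (fun k hk => hpos1 k (Finset.mem_of_mem_erase hk))
    rw [hcard, smul_eq_mul] at this
    omega
  · right
    push Not at hall
    have hn1 := hall n (by simp [hn])
    obtain ⟨v, s, u, hw', hv, hs⟩ := exists_split_of_charge_ne_zero
      (by omega : charge w (σ + n) ≠ 0)
    have hsn : traj v (σ + n) ≤ n := by
      have := (hP n).traj hv
      rw [hs] at this ⊢
      exact chargedPos_le_of_posInt hn (hw s (by simp [hw'])) this
    have hpos' (k : ℕ) : 0 < traj w (σ + k) :=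
      hpos.trans_le ((strictMono_traj w).monotone (by simp))
    have hv0 {k : ℕ} (hk : k < n) (h₁ : charge w (σ + k) = 1) :
        charge v (σ + k) = 0 := by
      by_contra hne
      have hp := hpos' k
      rw [hw'] at h₁ hp
      have hlt : σ + k < σ + n := by simpa using hk
      have := rel_of_charge_eq_one (hP k) (hP n) hlt h₁ hp hne hv
      rw [← hw'] at this
      exact h.not_rel hk.le le_rfl this
    have hdown (j : ℕ) (hj : j < n) :
        traj v (σ + ((n - j : ℕ) : ℚ)) ≤ ((n - j : ℕ) : ℚ) := by
      induction j with
      | zero => simpa using hsn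
      | succ j ih =>
        have h₁ : n - j = n - (j + 1) + 1 := by omega
        have h₂ := ih (by omega)
        have h₃ : PosInt (traj v (σ + ((n - j : ℕ) : ℚ))) := by
          rcases Nat.eq_zero_or_pos j with rfl | hj0
          · exact (hP n).traj hv
          · exact (hP _).traj (hv0 (by omega) (hall _ (by simp; omega)))
        have h₄ : PosInt (traj v (σ + ((n - (j + 1) : ℕ) : ℚ))) :=
          (hP _).traj (hv0 (by omega) (hall _ (by simp; omega)))
        have h₅ := h₄.add_one_le h₃ (strictMono_traj v (by rw [h₁]; push_cast; linarith))
        rw [h₁] at h₂ h₅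
        push_cast at h₂ h₅
        linarith
    have h1 : traj v σ < 1 := by
      have h₁ := hdown (n - 1) (by omega)
      rw [show n - (n - 1) = 1 by omega, Nat.cast_one] at h₁
      exact (strictMono_traj v (by linarith)).trans_le h₁
    refine ⟨?_, v, s :: u, hw', h1⟩
    have hne : charge v σ ≠ 0 := fun h₀ => absurd (hσ.traj h₀).one_le (not_le.2 h1)
    by_contra hlt
    have h₂ : charge w σ = 1 := by
      have : charge v σ ≤ charge w σ := by simp [hw', charge_append]
      omega
    exact hne (by simpa using hv0 (k := 0) (by omega) (by simpa using h₂))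

/-! ### Counting charges -/

theorem sum_charge_add_sum_charge_le_length (w : List (ℕ × Bool)) (R N : ℕ) :
    ∑ k ∈ Finset.range R, charge w (-(k : ℚ)) + ∑ i ∈ Finset.range N, charge w (1 + (i : ℚ)) ≤
      w.length := by
  have hinj : Set.InjOn (fun k : ℕ => -(k : ℚ)) (Finset.range R) := fun a _ b _ h => by
    simpa using h
  have hinj' : Set.InjOn (fun i : ℕ => 1 + (i : ℚ)) (Finset.range N) := fun a _ b _ h => by
    simpa using h
  have hdisj : Disjoint ((Finset.range R).image fun k : ℕ => -(k : ℚ))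
      ((Finset.range N).image fun i : ℕ => 1 + (i : ℚ)) := by
    rw [Finset.disjoint_left]
    intro c hc hc'
    obtain ⟨k, -, rfl⟩ := Finset.mem_image.1 hc
    obtain ⟨i, -, hi⟩ := Finset.mem_image.1 hc'
    have h₁ : (0 : ℚ) ≤ k := by positivity
    have h₂ : (0 : ℚ) ≤ i := by positivity
    linarith
  rw [← Finset.sum_image hinj, ← Finset.sum_image hinj', ← Finset.sum_union hdisj]
  exact sum_charge_le_length w _

theorem charge_le_charge_append (v u : List (ℕ × Bool)) (c : ℚ) :
    charge v c ≤ charge (v ++ u) c := by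
  simp [charge_append]

theorem NonposInt.le_zero {c : ℚ} (h : NonposInt c) : c ≤ 0 := by
  obtain ⟨k, hk, rfl⟩ := h
  exact_mod_cast hk

/-- The points `0, -1, …, 1 - R` all hop back and forth over the origin if the last of them ends at
a non-integer while `0` ends on the left of the origin. -/
theorem two_mul_le_sum_charge {w : List (ℕ × Bool)} {R : ℕ} (h0 : traj w 0 < 0)
    (hu : ¬ NonposInt (traj w (1 - R))) (hR : 1 ≤ R) :
    2 * R ≤ ∑ k ∈ Finset.range R, charge w (-(k : ℚ)) := by
  have hN (k : ℕ) : NonposInt (-(k : ℚ)) := ⟨-k, by omega, by push_cast; ring⟩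
  have hu₀ : (1 - R : ℚ) = -((R - 1 : ℕ) : ℚ) := by
    rw [Nat.cast_sub hR]
    push_cast
    ring
  rw [hu₀] at hu
  obtain ⟨v, s, q, rfl, hv, hs⟩ := exists_split_of_charge_ne_zero (fun h => hu ((hN _).traj h))
  have hone : 1 ≤ traj (v ++ [s]) (-((R - 1 : ℕ) : ℚ)) := by
    have h₁ := ((hN (R - 1)).traj hv).le_zero
    rw [traj_append, hs]
    rw [hs] at h₁
    match s with
    | (0, true) => simp [traj, move, expand, chargedPos]
    | (0, false) => norm_num [chargedPos] at h₁
    | (i + 1, true) =>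
      have : (0 : ℚ) ≤ i := by positivity
      simp only [chargedPos] at h₁
      linarith
    | (i + 1, false) =>
      have : (0 : ℚ) ≤ i := by positivity
      simp only [chargedPos] at h₁
      linarith
  have key (k : ℕ) (hk : k ∈ Finset.range R) : 2 ≤ charge (v ++ s :: q) (-(k : ℚ)) := by
    rw [Finset.mem_range] at hk
    by_contra hlt
    obtain h | h : charge (v ++ s :: q) (-(k : ℚ)) = 0 ∨ charge (v ++ s :: q) (-(k : ℚ)) = 1 := by
      omega
    · have h₁ : charge (v ++ [s]) (-(k : ℚ)) = 0 := by
        have := charge_le_charge_append (v ++ [s]) q (-(k : ℚ))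
        rw [List.append_assoc, List.singleton_append] at this
        omega
      have h₂ := ((hN k).traj h₁).le_zero
      have h₃ : traj (v ++ [s]) (-((R - 1 : ℕ) : ℚ)) ≤ traj (v ++ [s]) (-(k : ℚ)) := by
        apply (strictMono_traj _).monotone
        have : (k : ℚ) ≤ ((R - 1 : ℕ) : ℚ) := by exact_mod_cast (by omega : k ≤ R - 1)
        linarith
      linarith
    · have h₁ : PosInt (traj (v ++ s :: q) (-(k : ℚ))) := by
        rw [posInt_traj_iff, h]
        simp only [Nat.not_even_one, iff_false]
        exact fun h => absurd (hN k).le_zero (by linarith [h.one_le])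
      have h₂ : traj (v ++ s :: q) (-(k : ℚ)) ≤ traj (v ++ s :: q) 0 :=
        (strictMono_traj _).monotone (by simp)
      linarith [h₁.one_le]
  calc 2 * R = ∑ _k ∈ Finset.range R, 2 := by simp [mul_comm]
    _ ≤ _ := Finset.sum_le_sum key

theorem sum_range_mul (f : ℕ → ℕ) (B S : ℕ) :
    ∑ i ∈ Finset.range (B * S), f i =
      ∑ j ∈ Finset.range B, ∑ k ∈ Finset.range S, f (j * S + k) := by
  induction B with
  | zero => simp
  | succ B ih => rw [Nat.succ_mul, Finset.sum_range_add, ih, Finset.sum_range_succ]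

theorem sum_range_eq_add_add (f : ℕ → ℕ) {n S : ℕ} (h : n < S) :
    ∑ k ∈ Finset.range S, f k =
      f 0 + ∑ k ∈ Finset.Icc 1 n, f k + ∑ k ∈ Finset.Ico (n + 1) S, f k := by
  rw [Finset.range_eq_Ico, ← Finset.sum_Ico_consecutive f (Nat.zero_le (n + 1)) (by omega),
    ← Finset.sum_Ico_consecutive f (Nat.zero_le 1) (by omega)]
  simp [Finset.Ico_add_one_right_eq_Icc]

theorem sub_le_sum_Ico {f : ℕ → ℕ} {a b : ℕ} (h : ∀ k, a ≤ k → k < b → 1 ≤ f k) :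
    b - a ≤ ∑ k ∈ Finset.Ico a b, f k := by
  calc b - a = ∑ _k ∈ Finset.Ico a b, 1 := by simp
    _ ≤ _ := Finset.sum_le_sum fun k hk => h k (Finset.mem_Ico.1 hk).1 (Finset.mem_Ico.1 hk).2

/-- The points to the right of the origin are arranged in `B` intact blocks of length `S`, and no
point in the interior of one of the blocks from the `J`-th on ends at a positive integer. -/
theorem mul_le_sum_charge {n S B J : ℕ} (hn : 1 ≤ n) (hS : n < S) (hJ : J + n ≤ B)
    {w : List (ℕ × Bool)} (hw : ∀ s ∈ w, s.1 ≤ n) (h0 : 0 ≤ traj w 0)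
    (hintact : ∀ j < B, ∃ d, Intact n (traj w) (1 + ((j * S : ℕ) : ℚ)) d)
    (hfar : ∀ j < B, J ≤ j → ∀ k, n < k → k < S →
      ¬ PosInt (traj w (1 + ((j * S + k : ℕ) : ℚ)))) :
    B * (S + 1) ≤ ∑ i ∈ Finset.range (B * S), charge w (1 + (i : ℚ)) := by
  have hP (i : ℕ) : PosInt (1 + (i : ℚ)) := ⟨1 + i, by omega, by push_cast; ring⟩
  set f : ℕ → ℕ := fun i => charge w (1 + (i : ℚ)) with hf
  have hblock (j : ℕ) (hj : j < B) :
      (∀ k ∈ Finset.Icc 1 n, 1 ≤ f (j * S + k)) ∧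
      (n + 2 ≤ ∑ k ∈ Finset.Icc 1 n, f (j * S + k) ∨
        2 ≤ f (j * S) ∧ ∃ v u, w = v ++ u ∧ traj v (1 + ((j * S : ℕ) : ℚ)) < 1) := by
    obtain ⟨d, hd⟩ := hintact j hj
    have hpos : 0 < traj w (1 + ((j * S : ℕ) : ℚ)) :=
      h0.trans_lt (strictMono_traj w (by positivity))
    have := hd.charge_dichotomy hn hw (hP _) hpos
    simpa only [hf, Nat.cast_add, add_assoc] using this
  have hsum (g : ℕ → ℕ) (j : ℕ) := sum_range_eq_add_add (fun k => g (j * S + k)) hS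
  simp only [add_zero] at hsum
  by_cases hrest : ∀ j < B, ∀ k, n < k → k < S → 1 ≤ f (j * S + k)
  · rw [sum_range_mul f B S]
    calc B * (S + 1) = ∑ _j ∈ Finset.range B, (S + 1) := by simp
      _ ≤ _ := Finset.sum_le_sum fun j hj => ?_
    rw [Finset.mem_range] at hj
    rw [hsum f j]
    have h₁ := sub_le_sum_Ico (f := fun k => f (j * S + k)) (a := n + 1) (hrest j hj)
    have h₂ := sub_le_sum_Ico (f := fun k => f (j * S + k)) (a := 1) (b := n + 1)
      fun k hk hk' => (hblock j hj).1 k (by simp; omega)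
    rw [Finset.Ico_add_one_right_eq_Icc] at h₂
    obtain h₃ | ⟨h₃, -⟩ := (hblock j hj).2 <;> omega
  · push Not at hrest
    obtain ⟨j₀, hj₀, k₀, hk₀, hk₀S, hf₀⟩ := hrest
    have hf₀ : charge w (1 + ((j₀ * S + k₀ : ℕ) : ℚ)) = 0 := by
      simp only [hf] at hf₀
      omega
    have hj₀J : j₀ < J := by
      by_contra hle
      exact hfar j₀ hj₀ (by omega) k₀ hk₀ hk₀S ((hP _).traj hf₀)
    set g : ℕ → ℕ := fun i => f i + if f i = 0 then 1 else 0 with hg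
    have hg1 (i : ℕ) : 1 ≤ g i := by
      simp only [hg]
      split_ifs <;> omega
    have hfg (i : ℕ) : f i ≤ g i := by simp [hg]
    have hgblock (j : ℕ) (hj : j ∈ Finset.range B) :
        S + 1 + (if j₀ < j then 1 else 0) ≤ ∑ k ∈ Finset.range S, g (j * S + k) := by
      rw [Finset.mem_range] at hj
      rw [hsum g j]
      have h₁ := sub_le_sum_Ico (f := fun k => g (j * S + k)) (a := n + 1) (b := S)
        fun k _ _ => hg1 _
      have h₂ := sub_le_sum_Ico (f := fun k => g (j * S + k)) (a := 1) (b := n + 1)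
        fun k _ _ => hg1 _
      have h₃ := hg1 (j * S)
      rw [Finset.Ico_add_one_right_eq_Icc] at h₂
      obtain h₄ | ⟨h₄, v, u, hvu, hv⟩ := (hblock j hj).2
      · have h₅ : ∑ k ∈ Finset.Icc 1 n, f (j * S + k) ≤ ∑ k ∈ Finset.Icc 1 n, g (j * S + k) :=
          Finset.sum_le_sum fun k _ => hfg _
        split_ifs <;> omega
      · have h₅ : ¬ j₀ < j := by
          intro hlt
          have h₆ : charge v (1 + ((j₀ * S + k₀ : ℕ) : ℚ)) = 0 := by
            have := charge_le_charge_append v u (1 + ((j₀ * S + k₀ : ℕ) : ℚ))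
            rw [← hvu] at this
            omega
          have h₇ : j₀ * S + k₀ < j * S := by
            have : (j₀ + 1) * S ≤ j * S := Nat.mul_le_mul_right S hlt
            rw [Nat.add_mul, one_mul] at this
            omega
          have h₈ : traj v (1 + ((j₀ * S + k₀ : ℕ) : ℚ)) < traj v (1 + ((j * S : ℕ) : ℚ)) :=
            strictMono_traj v (by gcongr)
          linarith [((hP _).traj h₆).one_le]
        have h₆ := hfg (j * S)
        rw [if_neg h₅]
        omega
    have hgsum : B * (S + 1) + (B - 1 - j₀) ≤ ∑ i ∈ Finset.range (B * S), g i := by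
      rw [sum_range_mul g B S]
      refine le_trans (le_of_eq ?_) (Finset.sum_le_sum hgblock)
      have hcard : ((Finset.range B).filter fun j => j₀ < j) = Finset.Ioo j₀ B := by
        ext j
        simp [and_comm]
      rw [Finset.sum_add_distrib, ← Finset.card_filter, hcard]
      simp only [Finset.sum_const, Finset.card_range, smul_eq_mul, Nat.card_Ioo]
      omega
    have hZ : ((Finset.range (B * S)).filter fun i => f i = 0).card ≤ n := by
      obtain ⟨b, rfl⟩ : ∃ b, B = b + 1 := ⟨B - 1, by omega⟩
      have hq : charge w (1 + ((b * S + 1 : ℕ) : ℚ)) ≠ 0 := by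
        have := (hblock b (by omega)).1 1 (by simp [hn])
        simp only [hf] at this
        omega
      obtain ⟨v, s, u, hvu, hv, hs⟩ := exists_split_of_charge_ne_zero hq
      have hqn : traj v (1 + ((b * S + 1 : ℕ) : ℚ)) ≤ n := by
        have := (hP _).traj hv
        rw [hs] at this ⊢
        exact chargedPos_le_of_posInt hn (hw s (by simp [hvu])) this
      have hPv (i : ℕ) (hi : f i = 0) : PosInt (traj v (1 + (i : ℚ))) := by
        apply (hP i).traj
        have := charge_le_charge_append v (s :: u) (1 + (i : ℚ))
        rw [← hvu] at this
        simp only [hf] at hi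
        omega
      calc _ ≤ (Finset.Icc 1 (n : ℤ)).card := ?_
        _ = n := by simp
      refine Finset.card_le_card_of_injOn (fun i => ⌊traj v (1 + (i : ℚ))⌋) ?_ ?_
      · intro i hi
        obtain ⟨hi, hi0⟩ := Finset.mem_filter.1 hi
        rw [Finset.mem_range] at hi
        have hib : i < b * S + 1 := by
          by_contra hle
          obtain ⟨k, rfl⟩ : ∃ k, i = b * S + k := ⟨i - b * S, by omega⟩
          rw [Nat.succ_mul] at hi
          by_cases hk : k ≤ n
          · have := (hblock b (by omega)).1 k (by simp; omega)
            omega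
          · refine hfar b (by omega) (by omega) k (by omega) (by omega) ((hP _).traj ?_)
            exact hi0
        have h₁ := (hPv i hi0).one_le
        have h₂ : traj v (1 + (i : ℚ)) < traj v (1 + ((b * S + 1 : ℕ) : ℚ)) :=
          strictMono_traj v (by gcongr)
        simp only [Finset.coe_Icc, Set.mem_Icc]
        refine ⟨Int.le_floor.2 (by exact_mod_cast h₁), ?_⟩
        have h₃ : (⌊traj v (1 + (i : ℚ))⌋ : ℚ) ≤ n := (Int.floor_le _).trans (h₂.le.trans hqn)
        exact_mod_cast h₃
      · intro i hi i' hi' h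
        obtain ⟨l, -, hl⟩ := hPv i (Finset.mem_filter.1 hi).2
        obtain ⟨l', -, hl'⟩ := hPv i' (Finset.mem_filter.1 hi').2
        simp only [hl, hl', Int.floor_intCast] at h
        rw [h, ← hl'] at hl
        simpa using (strictMono_traj v).injective hl
    have hsumg : ∑ i ∈ Finset.range (B * S), g i = ∑ i ∈ Finset.range (B * S), f i +
        ((Finset.range (B * S)).filter fun i => f i = 0).card := by
      rw [Finset.card_filter, ← Finset.sum_add_distrib]
    change B * (S + 1) ≤ ∑ i ∈ Finset.range (B * S), f i
    omega

/-! ### The effect of short words -/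

theorem Intact.traj {n : ℕ} {f : ℚ → ℚ} {σ : ℚ} {d : ℕ} (h : Intact n f σ d)
    (q : List (ℕ × Bool)) (hq : q.length ≤ d) :
    ∃ d', Intact n (fun c => traj q (f c)) σ d' := by
  induction q generalizing f d with
  | nil => exact ⟨d, h⟩
  | cons s q ih =>
    rw [List.length_cons] at hq
    obtain ⟨d', hd', h'⟩ := h.move (by omega) s
    exact ih h' (by omega)

theorem exists_traj_eq_add_of_le (q : List (ℕ × Bool)) :
    ∃ δ : ℤ, ∀ c : ℚ, c ≤ -q.length → traj q c = c + δ := by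
  induction q with
  | nil => exact ⟨0, fun c _ => by simp [traj]⟩
  | cons s q ih =>
    obtain ⟨δ, hδ⟩ := ih
    have hl : (0 : ℚ) ≤ q.length := by positivity
    suffices ∃ ε : ℤ, ε ≤ 1 ∧ ∀ c : ℚ, c ≤ 0 → move s c = c + ε by
      obtain ⟨ε, hε, h⟩ := this
      refine ⟨ε + δ, fun c hc => ?_⟩
      have hε' : (ε : ℚ) ≤ 1 := by exact_mod_cast hε
      simp only [List.length_cons, Nat.cast_add, Nat.cast_one] at hc
      rw [traj_cons, h c (by linarith), hδ _ (by linarith)]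
      push_cast
      ring
    match s with
    | (0, true) => exact ⟨1, by omega, fun c _ => by simp [move, expand]⟩
    | (0, false) => exact ⟨-1, by omega, fun c _ => by simp [move, contract, sub_eq_add_neg]⟩
    | (i + 1, b) =>
      refine ⟨0, by omega, fun c hc => ?_⟩
      have hi : c ≤ i := hc.trans (by positivity)
      cases b <;> simp [move, expand, contract, hi]

theorem exists_traj_eq_add_of_ge {n : ℕ} (q : List (ℕ × Bool)) (hq : ∀ s ∈ q, s.1 ≤ n) :
    ∃ δ : ℤ, ∀ c : ℚ, n + 1 + q.length ≤ c → traj q c = c + δ := by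
  induction q with
  | nil => exact ⟨0, fun c _ => by simp [traj]⟩
  | cons s q ih =>
    obtain ⟨δ, hδ⟩ := ih fun s hs => hq s (List.mem_cons_of_mem _ hs)
    have hl : (0 : ℚ) ≤ q.length := by positivity
    suffices ∃ ε : ℤ, -1 ≤ ε ∧ ∀ c : ℚ, n + 1 ≤ c → move s c = c + ε by
      obtain ⟨ε, hε, h⟩ := this
      refine ⟨ε + δ, fun c hc => ?_⟩
      have hε' : (-1 : ℚ) ≤ ε := by exact_mod_cast hε
      simp only [List.length_cons, Nat.cast_add, Nat.cast_one] at hc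
      rw [traj_cons, h c (by linarith), hδ _ (by linarith)]
      push_cast
      ring
    have hs := hq s List.mem_cons_self
    match s with
    | (0, true) => exact ⟨1, by omega, fun c _ => by simp [move, expand]⟩
    | (0, false) => exact ⟨-1, by omega, fun c _ => by simp [move, contract, sub_eq_add_neg]⟩
    | (i + 1, true) =>
      refine ⟨1, by omega, fun c hc => ?_⟩
      have hi : (i : ℚ) + 1 ≤ n := by exact_mod_cast hs
      simp only [move, expand, if_true]
      push_cast
      split_ifs <;> linarith
    | (i + 1, false) =>
      refine ⟨-1, by omega, fun c hc => ?_⟩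
      have hi : (i : ℚ) + 1 ≤ n := by exact_mod_cast hs
      simp only [move, contract, Bool.false_eq_true, if_false]
      push_cast
      split_ifs <;> linarith

/-! ### The two elements -/

/-- The word `x_n⁻¹ ⋯ x_1⁻¹`. -/
def combWord : ℕ → List (ℕ × Bool)
  | 0 => []
  | n + 1 => (n + 1, false) :: combWord n

/-- The word `x_n⁻¹ ⋯ x_1⁻¹ x_1 ^ (-L)`, which collapses `[0, L + n + 1]` to `[0, 1]`. -/
def tauWord (n L : ℕ) : List (ℕ × Bool) := combWord n ++ List.replicate L (1, false)

/-- The word `(x_0⁻¹ τ) ^ B`. -/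
def roundsWord (n L : ℕ) : ℕ → List (ℕ × Bool)
  | 0 => []
  | B + 1 => (0, false) :: tauWord n L ++ roundsWord n L B

/-- The word `x_0 ^ (r + 1) x_1⁻¹ x_0 ^ (-t)`. -/
def hopWord (r t : ℕ) : List (ℕ × Bool) :=
  List.replicate (r + 1) (0, true) ++ (1, false) :: List.replicate t (0, false)

/-- The word for the first of the two elements. -/
def leftWord (n L : ℕ) : List (ℕ × Bool) :=
  hopWord (L + 2) (L + 2) ++ roundsWord n L (L + 2 * n + 2) ++
    List.replicate (L + 2 * n + 1) (0, true)

/-- The word for the second of the two elements. -/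
def rightWord (n L : ℕ) : List (ℕ × Bool) :=
  roundsWord n L (L + 2 * n + 2) ++ List.replicate (L + 2 * n + 2) (0, true) ++
    hopWord (L + 2) (L + 1)

theorem length_combWord (n : ℕ) : (combWord n).length = n := by
  induction n with
  | zero => rfl
  | succ n ih => simp [combWord, ih]

theorem length_roundsWord (n L B : ℕ) : (roundsWord n L B).length = B * (L + n + 1) := by
  induction B with
  | zero => simp [roundsWord]
  | succ B ih =>
    simp only [roundsWord, tauWord, List.length_append, List.length_cons, length_combWord,
      List.length_replicate, ih]
    ring

theorem length_leftWord (n L : ℕ) :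
    (leftWord n L).length + 1 = 2 * (L + 3) + (L + 2 * n + 2) * (L + n + 1 + 1) := by
  simp only [leftWord, hopWord, List.length_append, List.length_cons, length_roundsWord,
    List.length_replicate]
  ring

theorem length_rightWord (n L : ℕ) :
    (rightWord n L).length + 1 = 2 * (L + 3) + (L + 2 * n + 2) * (L + n + 1 + 1) := by
  simp only [rightWord, hopWord, List.length_append, List.length_cons, length_roundsWord,
    List.length_replicate]
  ring

theorem mem_combWord {n : ℕ} {s : ℕ × Bool} (h : s ∈ combWord n) : 1 ≤ s.1 ∧ s.1 ≤ n := by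
  induction n with
  | zero => simp [combWord] at h
  | succ n ih =>
    rcases List.mem_cons.1 h with rfl | h
    · simp
    · have := ih h
      omega

theorem mem_tauWord {n L : ℕ} (hn : 1 ≤ n) {s : ℕ × Bool} (h : s ∈ tauWord n L) :
    1 ≤ s.1 ∧ s.1 ≤ n := by
  rcases List.mem_append.1 h with h | h
  · exact mem_combWord h
  · obtain rfl := List.eq_of_mem_replicate h
    exact ⟨le_rfl, hn⟩

theorem mem_roundsWord {n L B : ℕ} (hn : 1 ≤ n) {s : ℕ × Bool} (h : s ∈ roundsWord n L B) :
    s.1 ≤ n := by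
  induction B with
  | zero => simp [roundsWord] at h
  | succ B ih =>
    rcases List.mem_append.1 h with h | h
    · rcases List.mem_cons.1 h with rfl | h
      · simp
      · exact (mem_tauWord hn h).2
    · exact ih h

theorem mem_hopWord {n r t : ℕ} (hn : 1 ≤ n) {s : ℕ × Bool} (h : s ∈ hopWord r t) : s.1 ≤ n := by
  simp only [hopWord, List.mem_append, List.mem_cons, List.mem_replicate] at h
  rcases h with ⟨-, rfl⟩ | rfl | ⟨-, rfl⟩ <;> simp [hn]

theorem mem_leftWord {n L : ℕ} (hn : 1 ≤ n) {s : ℕ × Bool} (h : s ∈ leftWord n L) : s.1 ≤ n := by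
  rcases List.mem_append.1 h with h | h
  · rcases List.mem_append.1 h with h | h
    · exact mem_hopWord hn h
    · exact mem_roundsWord hn h
  · simp [List.eq_of_mem_replicate h]

theorem mem_rightWord {n L : ℕ} (hn : 1 ≤ n) {s : ℕ × Bool} (h : s ∈ rightWord n L) :
    s.1 ≤ n := by
  rcases List.mem_append.1 h with h | h
  · rcases List.mem_append.1 h with h | h
    · exact mem_roundsWord hn h
    · simp [List.eq_of_mem_replicate h]
  · exact mem_hopWord hn h

/-! ### The action of the two elements -/

theorem traj_replicate_zero_true (k : ℕ) (c : ℚ) :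
    traj (List.replicate k (0, true)) c = c + k := by
  induction k generalizing c with
  | zero => simp [traj]
  | succ k ih =>
    rw [List.replicate_succ, traj_cons, ih]
    simp only [move, expand, if_true]
    push_cast
    ring

theorem traj_replicate_zero_false (k : ℕ) (c : ℚ) :
    traj (List.replicate k (0, false)) c = c - k := by
  induction k generalizing c with
  | zero => simp [traj]
  | succ k ih =>
    rw [List.replicate_succ, traj_cons, ih]
    simp only [move, contract, Bool.false_eq_true, if_false]
    push_cast
    ring

theorem traj_hopWord (r t : ℕ) (c : ℚ) :
    traj (hopWord r t) c = contract 1 (c + r + 1) - t := by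
  rw [hopWord, traj_append, traj_cons, traj_replicate_zero_true, traj_replicate_zero_false]
  simp only [move, Bool.false_eq_true, if_false]
  push_cast
  ring_nf

theorem contract_one_of_le {c : ℚ} (hc : c ≤ 0) : contract 1 c = c := by
  simp [contract, hc]

theorem contract_one_of_mem {c : ℚ} (hc : 0 ≤ c) (hc' : c ≤ 2) : contract 1 c = c / 2 := by
  simp only [contract]
  push_cast
  split_ifs <;> linarith

theorem contract_one_of_ge {c : ℚ} (hc : 2 ≤ c) : contract 1 c = c - 1 := by
  simp only [contract]
  push_cast
  split_ifs <;> linarith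

theorem traj_combWord_of_le (n : ℕ) {c : ℚ} (hc : c ≤ 0) : traj (combWord n) c = c := by
  induction n with
  | zero => rfl
  | succ n ih =>
    have hn : c ≤ n := hc.trans (by positivity)
    rw [combWord, traj_cons]
    simpa [move, contract, hn] using ih

theorem traj_combWord_of_ge (n : ℕ) {c : ℚ} (hc : n + 1 ≤ c) : traj (combWord n) c = c - n := by
  induction n generalizing c with
  | zero => simp [combWord, traj]
  | succ n ih =>
    push_cast at hc
    have h₁ : move (n + 1, false) c = c - 1 := by
      simp only [move, contract, Bool.false_eq_true, if_false]
      split_ifs <;> linarith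
    rw [combWord, traj_cons, h₁, ih (by linarith)]
    push_cast
    ring

theorem traj_combWord_add (n : ℕ) {t : ℚ} (ht : 0 ≤ t) (ht' : t ≤ 1) :
    traj (combWord n) (n + t) = 1 - (1 - t) / 2 ^ n := by
  induction n generalizing t with
  | zero => simp [combWord, traj]
  | succ n ih =>
    have h₁ : move (n + 1, false) ((n + 1 : ℕ) + t) = n + (1 + t) / 2 := by
      simp only [move, contract, Bool.false_eq_true, if_false]
      push_cast
      split_ifs <;> linarith
    rw [combWord, traj_cons, h₁, ih (by linarith) (by linarith), pow_succ]
    field_simp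
    ring

theorem traj_combWord_natCast {n k : ℕ} (hk : k ≤ n) :
    traj (combWord n) k = 1 - 1 / 2 ^ k := by
  induction n with
  | zero =>
    obtain rfl : k = 0 := by omega
    simp [combWord, traj]
  | succ n ih =>
    obtain rfl | hk' : k = n + 1 ∨ k ≤ n := by omega
    · simpa using traj_combWord_add (n + 1) (t := 0) le_rfl zero_le_one
    · have hkn : (k : ℚ) ≤ n := by exact_mod_cast hk'
      rw [combWord, traj_cons, ← ih hk']
      simp [move, contract, hkn]

theorem traj_replicate_one_of_le (L : ℕ) {c : ℚ} (hc : c ≤ 0) :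
    traj (List.replicate L (1, false)) c = c := by
  induction L with
  | zero => rfl
  | succ L ih =>
    rw [List.replicate_succ, traj_cons]
    simpa [move, contract_one_of_le hc] using ih

theorem traj_replicate_one_of_mem (L : ℕ) {c : ℚ} (hc : 0 ≤ c) (hc' : c ≤ 1) :
    traj (List.replicate L (1, false)) c = c / 2 ^ L := by
  induction L generalizing c with
  | zero => simp [traj]
  | succ L ih =>
    have h₁ : move (1, false) c = c / 2 := by
      simp [move, contract_one_of_mem hc (by linarith)]
    rw [List.replicate_succ, traj_cons, h₁, ih (by linarith) (by linarith), pow_succ]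
    field_simp

theorem traj_replicate_one_of_ge (L : ℕ) {c : ℚ} (hc : L + 1 ≤ c) :
    traj (List.replicate L (1, false)) c = c - L := by
  induction L generalizing c with
  | zero => simp [traj]
  | succ L ih =>
    have hL : (0 : ℚ) ≤ L := by positivity
    push_cast at hc
    have h₁ : move (1, false) c = c - 1 := by simp [move, contract_one_of_ge (by linarith : 2 ≤ c)]
    rw [List.replicate_succ, traj_cons, h₁, ih (by linarith)]
    push_cast
    ring

theorem traj_tauWord_of_le (n L : ℕ) {c : ℚ} (hc : c ≤ 0) : traj (tauWord n L) c = c := by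
  rw [tauWord, traj_append, traj_combWord_of_le n hc, traj_replicate_one_of_le L hc]

theorem traj_tauWord_natCast {n k : ℕ} (L : ℕ) (hk : k ≤ n) :
    traj (tauWord n L) k = (1 - 1 / 2 ^ k) / 2 ^ L := by
  have h₁ : (1 : ℚ) / 2 ^ k ≤ 1 := by
    rw [div_le_one (by positivity)]
    exact one_le_pow₀ (by norm_num)
  have h₂ : (0 : ℚ) ≤ 1 / 2 ^ k := by positivity
  rw [tauWord, traj_append, traj_combWord_natCast hk,
    traj_replicate_one_of_mem L (by linarith) (by linarith)]

theorem traj_tauWord_of_ge (n L : ℕ) {c : ℚ} (hc : L + n + 1 ≤ c) :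
    traj (tauWord n L) c = c - (L + n) := by
  have hL : (0 : ℚ) ≤ L := by positivity
  rw [tauWord, traj_append, traj_combWord_of_ge n (by linarith),
    traj_replicate_one_of_ge L (by linarith)]
  ring

theorem traj_roundsWord_succ (n L B : ℕ) (c : ℚ) :
    traj (roundsWord n L (B + 1)) c = traj (roundsWord n L B) (traj (tauWord n L) (c - 1)) := by
  rw [roundsWord, traj_append, traj_cons]
  simp [move, contract]

theorem traj_roundsWord_of_le (n L B : ℕ) {c : ℚ} (hc : c ≤ 1) :
    traj (roundsWord n L B) c = c - B := by
  induction B generalizing c with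
  | zero => simp [roundsWord, traj]
  | succ B ih =>
    rw [traj_roundsWord_succ, traj_tauWord_of_le n L (by linarith), ih (by linarith)]
    push_cast
    ring

theorem traj_roundsWord_add (n L i j : ℕ) {c : ℚ} (hc : 1 ≤ c) :
    traj (roundsWord n L (j + i)) (c + j * (L + n + 1)) = traj (roundsWord n L i) c := by
  induction j with
  | zero => simp
  | succ j ih =>
    have h₁ : (0 : ℚ) ≤ j * (L + n + 1) := by positivity
    rw [show j + 1 + i = j + i + 1 by ring, traj_roundsWord_succ, ← ih]
    push_cast
    rw [traj_tauWord_of_ge n L (by linarith)]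
    ring_nf

theorem traj_hopWord_of_ge {r : ℕ} (hr : 1 ≤ r) {c : ℚ} (hc : 0 ≤ c) :
    traj (hopWord r r) c = c := by
  have hr' : (1 : ℚ) ≤ r := by exact_mod_cast hr
  rw [traj_hopWord, contract_one_of_ge (by linarith)]
  ring

theorem traj_leftWord (n L : ℕ) (c : ℚ) :
    traj (leftWord n L) c = traj (roundsWord n L (L + 2 * n + 2))
      (traj (hopWord (L + 2) (L + 2)) c) + (L + 2 * n + 1) := by
  rw [leftWord, traj_append, traj_append, traj_replicate_zero_true]
  push_cast
  ring

theorem traj_leftWord_zero (n L : ℕ) : traj (leftWord n L) 0 = -1 := by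
  rw [traj_leftWord, traj_hopWord_of_ge (by omega) le_rfl,
    traj_roundsWord_of_le _ _ _ zero_le_one]
  push_cast
  ring

theorem traj_rightWord_zero (n L : ℕ) : traj (rightWord n L) 0 = 1 := by
  have hL : (0 : ℚ) ≤ L := by positivity
  rw [rightWord, traj_append, traj_append, traj_roundsWord_of_le _ _ _ zero_le_one,
    traj_replicate_zero_true, traj_hopWord, contract_one_of_ge (by push_cast; linarith)]
  push_cast
  ring

theorem traj_leftWord_neg (n L : ℕ) :
    traj (leftWord n L) (1 - (L + 3 : ℕ)) = -(L + 3) + 1 / 2 := by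
  have hL : (0 : ℚ) ≤ L := by positivity
  have h₁ : traj (hopWord (L + 2) (L + 2)) (1 - (L + 3 : ℕ)) = 1 / 2 - (L + 2) := by
    rw [traj_hopWord, contract_one_of_mem] <;> push_cast <;> linarith
  rw [traj_leftWord, h₁, traj_roundsWord_of_le _ _ _ (by linarith)]
  push_cast
  ring

theorem traj_leftWord_block {n k : ℕ} (L : ℕ) {j : ℕ} (hj : j < L + 2 * n + 2) (hk : k ≤ n) :
    traj (leftWord n L) (1 + ((j * (L + n + 1) : ℕ) : ℚ) + k) = j + (1 - 1 / 2 ^ k) / 2 ^ L := by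
  obtain ⟨i, hi⟩ : ∃ i, L + 2 * n + 2 = j + (i + 1) := ⟨L + 2 * n + 1 - j, by omega⟩
  have hi' : (L + 2 * n + 2 : ℚ) = j + (i + 1) := by exact_mod_cast hi
  have hle : (1 - 1 / 2 ^ k : ℚ) / 2 ^ L ≤ 1 := by
    rw [div_le_one (by positivity)]
    have h₁ : (0 : ℚ) < 1 / 2 ^ k := by positivity
    have h₂ : (1 : ℚ) ≤ 2 ^ L := one_le_pow₀ (by norm_num)
    linarith
  have hc : (1 + ((j * (L + n + 1) : ℕ) : ℚ) + k) = 1 + k + j * (L + n + 1) := by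
    push_cast
    ring
  rw [traj_leftWord, traj_hopWord_of_ge (by omega) (by positivity), hi, hc,
    traj_roundsWord_add n L (i + 1) j (by simp), traj_roundsWord_succ, add_sub_cancel_left,
    traj_tauWord_natCast L hk, traj_roundsWord_of_le _ _ _ hle]
  linarith

theorem traj_leftWord_block_start (n L : ℕ) {j : ℕ} (hj : j ≤ L + 2 * n + 2) :
    traj (leftWord n L) (1 + ((j * (L + n + 1) : ℕ) : ℚ)) = j := by
  obtain ⟨i, hi⟩ : ∃ i, L + 2 * n + 2 = j + i := ⟨L + 2 * n + 2 - j, by omega⟩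
  have hi' : (L + 2 * n + 2 : ℚ) = j + i := by exact_mod_cast hi
  have hc : (1 + ((j * (L + n + 1) : ℕ) : ℚ)) = 1 + j * (L + n + 1) := by push_cast; ring
  rw [traj_leftWord, traj_hopWord_of_ge (by omega) (by positivity), hi, hc,
    traj_roundsWord_add n L i j le_rfl, traj_roundsWord_of_le _ _ _ le_rfl]
  linarith

/-! ### The two elements differ by `x_0 ^ 2` -/

theorem x_mul_x {i j : ℕ} (hij : i < j) : x i * x (j + 1) = x j * x i := by
  have h : (x i)⁻¹ * x j * x i * (x (j + 1))⁻¹ = 1 := by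
    have := PresentedGroup.one_of_mem (rels := thompsonRels) ⟨i, j, hij, rfl⟩
    simp only [map_mul, map_inv] at this
    exact this
  rw [mul_inv_eq_one, mul_assoc, inv_mul_eq_iff_eq_mul] at h
  exact h.symm

theorem semiconjBy_x {i j : ℕ} (hij : i < j) : SemiconjBy (x i) (x (j + 1)) (x j) := x_mul_x hij

theorem semiconjBy_x_zero_pow (r : ℕ) {k : ℕ} (hk : 1 ≤ k) :
    SemiconjBy (x 0 ^ r) (x (k + r)) (x k) := by
  induction r with
  | zero => simp
  | succ r ih =>
    rw [pow_succ]
    exact ih.mul_left (semiconjBy_x (by omega : 0 < k + r))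

/-- The conjugate of `x_0 x_1⁻¹` by `x_0 ^ (-r)`. -/
def bump (r : ℕ) : ThompsonF := x 0 ^ r * (x 0 * (x 1)⁻¹) * (x 0 ^ r)⁻¹

theorem x_zero_conj_bump (r : ℕ) : x 0 * bump r * (x 0)⁻¹ = bump (r + 1) := by
  simp only [bump, pow_succ', mul_inv_rev, mul_assoc]

theorem commute_bump_x (r : ℕ) {k : ℕ} (hk : 1 ≤ k) : Commute (bump (r + 1)) (x k) := by
  have h₁ := semiconjBy_x_zero_pow (r + 1) hk
  have h₂ : SemiconjBy (x 0 * (x 1)⁻¹) (x (k + (r + 1))) (x (k + (r + 1))) :=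
    (semiconjBy_x (by omega : 0 < k + (r + 1))).mul_left
      (semiconjBy_x (by omega : 1 < k + (r + 1))).inv_symm_left
  exact (h₁.mul_left h₂).mul_left h₁.inv_symm_left

theorem wordVal_cons (s : ℕ × Bool) (w : List (ℕ × Bool)) :
    wordVal (s :: w) = letterVal s * wordVal w := by
  simp [wordVal]

theorem commute_bump_wordVal (r : ℕ) {w : List (ℕ × Bool)} (hw : ∀ s ∈ w, 1 ≤ s.1) :
    Commute (bump (r + 1)) (wordVal w) := by
  induction w with
  | nil => exact Commute.one_right _
  | cons s w ih =>
    rw [wordVal_cons]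
    refine Commute.mul_right ?_ (ih fun s hs => hw s (List.mem_cons_of_mem _ hs))
    have h := commute_bump_x r (hw s List.mem_cons_self)
    unfold letterVal
    split_ifs
    exacts [h, h.inv_right]

theorem commute_bump_roundsWord {n : ℕ} (hn : 1 ≤ n) (L r B : ℕ) :
    Commute (bump (r + 1)) (wordVal (roundsWord n L B) * x 0 ^ B) := by
  induction B generalizing r with
  | zero => simp [roundsWord, wordVal]
  | succ B ih =>
    have h₁ : wordVal (roundsWord n L (B + 1)) * x 0 ^ (B + 1) =
        (x 0)⁻¹ * (wordVal (tauWord n L) * (wordVal (roundsWord n L B) * x 0 ^ B)) * x 0 := by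
      rw [roundsWord, wordVal_append, wordVal_cons, pow_succ]
      simp [letterVal, mul_assoc]
    have h₂ : bump (r + 1) = (x 0)⁻¹ * bump (r + 1 + 1) * x 0 := by
      rw [← x_zero_conj_bump (r + 1)]
      group
    have h₃ := (commute_bump_wordVal (r + 1) fun s hs => (mem_tauWord (L := L) hn hs).1).mul_right
      (ih (r + 1))
    rw [h₁, h₂]
    simpa using (Commute.conj_iff (x 0)⁻¹).2 h₃

theorem wordVal_replicate (k : ℕ) (s : ℕ × Bool) :
    wordVal (List.replicate k s) = letterVal s ^ k := by
  simp [wordVal]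

theorem wordVal_hopWord (r t : ℕ) :
    wordVal (hopWord r t) = x 0 ^ (r + 1) * (x 1)⁻¹ * (x 0 ^ t)⁻¹ := by
  simp [hopWord, wordVal_append, wordVal_cons, wordVal_replicate, letterVal, mul_assoc]

theorem wordVal_hopWord_self (r : ℕ) : wordVal (hopWord r r) = bump r := by
  simp only [wordVal_hopWord, bump, pow_succ, mul_assoc]

theorem wordVal_hopWord_succ (r : ℕ) : wordVal (hopWord (r + 1) r) = bump (r + 1) * x 0 := by
  rw [wordVal_hopWord, bump, pow_succ (x 0) (r + 1), pow_succ (x 0) r]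
  group

theorem wordVal_leftWord_mul {n : ℕ} (hn : 1 ≤ n) (L : ℕ) :
    wordVal (leftWord n L) * (x 0 * x 0) = wordVal (rightWord n L) := by
  have h := commute_bump_roundsWord hn L (L + 1) (L + 2 * n + 2)
  rw [rightWord, wordVal_append, wordVal_append, wordVal_hopWord_succ, wordVal_replicate,
    leftWord, wordVal_append, wordVal_append, wordVal_hopWord_self, wordVal_replicate]
  simp only [letterVal, if_true]
  rw [← mul_assoc _ (bump (L + 1 + 1)), ← h.eq, pow_succ (x 0) (L + 2 * n + 1)]
  simp only [mul_assoc]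

/-! ### Word length and words -/

theorem letterVal_mem {n : ℕ} {s : ℕ × Bool} (hs : s.1 ≤ n) :
    letterVal s ∈ Xset n ∨ (letterVal s)⁻¹ ∈ Xset n := by
  unfold letterVal
  split_ifs
  · exact Or.inl ⟨s.1, hs, rfl⟩
  · exact Or.inr ⟨s.1, hs, inv_inv _⟩

theorem exists_letterVal_eq {n : ℕ} {g : ThompsonF} (hg : g ∈ Xset n ∨ g⁻¹ ∈ Xset n) :
    ∃ s : ℕ × Bool, s.1 ≤ n ∧ letterVal s = g := by
  rcases hg with ⟨i, hi, rfl⟩ | ⟨i, hi, h⟩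
  · exact ⟨(i, true), hi, by simp [letterVal]⟩
  · exact ⟨(i, false), hi, by simp [letterVal, ← h]⟩

theorem ln_wordVal_le {n : ℕ} {w : List (ℕ × Bool)} (hw : ∀ s ∈ w, s.1 ≤ n) :
    ln n (wordVal w) ≤ w.length := by
  refine Nat.sInf_le ⟨w.map letterVal, by simp, ?_, rfl⟩
  intro g hg
  obtain ⟨s, hs, rfl⟩ := List.mem_map.1 hg
  exact letterVal_mem (hw s hs)

theorem exists_length_eq_ln {n : ℕ} {w : List (ℕ × Bool)} (hw : ∀ s ∈ w, s.1 ≤ n) :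
    ∃ v : List (ℕ × Bool), (∀ s ∈ v, s.1 ≤ n) ∧ wordVal v = wordVal w ∧
      v.length = ln n (wordVal w) := by
  have hne : {m | ∃ l : List ThompsonF, l.length = m ∧ (∀ a ∈ l, a ∈ Xset n ∨ a⁻¹ ∈ Xset n) ∧
      l.prod = wordVal w}.Nonempty := by
    refine ⟨_, w.map letterVal, rfl, ?_, rfl⟩
    intro g hg
    obtain ⟨s, hs, rfl⟩ := List.mem_map.1 hg
    exact letterVal_mem (hw s hs)
  obtain ⟨l, hl, hmem, hprod⟩ := Nat.sInf_mem hne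
  have hlift : ∃ v : List (ℕ × Bool), (∀ s ∈ v, s.1 ≤ n) ∧ v.map letterVal = l := by
    clear hl hprod
    induction l with
    | nil => exact ⟨[], by simp, rfl⟩
    | cons g l ih =>
      obtain ⟨v, hv, rfl⟩ := ih fun a ha => hmem a (List.mem_cons_of_mem _ ha)
      obtain ⟨s, hs, rfl⟩ := exists_letterVal_eq (hmem g List.mem_cons_self)
      exact ⟨s :: v, by simpa [hs] using hv, rfl⟩
  obtain ⟨v, hv, rfl⟩ := hlift
  exact ⟨v, hv, hprod, by rw [← List.length_map letterVal, hl]; rfl⟩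

/-- The homomorphism to `ℤ / 2` sending every generator to `1`. -/
def parityHom : ThompsonF →* Multiplicative (ZMod 2) :=
  PresentedGroup.toGroup (f := fun _ => Multiplicative.ofAdd 1) (by
    rintro _ ⟨i, j, -, rfl⟩
    simp)

theorem parityHom_wordVal (w : List (ℕ × Bool)) :
    parityHom (wordVal w) = Multiplicative.ofAdd (w.length : ZMod 2) := by
  induction w with
  | nil => simp [wordVal]
  | cons s w ih =>
    have hs : parityHom (letterVal s) = Multiplicative.ofAdd 1 := by
      unfold letterVal
      split_ifs
      · simp [parityHom, x]
      · simp only [map_inv, parityHom, x, PresentedGroup.toGroup.of]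
        decide
    rw [wordVal_cons, map_mul, hs, ih, ← ofAdd_add, List.length_cons]
    push_cast
    rw [add_comm]

theorem length_ne_length_of_wordVal_eq_mul {v w : List (ℕ × Bool)} {s : ℕ × Bool}
    (h : wordVal w = wordVal v * letterVal s) : w.length ≠ v.length := by
  intro hlen
  have h₁ : wordVal w = wordVal (v ++ [s]) := by
    rw [h, wordVal_append]
    simp [wordVal]
  have h₂ := congrArg parityHom h₁
  rw [parityHom_wordVal, parityHom_wordVal, hlen] at h₂
  simp at h₂

/-- The inverse letter. -/
def flipLetter (s : ℕ × Bool) : ℕ × Bool := (s.1, !s.2)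

theorem letterVal_flipLetter (s : ℕ × Bool) : letterVal (flipLetter s) = (letterVal s)⁻¹ := by
  obtain ⟨i, b⟩ := s
  cases b <;> simp [letterVal, flipLetter]

/-! ### Failure of almost convexity -/

theorem traj_eq_of_wordVal_eq_append {v p q : List (ℕ × Bool)} (h : wordVal v = wordVal (p ++ q)) :
    traj v = fun c => traj q (traj p c) := by
  funext c
  rw [← act_wordVal, h, act_wordVal, traj_append]

/-- A word with prefixes for two elements close to the first of our two elements, one moving the
origin to the left and the other not, is long. -/
theorem le_length_of_crossing {n L : ℕ} (hn : 1 ≤ n) {p q v u w u' : List (ℕ × Bool)}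
    (hpL : p.length ≤ L) (hqL : q.length ≤ L) (hq : ∀ s ∈ q, s.1 ≤ n)
    (hw : ∀ s ∈ w, s.1 ≤ n) (hv : wordVal v = wordVal (leftWord n L ++ p))
    (hw' : wordVal w = wordVal (leftWord n L ++ q)) (hv0 : traj v 0 < 0) (hw0 : 0 ≤ traj w 0)
    (heq : v ++ u = w ++ u') :
    2 * (L + 3) + (L + 2 * n + 2) * (L + n + 1 + 1) ≤ (v ++ u).length := by
  have hL : (0 : ℚ) ≤ L := by positivity
  have hp' : (p.length : ℚ) ≤ L := by exact_mod_cast hpL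
  have hq' : (q.length : ℚ) ≤ L := by exact_mod_cast hqL
  have hvt := traj_eq_of_wordVal_eq_append hv
  have hwt := traj_eq_of_wordVal_eq_append hw'
  have hleft : 2 * (L + 3) ≤ ∑ k ∈ Finset.range (L + 3), charge v (-(k : ℚ)) := by
    refine two_mul_le_sum_charge hv0 ?_ (by omega)
    obtain ⟨δ, hδ⟩ := exists_traj_eq_add_of_le p
    rintro ⟨k, -, hk⟩
    rw [hvt] at hk
    simp only [traj_leftWord_neg] at hk
    rw [hδ _ (by linarith)] at hk
    have h₁ : ((2 * (k - δ + L + 3) : ℤ) : ℚ) = ((1 : ℤ) : ℚ) := by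
      push_cast
      linarith
    have h₂ : 2 * (k - δ + L + 3) = 1 := by exact_mod_cast h₁
    omega
  have hright : (L + 2 * n + 2) * (L + n + 1 + 1) ≤
      ∑ i ∈ Finset.range ((L + 2 * n + 2) * (L + n + 1)), charge w (1 + (i : ℚ)) := by
    refine mul_le_sum_charge (J := L + n + 1) hn (by omega) (by omega) hw hw0 ?_ ?_
    · intro j hj
      rw [hwt]
      refine Intact.traj (d := L) ⟨j * 2 ^ L, fun k hk => ?_⟩ q hqL
      rw [traj_leftWord_block L hj hk]
      push_cast
      field_simp
    · rintro j hj hjJ k hk hkS ⟨m, -, hm⟩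
      obtain ⟨δ, hδ⟩ := exists_traj_eq_add_of_ge q hq
      have hjJ' : (L + n + 1 : ℚ) ≤ j := by exact_mod_cast hjJ
      have h₁ : traj w (1 + ((j * (L + n + 1) : ℕ) : ℚ)) = j + δ := by
        rw [hwt]
        simp only
        rw [traj_leftWord_block_start n L hj.le, hδ _ (by linarith)]
      have h₂ : traj w (1 + (((j + 1) * (L + n + 1) : ℕ) : ℚ)) = j + 1 + δ := by
        rw [hwt]
        simp only
        rw [traj_leftWord_block_start n L hj, Nat.cast_succ, hδ _ (by linarith)]
      have h₃ : traj w (1 + ((j * (L + n + 1) : ℕ) : ℚ)) <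
          traj w (1 + ((j * (L + n + 1) + k : ℕ) : ℚ)) :=
        strictMono_traj w (by gcongr; omega)
      have h₄ : traj w (1 + ((j * (L + n + 1) + k : ℕ) : ℚ)) <
          traj w (1 + (((j + 1) * (L + n + 1) : ℕ) : ℚ)) :=
        strictMono_traj w (by gcongr; rw [Nat.add_mul, one_mul]; omega)
      rw [h₁, hm] at h₃
      rw [h₂, hm] at h₄
      have h₅ : (j : ℤ) + δ < m := by exact_mod_cast h₃
      have h₆ : m < (j : ℤ) + 1 + δ := by exact_mod_cast h₄
      omega
  have hleft' := hleft.trans (Finset.sum_le_sum fun k _ => charge_le_charge_append v u (-(k : ℚ)))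
  have hright' :=
    hright.trans (Finset.sum_le_sum fun i _ => charge_le_charge_append w u' (1 + (i : ℚ)))
  rw [← heq] at hright'
  exact (add_le_add hleft' hright').trans (sum_charge_add_sum_charge_le_length (v ++ u) _ _)

/-- One of two neighbouring elements that are close to the first of our two elements, one moving the
origin to the left and the other not, has large word length. -/
theorem le_ln_of_crossing {n L m : ℕ} (hn : 1 ≤ n)
    (hm : m + 1 = 2 * (L + 3) + (L + 2 * n + 2) * (L + n + 1 + 1)) {p q : List (ℕ × Bool)}
    {s : ℕ × Bool} (hs : s.1 ≤ n) (hp : ∀ s ∈ p, s.1 ≤ n) (hq : q = p ++ [s]) (hqL : q.length ≤ L)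
    (hp0 : traj (leftWord n L ++ p) 0 < 0) (hq0 : 0 ≤ traj (leftWord n L ++ q) 0) :
    m < ln n (wordVal (leftWord n L ++ p)) ∨ m < ln n (wordVal (leftWord n L ++ q)) := by
  have hqn : ∀ r ∈ q, r.1 ≤ n := by
    subst hq
    simp only [List.mem_append, List.mem_singleton]
    rintro r (hr | rfl)
    exacts [hp r hr, hs]
  have hpL : p.length ≤ L := by
    rw [hq, List.length_append] at hqL
    omega
  have hmem {r : List (ℕ × Bool)} (hr : ∀ s ∈ r, s.1 ≤ n) : ∀ s ∈ leftWord n L ++ r, s.1 ≤ n := by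
    intro s hs
    rcases List.mem_append.1 hs with hs | hs
    exacts [mem_leftWord hn hs, hr s hs]
  obtain ⟨v, hvn, hv, hvl⟩ := exists_length_eq_ln (hmem hp)
  obtain ⟨w, hwn, hw, hwl⟩ := exists_length_eq_ln (hmem hqn)
  have hwv : wordVal w = wordVal v * letterVal s := by
    rw [hw, hv, hq, ← List.append_assoc, wordVal_append _ [s]]
    simp [wordVal]
  have hvw : wordVal v = wordVal (w ++ [flipLetter s]) := by
    rw [wordVal_append, hwv]
    simp [wordVal, letterVal_flipLetter]
  have hwv' : wordVal w = wordVal (v ++ [s]) := by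
    rw [hwv, wordVal_append]
    simp [wordVal]
  have hne := length_ne_length_of_wordVal_eq_mul hwv
  rw [← act_wordVal, ← hv, act_wordVal] at hp0
  rw [← act_wordVal, ← hw, act_wordVal] at hq0
  rw [← hvl, ← hwl]
  by_contra hlt
  push Not at hlt
  obtain hlen | hlen : w.length < m ∨ v.length < m := by omega
  · have := le_length_of_crossing hn (v := w ++ [flipLetter s]) (u := []) (w := w)
      (u' := [flipLetter s]) hpL hqL hqn hwn (hvw ▸ hv) hw
      (by rwa [← act_wordVal, ← hvw, act_wordVal]) hq0 (by simp)
    simp only [List.append_nil, List.length_append, List.length_singleton] at this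
    omega
  · have := le_length_of_crossing hn (v := v) (u := [s]) (w := v ++ [s])
      (u' := []) hpL hqL hqn ?_ hv (hwv' ▸ hw) hp0
      (by rwa [← act_wordVal, ← hwv', act_wordVal]) (by simp)
    · simp only [List.length_append, List.length_singleton] at this
      omega
    · simp only [List.mem_append, List.mem_singleton]
      rintro r (hr | rfl)
      exacts [hvn r hr, hs]

theorem exists_lt_and_not_succ {P : ℕ → Prop} {j : ℕ} (h0 : P 0) (hj : ¬ P j) :
    ∃ t < j, P t ∧ ¬ P (t + 1) := by
  induction j with
  | zero => exact absurd h0 hj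
  | succ j ih =>
    by_cases h : P j
    · exact ⟨j, by omega, h, hj⟩
    · obtain ⟨t, ht, h'⟩ := ih h
      exact ⟨t, by omega, h'⟩

end ThompsonF

open ThompsonF in
theorem not_almost_convex (n : ℕ) (hn : 1 ≤ n) :
    ∀ L : ℕ, ∃ (m : ℕ) (a b : ThompsonF), 0 < m ∧ ln n a ≤ m ∧ ln n b ≤ m ∧
      dn n a b ≤ 2 ∧
      ¬ ∃ (j : ℕ) (z : ℕ → ThompsonF), j ≤ L ∧ z 0 = a ∧ z j = b ∧
        (∀ t < j, ∃ s : ThompsonF, (s ∈ Xset n ∨ s⁻¹ ∈ Xset n) ∧ z (t + 1) = z t * s) ∧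
        (∀ t ≤ j, ln n (z t) ≤ m) := by
  intro L
  have hl := length_leftWord n L
  have hr := length_rightWord n L
  refine ⟨(leftWord n L).length, wordVal (leftWord n L), wordVal (rightWord n L), by omega,
    ln_wordVal_le fun s hs => mem_leftWord hn hs, ?_, ?_, ?_⟩
  · have := ln_wordVal_le fun s hs => mem_rightWord (n := n) (L := L) hn hs
    omega
  · have h : (wordVal (leftWord n L))⁻¹ * wordVal (rightWord n L) =
        wordVal [(0, true), (0, true)] := by
      rw [← wordVal_leftWord_mul hn L, inv_mul_cancel_left]
      simp [wordVal, letterVal]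
    rw [dn, h]
    exact ln_wordVal_le (by simp)
  · rintro ⟨j, z, hjL, hz0, hzj, hstep, hball⟩
    have hpath (t : ℕ) : t ≤ j → ∃ p : List (ℕ × Bool), (∀ s ∈ p, s.1 ≤ n) ∧ p.length = t ∧
        z t = wordVal (leftWord n L ++ p) := by
      induction t with
      | zero => exact fun _ => ⟨[], by simp, rfl, by simp [hz0]⟩
      | succ t ih =>
        intro ht
        obtain ⟨p, hp, hpt, hzt⟩ := ih (by omega)
        obtain ⟨g, hg, hzg⟩ := hstep t ht
        obtain ⟨s, hs, rfl⟩ := exists_letterVal_eq hg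
        refine ⟨p ++ [s], ?_, by simp [hpt], ?_⟩
        · simp only [List.mem_append, List.mem_singleton]
          rintro r (hr | rfl)
          exacts [hp r hr, hs]
        · rw [hzg, hzt, ← List.append_assoc, wordVal_append _ [s]]
          simp [wordVal]
    obtain ⟨t, htj, ht, ht'⟩ := exists_lt_and_not_succ (P := fun t => act (z t) 0 < 0) (j := j)
      (by rw [hz0, act_wordVal, traj_leftWord_zero]; norm_num)
      (by rw [hzj, act_wordVal, traj_rightWord_zero]; norm_num)
    obtain ⟨p, hp, hpt, hzt⟩ := hpath t htj.le
    obtain ⟨g, hg, hzg⟩ := hstep t htj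
    obtain ⟨s, hs, rfl⟩ := exists_letterVal_eq hg
    have hzt' : z (t + 1) = wordVal (leftWord n L ++ (p ++ [s])) := by
      rw [hzg, hzt, ← List.append_assoc, wordVal_append _ [s]]
      simp [wordVal]
    rw [hzt, act_wordVal] at ht
    rw [hzt', act_wordVal, not_lt] at ht'
    have h₁ := hball t htj.le
    have h₂ := hball (t + 1) htj
    rw [hzt] at h₁
    rw [hzt'] at h₂
    have := le_ln_of_crossing hn hl hs hp rfl (by simp; omega) ht ht'
    omega
end

section
/- For every k ≥ 1 and every n ≥ 2k + 2, Thompson's group F has a pocket of depth at least k with respect to the generating set X_n: there exists g ∈ F such that every h ∈ F with d_n(g, h) ≤ k satisfies l_n(h) ≤ l_n(g). -/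
namespace ThompsonPocket

/-! ### Words in the generators -/

/-- `g` is a product of at most `m` elements of `X_n ∪ X_n⁻¹`. -/
def HasWord (n : ℕ) (g : ThompsonF) (m : ℕ) : Prop :=
  ∃ l : List ThompsonF, l.length ≤ m ∧ (∀ a ∈ l, a ∈ Xset n ∨ a⁻¹ ∈ Xset n) ∧ l.prod = g

theorem HasWord.ln_le {n m : ℕ} {g : ThompsonF} (h : HasWord n g m) : ln n g ≤ m := by
  obtain ⟨l, hl, ha, hp⟩ := h
  have h1 : ln n g ≤ l.length := Nat.sInf_le ⟨l, rfl, ha, hp⟩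
  exact h1.trans hl

theorem HasWord.mono {n m m' : ℕ} {g : ThompsonF} (h : HasWord n g m) (hm : m ≤ m') :
    HasWord n g m' := by
  obtain ⟨l, hl, ha⟩ := h
  exact ⟨l, hl.trans hm, ha⟩

theorem HasWord.one (n : ℕ) : HasWord n 1 0 := ⟨[], by simp⟩

theorem HasWord.mul {n a b : ℕ} {g h : ThompsonF} (hg : HasWord n g a) (hh : HasWord n h b) :
    HasWord n (g * h) (a + b) := by
  obtain ⟨l, hl, ha, rfl⟩ := hg
  obtain ⟨l', hl', ha', rfl⟩ := hh
  refine ⟨l ++ l', by simp; omega, ?_, by simp⟩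
  intro y hy
  rcases List.mem_append.1 hy with h | h
  exacts [ha y h, ha' y h]

theorem HasWord.inv {n a : ℕ} {g : ThompsonF} (hg : HasWord n g a) : HasWord n g⁻¹ a := by
  obtain ⟨l, hl, ha, rfl⟩ := hg
  refine ⟨(l.map (·⁻¹)).reverse, by simpa using hl, ?_, (List.prod_inv_reverse l).symm⟩
  intro y hy
  simp only [List.mem_reverse, List.mem_map] at hy
  obtain ⟨z, hz, rfl⟩ := hy
  simpa [or_comm] using ha z hz

theorem HasWord.gen {n i : ℕ} (hi : i ≤ n) : HasWord n (x i) 1 :=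
  ⟨[x i], by simp, by
    intro a ha
    rw [List.mem_singleton] at ha
    subst ha
    exact Or.inl ⟨i, hi, rfl⟩, by simp⟩

theorem HasWord.gen_pow {n i : ℕ} (hi : i ≤ n) (r : ℕ) : HasWord n (x i ^ r) r := by
  induction r with
  | zero => simpa using HasWord.one n
  | succ r ih => rw [pow_succ]; exact ih.mul (HasWord.gen hi)

/-! ### The shift endomorphism -/

theorem x_rel {i j : ℕ} (h : i < j) : x j * x i = x i * x (j + 1) := by
  have : (PresentedGroup.mk thompsonRels) ((FreeGroup.of i)⁻¹ * FreeGroup.of j * FreeGroup.of i *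
      (FreeGroup.of (j + 1))⁻¹) = 1 :=
    PresentedGroup.one_of_mem (rels := thompsonRels) ⟨i, j, h, rfl⟩
  simp only [map_mul, map_inv] at this
  have h2 : (x i)⁻¹ * x j * x i * (x (j + 1))⁻¹ = 1 := this
  rw [mul_inv_eq_one, mul_assoc, inv_mul_eq_iff_eq_mul] at h2
  exact h2

/-- The endomorphism of `F` with `x_i ↦ x_{i+1}`. -/
def shift : ThompsonF →* ThompsonF :=
  PresentedGroup.toGroup (f := fun i => x (i + 1)) (by
    rintro _ ⟨i, j, h, rfl⟩
    simp only [map_mul, map_inv, FreeGroup.lift_apply_of]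
    rw [mul_inv_eq_one, mul_assoc, inv_mul_eq_iff_eq_mul]
    exact x_rel (by omega))

@[simp] theorem shift_x (i : ℕ) : shift (x i) = x (i + 1) :=
  PresentedGroup.toGroup.of _

theorem shift_mul_x_zero (u : ThompsonF) : shift u * x 0 = x 0 * shift (shift u) := by
  have h : (MulAut.conj (x 0)⁻¹).toMonoidHom.comp shift = shift.comp shift := by
    refine PresentedGroup.ext fun i => ?_
    change (MulAut.conj (x 0)⁻¹) (shift (x i)) = shift (shift (x i))
    simp only [shift_x, MulAut.conj_apply, inv_inv]
    rw [mul_assoc, x_rel (by omega), inv_mul_cancel_left]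
  have h2 : (x 0)⁻¹ * shift u * (x 0)⁻¹⁻¹ = shift (shift u) := DFunLike.congr_fun h u
  rw [← h2]; group

theorem iterate_shift_x (s i : ℕ) : shift^[s] (x i) = x (i + s) := by
  induction s generalizing i with
  | zero => rfl
  | succ s ih => rw [Function.iterate_succ_apply, shift_x, ih]; congr 1; omega

theorem iterate_shift_mul (s : ℕ) (a b : ThompsonF) :
    shift^[s] (a * b) = shift^[s] a * shift^[s] b := iterate_map_mul shift s a b

theorem iterate_shift_inv (s : ℕ) (a : ThompsonF) : shift^[s] a⁻¹ = (shift^[s] a)⁻¹ :=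
  iterate_map_inv shift s a

theorem iterate_shift_eq_conj (u : ThompsonF) (j : ℕ) :
    shift^[j + 1] u = (x 0 ^ j)⁻¹ * shift u * x 0 ^ j := by
  induction j with
  | zero => simp
  | succ j ih =>
    have h := shift_mul_x_zero (shift^[j] u)
    rw [← Function.iterate_succ_apply' shift, ← Function.iterate_succ_apply' shift] at h
    rw [← inv_mul_eq_iff_eq_mul, ih] at h
    rw [← h, pow_succ]; group

theorem x_add_eq_conj {i : ℕ} (hi : 1 ≤ i) (j : ℕ) :
    x (i + j) = (x 0 ^ j)⁻¹ * x i * x 0 ^ j := by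
  obtain ⟨i, rfl⟩ := Nat.exists_eq_add_of_le' hi
  have := iterate_shift_eq_conj (x i) j
  rw [iterate_shift_x, shift_x] at this
  rw [← this]; congr 1; omega

theorem induction_x {p : ThompsonF → Prop} (hx : ∀ i, p (x i))
    (hmul : ∀ a b, p a → p b → p (a * b)) (hinv : ∀ a, p a → p a⁻¹) (g : ThompsonF) : p g := by
  have hg : g ∈ Subgroup.closure (Set.range (PresentedGroup.of (rels := thompsonRels))) := by
    rw [PresentedGroup.closure_range_of]; trivial
  induction hg using Subgroup.closure_induction with
  | mem y hy =>
    obtain ⟨i, rfl⟩ := hy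
    exact hx i
  | one => simpa using hmul _ _ (hx 0) (hinv _ (hx 0))
  | mul a b _ _ iha ihb => exact hmul a b iha ihb
  | inv a _ iha => exact hinv a iha

theorem exists_hasWord {n : ℕ} (hn : 1 ≤ n) (g : ThompsonF) : ∃ m, HasWord n g m := by
  induction g using induction_x with
  | hx i =>
    rcases le_or_gt i n with h | h
    · exact ⟨1, HasWord.gen h⟩
    · obtain ⟨j, rfl⟩ := Nat.exists_eq_add_of_lt h
      rw [show n + j + 1 = n + (j + 1) by omega, x_add_eq_conj hn]
      exact ⟨_, ((HasWord.gen_pow n.zero_le _).inv.mul (HasWord.gen le_rfl)).mul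
        (HasWord.gen_pow n.zero_le _)⟩
  | hmul a b iha ihb =>
    obtain ⟨_, ha⟩ := iha
    obtain ⟨_, hb⟩ := ihb
    exact ⟨_, ha.mul hb⟩
  | hinv a iha =>
    obtain ⟨_, ha⟩ := iha
    exact ⟨_, ha.inv⟩

/-! ### Binary trees and forests -/

/-- Finite rooted binary trees. -/
inductive BTree where
  | leaf : BTree
  | node : BTree → BTree → BTree

open BTree

/-- The number of leaves of a tree. -/
def leaves : BTree → ℕ
  | leaf => 1
  | node l r => leaves l + leaves r

/-- The number of carets of a tree. -/
def carets : BTree → ℕ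
  | leaf => 0
  | node l r => carets l + carets r + 1

/-- The least depth of a leaf of a tree. -/
def minDepth : BTree → ℕ
  | leaf => 0
  | node l r => min (minDepth l) (minDepth r) + 1

/-- The positive element of `F` given by the forest whose only nontrivial tree is the first. -/
def treeElt : BTree → ThompsonF
  | leaf => 1
  | node l r => x 0 * shift (treeElt r) * treeElt l

/-- The positive element of `F` given by a forest. -/
def forestElt : List BTree → ThompsonF
  | [] => 1
  | t :: ts => shift (forestElt ts) * treeElt t

/-- The number of leaves of a forest. -/
def forestLeaves (ts : List BTree) : ℕ := (ts.map leaves).sum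

/-- The number of carets of a forest. -/
def forestCarets (ts : List BTree) : ℕ := (ts.map carets).sum

theorem leaves_eq (t : BTree) : leaves t = carets t + 1 := by
  induction t with
  | leaf => rfl
  | node l r hl hr => simp only [leaves, carets]; omega

theorem forestLeaves_eq (ts : List BTree) :
    forestLeaves ts = forestCarets ts + ts.length := by
  induction ts with
  | nil => rfl
  | cons t ts ih =>
    simp only [forestLeaves, forestCarets, List.map_cons, List.sum_cons, List.length_cons,
      leaves_eq] at ih ⊢
    omega

theorem forestLeaves_append (A B : List BTree) :
    forestLeaves (A ++ B) = forestLeaves A + forestLeaves B := by simp [forestLeaves]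

theorem forestElt_append (A B : List BTree) :
    forestElt (A ++ B) = shift^[A.length] (forestElt B) * forestElt A := by
  induction A with
  | nil => simp [forestElt]
  | cons t A ih =>
    simp only [List.cons_append, forestElt, ih, map_mul, List.length_cons,
      Function.iterate_succ_apply', mul_assoc]

theorem forestElt_split (A B : List BTree) (l r : BTree) :
    forestElt (A ++ node l r :: B) = x A.length * forestElt (A ++ l :: r :: B) := by
  induction A with
  | nil =>
    simp only [List.nil_append, forestElt, treeElt, List.length_nil, map_mul]
    simp only [← mul_assoc]
    rw [shift_mul_x_zero]
  | cons t A ih =>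
    simp only [List.cons_append, forestElt, ih, map_mul, shift_x, List.length_cons, mul_assoc]

theorem shift_mul_treeElt (t : BTree) (u : ThompsonF) :
    shift u * treeElt t = treeElt t * shift^[leaves t] u := by
  induction t generalizing u with
  | leaf => simp [treeElt, leaves]
  | node l r hl hr =>
    have h1 : shift (shift u) * shift (treeElt r) =
        shift (treeElt r) * shift (shift^[leaves r] u) := by
      rw [← map_mul, hr, map_mul]
    calc shift u * (x 0 * shift (treeElt r) * treeElt l)
        = (shift u * x 0) * shift (treeElt r) * treeElt l := by group
      _ = x 0 * (shift (shift u) * shift (treeElt r)) * treeElt l := by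
        rw [shift_mul_x_zero]; group
      _ = x 0 * shift (treeElt r) * (shift (shift^[leaves r] u) * treeElt l) := by
        rw [h1]; group
      _ = _ := by
        rw [hl, ← Function.iterate_add_apply, leaves, treeElt]; group

theorem iterate_shift_mul_forestElt (ts : List BTree) (u : ThompsonF) :
    shift^[ts.length] u * forestElt ts = forestElt ts * shift^[forestLeaves ts] u := by
  induction ts generalizing u with
  | nil => simp [forestElt, forestLeaves]
  | cons t ts ih =>
    have h1 : shift (shift^[ts.length] u) * shift (forestElt ts) =
        shift (forestElt ts) * shift (shift^[forestLeaves ts] u) := by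
      rw [← map_mul, ih, map_mul]
    rw [List.length_cons, Function.iterate_succ_apply', forestElt, ← mul_assoc, h1, mul_assoc,
      shift_mul_treeElt, ← Function.iterate_add_apply, mul_assoc]
    simp [forestLeaves]

theorem iterate_shift_mul_forestElt_div (A B : List BTree)
    (h : forestLeaves A = forestLeaves B) (u : ThompsonF) :
    shift^[A.length] u * (forestElt A * (forestElt B)⁻¹) =
      forestElt A * (forestElt B)⁻¹ * shift^[B.length] u := by
  have h1 := iterate_shift_mul_forestElt A u
  have h2 := iterate_shift_mul_forestElt B u
  rw [← mul_assoc, h1, h, mul_assoc, mul_assoc]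
  congr 1
  rw [eq_inv_mul_iff_mul_eq, ← mul_assoc, ← h2]
  group

/-! ### Sweeping a forest into left combs -/

/-- The left comb with `m` carets. -/
def comb : ℕ → BTree
  | 0 => leaf
  | m + 1 => node (comb m) leaf

@[simp] theorem carets_comb (m : ℕ) : carets (comb m) = m := by
  induction m with
  | zero => rfl
  | succ m ih => simp [comb, carets, ih]

theorem treeElt_comb (m : ℕ) : treeElt (comb m) = x 0 ^ m := by
  induction m with
  | zero => rfl
  | succ m ih => simp [comb, treeElt, ih, pow_succ']

theorem hasWord_sweep_aux {n m : ℕ} (K : ℕ) : ∀ (ts : List BTree) (b C s : ℕ),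
    forestLeaves ts + forestCarets ts ≤ K → s + C + 1 ≤ n →
    forestLeaves ts = b + 1 + C * (m + 1) →
    HasWord n (shift^[s] (forestElt (comb b :: List.replicate C (comb m)) * (forestElt ts)⁻¹))
      (b + C * m + forestCarets ts) := by
  induction K with
  | zero =>
    intro ts b C s hK hs hl
    omega
  | succ K ih =>
    intro ts b C s hK hs hl
    have hx : x s = shift^[s] (x 0) := by rw [iterate_shift_x, Nat.zero_add]
    match ts with
    | [] =>
      simp [forestLeaves] at hl
      omega
    | node l r :: ts =>
      have h1 := ih (l :: r :: ts) b C s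
        (by simp [forestLeaves, forestCarets, leaves, carets] at hK ⊢; omega) hs
        (by simp [forestLeaves, leaves] at hl ⊢; omega)
      have h2 := h1.mul (HasWord.gen (n := n) (i := s) (by omega)).inv
      have he := forestElt_split [] ts l r
      simp only [List.nil_append, List.length_nil] at he
      rw [he]
      rw [hx, ← iterate_shift_inv, ← iterate_shift_mul] at h2
      convert h2.mono _ using 2
      · group
      · simp [forestCarets, carets]; omega
    | [leaf] =>
      have hb : b = 0 := by simp [forestLeaves, leaves] at hl; omega
      have hC : C = 0 := by
        simp only [forestLeaves, leaves, List.map_cons, List.map_nil, List.sum_cons,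
          List.sum_nil] at hl
        by_contra h
        have : 0 < C * (m + 1) := by positivity
        omega
      subst hb hC
      have : forestElt [leaf] = 1 := by simp [forestElt, treeElt]
      simp only [comb, List.replicate_zero, this, mul_one, inv_one]
      rw [iterate_map_one]
      exact (HasWord.one n).mono (Nat.zero_le _)
    | leaf :: node l r :: ts =>
      have h1 := ih (leaf :: l :: r :: ts) b C s
        (by simp [forestLeaves, forestCarets, leaves, carets] at hK ⊢; omega) hs
        (by simp [forestLeaves, leaves] at hl ⊢; omega)
      have h2 := h1.mul (HasWord.gen (n := n) (i := 1 + s) (by omega)).inv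
      have he := forestElt_split [leaf] ts l r
      simp only [List.cons_append, List.nil_append, List.length_cons, List.length_nil,
        Nat.zero_add] at he
      rw [he]
      rw [← iterate_shift_x, ← iterate_shift_inv, ← iterate_shift_mul] at h2
      convert h2.mono _ using 2
      · group
      · simp [forestCarets, carets]; omega
    | leaf :: leaf :: ts =>
      match b, C with
      | 0, 0 => simp [forestLeaves, leaves] at hl
      | 0, C + 1 =>
        have h1 := ih (leaf :: ts) m C (s + 1)
          (by simp [forestLeaves, forestCarets, leaves, carets] at hK ⊢; omega) (by omega)
          (by simp [forestLeaves, leaves] at hl ⊢; rw [Nat.add_mul] at hl; omega)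
        rw [Function.iterate_succ_apply] at h1
        convert h1.mono _ using 2
        · simp [comb, treeElt, forestElt, List.replicate_succ]
        · simp [forestCarets, carets, Nat.add_mul]; omega
      | b + 1, C =>
        have h1 := ih (leaf :: ts) b C s
          (by simp [forestLeaves, forestCarets, leaves, carets] at hK ⊢; omega) hs
          (by simp [forestLeaves, leaves] at hl ⊢; omega)
        have h2 := h1.mul (HasWord.gen (n := n) (i := s) (by omega))
        rw [hx, ← iterate_shift_mul] at h2
        have h3 := shift_mul_x_zero (forestElt ts)
        convert h2.mono _ using 2
        · simp only [forestElt, treeElt_comb, treeElt, mul_one, pow_succ]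
          have h4 : x 0 * (shift (shift (forestElt ts)))⁻¹ = (shift (forestElt ts))⁻¹ * x 0 := by
            rw [mul_inv_eq_iff_eq_mul, mul_assoc, ← h3, inv_mul_cancel_left]
          simp only [mul_assoc, h4]
        · simp only [forestCarets, carets, List.map_cons, List.sum_cons]; omega

theorem hasWord_sweep {n m C s : ℕ} (ts : List BTree) (hC : 1 ≤ C) (hs : s + C ≤ n)
    (hl : forestLeaves ts = C * (m + 1)) :
    HasWord n (shift^[s] (forestElt (List.replicate C (comb m)) * (forestElt ts)⁻¹))
      (C * m + forestCarets ts) := by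
  obtain ⟨C, rfl⟩ := Nat.exists_eq_add_of_le' hC
  refine (hasWord_sweep_aux _ ts m C s le_rfl (by omega) ?_).mono ?_
  · rw [hl]; ring
  · apply le_of_eq; ring

/-! ### Forests obtained by short words -/

theorem exists_append_split {A B A' B' : List BTree} {l r : BTree}
    (h : A ++ node l r :: B = A' ++ B') :
    ∃ A'' B'', A ++ l :: r :: B = A'' ++ B'' ∧ forestLeaves A'' = forestLeaves A' := by
  rcases List.append_eq_append_iff.1 h with ⟨C, rfl, hC⟩ | ⟨C, rfl, hC⟩
  · cases C with
    | nil => exact ⟨A, l :: r :: B, rfl, by simp⟩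
    | cons t C =>
      simp only [List.cons_append, List.cons.injEq] at hC
      obtain ⟨rfl, rfl⟩ := hC
      exact ⟨A ++ l :: r :: C, B', by simp, by simp [forestLeaves, leaves]; omega⟩
  · exact ⟨A', C ++ l :: r :: B, by simp, rfl⟩

theorem exists_append_join {A B A' B' : List BTree} {l r : BTree}
    (h : A ++ l :: r :: B = A' ++ B') (hne : forestLeaves A' ≠ forestLeaves (A ++ [l])) :
    ∃ A'' B'', A ++ node l r :: B = A'' ++ B'' ∧ forestLeaves A'' = forestLeaves A' := by
  rcases List.append_eq_append_iff.1 h with ⟨C, rfl, hC⟩ | ⟨C, rfl, hC⟩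
  · match C with
    | [] => exact ⟨A, node l r :: B, rfl, by simp⟩
    | [t] =>
      simp only [List.cons_append, List.cons.injEq] at hC
      obtain ⟨rfl, -⟩ := hC
      exact absurd rfl hne
    | t :: t' :: C =>
      simp only [List.cons_append, List.cons.injEq] at hC
      obtain ⟨rfl, rfl, rfl⟩ := hC
      exact ⟨A ++ node l r :: C, B', by simp, by simp [forestLeaves, leaves]; omega⟩
  · exact ⟨A', C ++ node l r :: B, by simp, rfl⟩

theorem exists_eq_append_cons {α : Type*} {V : List α} {i : ℕ} (h : i < V.length) :
    ∃ A t B, V = A ++ t :: B ∧ A.length = i :=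
  ⟨V.take i, V[i], V.drop (i + 1), by simp, by simp; omega⟩

/-- Multiplying the inverse of a deep and wide forest by a short word yields the inverse of a
forest with the same number of leaves, almost as many trees, and almost the same gaps
between trees. -/
theorem exists_forest_of_word {n k M : ℕ} {T : BTree} (hT : k ≤ minDepth T)
    (hM : n + k + 1 ≤ M) (w : List ThompsonF) (hw : ∀ a ∈ w, a ∈ Xset n ∨ a⁻¹ ∈ Xset n)
    (hk : w.length ≤ k) :
    ∃ (V : List BTree) (D : Finset ℕ),
      (forestElt (List.replicate M T))⁻¹ * w.prod = (forestElt V)⁻¹ ∧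
      forestLeaves V = M * leaves T ∧ M ≤ V.length + w.length ∧
      (∀ t ∈ V, k ≤ minDepth t + w.length) ∧ D.card ≤ w.length ∧
      ∀ c ≤ M, c * leaves T ∉ D → ∃ A B, V = A ++ B ∧ forestLeaves A = c * leaves T := by
  induction w using List.reverseRecOn with
  | nil =>
    refine ⟨List.replicate M T, ∅, by simp, by simp [forestLeaves], by simp, ?_, by simp, ?_⟩
    · intro t ht
      rw [List.eq_of_mem_replicate ht]
      simpa using hT
    · intro c hc _
      refine ⟨List.replicate c T, List.replicate (M - c) T, ?_, by simp [forestLeaves]⟩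
      rw [List.replicate_append_replicate]
      congr 1
      omega
  | append_singleton w a ih =>
    simp only [List.length_append, List.length_singleton] at hk ⊢
    obtain ⟨V, D, hprod, hleaves, hlen, hdepth, hD, hpre⟩ :=
      ih (fun b hb => hw b (by simp [hb])) (by omega)
    rw [List.prod_append, List.prod_singleton, ← mul_assoc, hprod]
    rcases hw a (by simp) with ⟨i, hi, rfl⟩ | ⟨i, hi, hai⟩
    · obtain ⟨A, t, B, rfl, rfl⟩ := exists_eq_append_cons (V := V) (i := i) (by omega)
      have ht := hdepth t (by simp)
      cases t with
      | leaf => simp [minDepth] at ht; omega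
      | node l r =>
        refine ⟨A ++ l :: r :: B, D, ?_, ?_, ?_, ?_, by omega, ?_⟩
        · rw [forestElt_split]; group
        · rw [← hleaves]; simp [forestLeaves, leaves]; omega
        · simp at hlen ⊢; omega
        · intro t ht'
          simp only [List.mem_append, List.mem_cons] at ht'
          simp only [minDepth] at ht
          rcases ht' with h | rfl | rfl | h
          · have := hdepth t (by simp [h]); omega
          · omega
          · omega
          · have := hdepth t (by simp [h]); omega
        · intro c hc hcD
          obtain ⟨A', B', h, h'⟩ := hpre c hc hcD
          obtain ⟨A'', B'', h1, h2⟩ := exists_append_split h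
          exact ⟨A'', B'', h1, h2.trans h'⟩
    · obtain rfl : a = (x i)⁻¹ := by rw [← hai, inv_inv]
      obtain ⟨A, l, B, rfl, rfl⟩ := exists_eq_append_cons (V := V) (i := i) (by omega)
      cases B with
      | nil => simp at hlen; omega
      | cons r B =>
        refine ⟨A ++ node l r :: B, insert (forestLeaves (A ++ [l])) D, ?_, ?_, ?_, ?_, ?_, ?_⟩
        · rw [forestElt_split]; group
        · rw [← hleaves]; simp [forestLeaves, leaves]; omega
        · simp at hlen ⊢; omega
        · intro t ht'
          simp only [List.mem_append, List.mem_cons] at ht'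
          rcases ht' with h | rfl | h
          · have := hdepth t (by simp [h]); omega
          · have h1 := hdepth l (by simp)
            have h2 := hdepth r (by simp)
            simp only [minDepth]; omega
          · have := hdepth t (by simp [h]); omega
        · exact (Finset.card_insert_le _ _).trans (by omega)
        · intro c hc hcD
          rw [Finset.mem_insert, not_or] at hcD
          obtain ⟨A', B', h, hA⟩ := hpre c hc hcD.2
          obtain ⟨A'', B'', h1, h2⟩ := exists_append_join h (by rw [hA]; exact hcD.1)
          exact ⟨A'', B'', h1, h2.trans hA⟩

/-! ### The upper bound -/

/-- The candidate for a deep pocket. -/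
def pocketElt (N M : ℕ) (T : BTree) : ThompsonF :=
  x N * forestElt (List.replicate M (comb (carets T))) * (forestElt (List.replicate M T))⁻¹

theorem ln_pocketElt_mul_le {n k M : ℕ} {T : BTree} (hn : 2 * k + 2 ≤ n)
    (hT : k ≤ minDepth T) (hM : M = n + k + 1) (w : List ThompsonF)
    (hw : ∀ a ∈ w, a ∈ Xset n ∨ a⁻¹ ∈ Xset n) (hk : w.length ≤ k) :
    ln n (pocketElt (n + M) M T * w.prod) ≤ 2 * (M * carets T) + 2 * M + 1 := by
  obtain ⟨V, D, hprod, hleaves, hlen, -, hD, hpre⟩ :=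
    exists_forest_of_word hT hM.ge w hw hk
  set m := carets T with hm
  rw [leaves_eq, ← hm] at hleaves hpre
  obtain ⟨c, hc, hcD⟩ : ∃ c ∈ Finset.Icc (k + 2) n, c * (m + 1) ∉ D := by
    by_contra! hall
    have h1 : ((Finset.Icc (k + 2) n).image (· * (m + 1))).card ≤ D.card :=
      Finset.card_le_card (by
        intro y hy
        obtain ⟨c, hc, rfl⟩ := Finset.mem_image.1 hy
        exact hall c hc)
    rw [Finset.card_image_of_injective _ (fun a b h => Nat.eq_of_mul_eq_mul_right m.succ_pos h),
      Nat.card_Icc] at h1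
    omega
  rw [Finset.mem_Icc] at hc
  obtain ⟨A, B, rfl, hA⟩ := hpre c (by omega) hcD
  have hB : forestLeaves B = (M - c) * (m + 1) := by
    rw [forestLeaves_append, hA] at hleaves
    rw [Nat.sub_mul]; omega
  have hAB : forestCarets A + forestCarets B + (A.length + B.length) = M * m + M := by
    have h1 := forestLeaves_eq A
    have h2 := forestLeaves_eq B
    rw [forestLeaves_append] at hleaves
    rw [Nat.mul_add] at hleaves
    omega
  have hq : 1 ≤ A.length := by
    rcases A with _ | ⟨t, A⟩
    · simp [forestLeaves] at hA; omega
    · simp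
  have hcm : c * m + (M - c) * m = M * m := by rw [← Nat.add_mul]; congr 1; omega
  have hz := hasWord_sweep (n := n) (s := 0) A (by omega : 1 ≤ c) (by omega) hA
  have hY := hasWord_sweep (n := n) (s := 1) B (by omega : 1 ≤ M - c) (by omega) hB
  simp only [Function.iterate_zero, id, Function.iterate_one] at hz hY
  have hP : forestElt (List.replicate M (comb m)) = shift^[c]
      (forestElt (List.replicate (M - c) (comb m))) * forestElt (List.replicate c (comb m)) := by
    have := forestElt_append (List.replicate c (comb m)) (List.replicate (M - c) (comb m))
    rw [List.replicate_append_replicate, List.length_replicate] at this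
    rw [← this]
    congr 2; omega
  have hcomm := iterate_shift_mul_forestElt_div (List.replicate c (comb m)) A
    (by rw [hA]; simp [forestLeaves, leaves_eq])
  rw [List.length_replicate] at hcomm
  have hV : forestElt (A ++ B) = _ := forestElt_append A B
  have hcommV := iterate_shift_mul_forestElt_div (List.replicate M (comb m)) (A ++ B)
    (by rw [hleaves]; simp [forestLeaves, leaves_eq]) (x n)
  rw [List.length_replicate, iterate_shift_x, iterate_shift_x] at hcommV
  set z := forestElt (List.replicate c (comb m)) * (forestElt A)⁻¹ with hz_def
  set Y := forestElt (List.replicate (M - c) (comb m)) * (forestElt B)⁻¹ with hY_def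
  have hPV : forestElt (List.replicate M (comb m)) * (forestElt (A ++ B))⁻¹ =
      z * shift^[A.length] Y := by
    rw [hP, hV, hY_def, hz_def, iterate_shift_mul, iterate_shift_inv]
    have h1 := hcomm (forestElt (List.replicate (M - c) (comb m)))
    rw [mul_inv_rev, ← mul_assoc, ← mul_assoc, mul_assoc (shift^[c] _), h1]
  have hg : pocketElt (n + M) M T * w.prod =
      x (n + M) * (forestElt (List.replicate M (comb m)) * (forestElt (A ++ B))⁻¹) := by
    rw [← hprod, pocketElt, ← hm]; group
  have h0 := fun j => HasWord.gen_pow (n := n) (i := 0) (Nat.zero_le _) j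
  rcases le_or_gt M (A ++ B).length with hr | hr
  · obtain ⟨c, rfl⟩ := Nat.exists_eq_add_of_le' (show 1 ≤ c by omega)
    obtain ⟨d, rfl⟩ := Nat.exists_eq_add_of_le (show c ≤ M by omega)
    have he : pocketElt (n + (c + d)) (c + d) T * w.prod = (x 0 ^ (c + d))⁻¹ * x n * x 0 ^ d *
        shift Y * x 0 ^ c * z := by
      rw [hg, hPV, ← hcomm, iterate_shift_eq_conj, x_add_eq_conj (by omega),
        show x 0 ^ (c + d) = x 0 ^ d * x 0 ^ c by rw [← pow_add, add_comm]]
      group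
    rw [he]
    refine (((((h0 _).inv.mul (HasWord.gen le_rfl)).mul (h0 _)).mul hY).mul (h0 _)).mul hz
      |>.mono ?_ |>.ln_le
    simp only [List.length_append] at hr
    omega
  · have hr' := hr
    simp only [List.length_append] at hr'
    obtain ⟨q, hq⟩ := Nat.exists_eq_add_of_le' hq
    have he : pocketElt (n + M) M T * w.prod = z * (x 0 ^ q)⁻¹ * shift Y *
        (x 0 ^ (1 + B.length))⁻¹ * x n * x 0 ^ (A.length + B.length) := by
      rw [hg, hcommV, x_add_eq_conj (by omega), hPV, hq, iterate_shift_eq_conj,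
        List.length_append, hq, show q + 1 + B.length = q + (1 + B.length) by omega, pow_add]
      group
    rw [he]
    refine (((((hz.mul (h0 _).inv).mul hY).mul (h0 _).inv).mul (HasWord.gen le_rfl)).mul (h0 _))
      |>.mono ?_ |>.ln_le
    omega

/-! ### The action on the line -/

/-- The piecewise linear map which halves `[i, i + 2]`, fixes everything to the left and
translates everything to the right by `-1`. -/
def contract (i : ℕ) : Equiv.Perm ℚ where
  toFun y := if y ≤ i then y else if y ≤ i + 2 then (y + i) / 2 else y - 1
  invFun y := if y ≤ i then y else if y ≤ i + 1 then 2 * y - i else y + 1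
  left_inv y := by
    dsimp only
    split_ifs <;> linarith
  right_inv y := by
    dsimp only
    split_ifs <;> linarith

theorem contract_apply (i : ℕ) (y : ℚ) :
    contract i y = if y ≤ i then y else if y ≤ i + 2 then (y + i) / 2 else y - 1 := rfl

theorem contract_inv_apply (i : ℕ) (y : ℚ) :
    (contract i)⁻¹ y = if y ≤ i then y else if y ≤ i + 1 then 2 * y - i else y + 1 := rfl

theorem contract_rel {i j : ℕ} (h : i < j) :
    contract j * contract i = contract i * contract (j + 1) := by
  have h' : (i : ℚ) + 1 ≤ j := by exact_mod_cast h
  ext y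
  simp only [Equiv.Perm.mul_apply, contract_apply, Nat.cast_add, Nat.cast_one]
  split_ifs <;> linarith

/-- The action of `F` on the line by piecewise linear maps. -/
def act : ThompsonF →* Equiv.Perm ℚ :=
  PresentedGroup.toGroup (f := contract) (by
    rintro _ ⟨i, j, h, rfl⟩
    simp only [map_mul, map_inv, FreeGroup.lift_apply_of]
    rw [mul_inv_eq_one, mul_assoc, inv_mul_eq_iff_eq_mul]
    exact contract_rel h)

@[simp] theorem act_x (i : ℕ) : act (x i) = contract i := PresentedGroup.toGroup.of _

theorem act_strictMono (u : ThompsonF) : StrictMono (act u) := by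
  induction u using induction_x with
  | hx i =>
    intro y z h
    rw [act_x, contract_apply, contract_apply]
    split_ifs <;> linarith
  | hmul a b ha hb =>
    rw [map_mul, Equiv.Perm.coe_mul]
    exact ha.comp hb
  | hinv a ha =>
    intro y z h
    rw [map_inv, ← ha.lt_iff_lt]
    simpa using h

theorem act_of_nonpos (u : ThompsonF) {y : ℚ} (hy : y ≤ 0) : act u y = y := by
  induction u using induction_x with
  | hx i =>
    have : (0 : ℚ) ≤ i := i.cast_nonneg
    rw [act_x, contract_apply, if_pos (by linarith)]
  | hmul a b ha hb => rw [map_mul, Equiv.Perm.mul_apply, hb, ha]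
  | hinv a ha => rw [map_inv, Equiv.Perm.inv_eq_iff_eq, ha]

theorem act_nonneg (u : ThompsonF) {y : ℚ} (hy : 0 ≤ y) : 0 ≤ act u y := by
  have := (act_strictMono u).monotone hy
  rwa [act_of_nonpos u le_rfl] at this

theorem act_pos (u : ThompsonF) {y : ℚ} (hy : 0 < y) : 0 < act u y := by
  have := act_strictMono u hy
  rwa [act_of_nonpos u le_rfl] at this

theorem act_shift_of_le_one (u : ThompsonF) {y : ℚ} (hy : y ≤ 1) : act (shift u) y = y := by
  induction u using induction_x with
  | hx i =>
    have : (0 : ℚ) ≤ i := i.cast_nonneg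
    rw [shift_x, act_x, contract_apply, if_pos (by push_cast; linarith)]
  | hmul a b ha hb => rw [map_mul, map_mul, Equiv.Perm.mul_apply, hb, ha]
  | hinv a ha => rw [map_inv, map_inv, Equiv.Perm.inv_eq_iff_eq, ha]

theorem act_shift_add_one (u : ThompsonF) {y : ℚ} (hy : 0 ≤ y) :
    act (shift u) (y + 1) = act u y + 1 := by
  induction u using induction_x generalizing y with
  | hx i =>
    rw [shift_x, act_x, act_x, contract_apply, contract_apply]
    push_cast
    split_ifs <;> linarith
  | hmul a b ha hb =>
    rw [map_mul, map_mul, map_mul, Equiv.Perm.mul_apply, Equiv.Perm.mul_apply, hb hy,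
      ha (act_nonneg b hy)]
  | hinv a ha =>
    have h : 0 ≤ (act a)⁻¹ y := by rw [← map_inv]; exact act_nonneg _ hy
    rw [map_inv, map_inv, map_inv, Equiv.Perm.inv_eq_iff_eq, ha h]
    simp

theorem act_treeElt_add (t : BTree) {y : ℚ} (hy : 0 ≤ y) :
    act (treeElt t) (leaves t + y) = 1 + y := by
  induction t generalizing y with
  | leaf => simp [treeElt, leaves]
  | node l r hl hr =>
    have h0 : (0 : ℚ) ≤ leaves r + y := by positivity
    simp only [treeElt, map_mul, Equiv.Perm.mul_apply, leaves, Nat.cast_add, add_assoc, hl h0]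
    rw [add_comm 1, act_shift_add_one _ h0, hr hy, act_x, contract_apply]
    push_cast
    split_ifs <;> linarith

theorem act_treeElt_leaves (t : BTree) : act (treeElt t) (leaves t) = 1 := by
  simpa using act_treeElt_add t le_rfl

theorem act_treeElt_le_one (t : BTree) {y : ℚ} (hy : y ≤ leaves t) :
    act (treeElt t) y ≤ 1 := by
  rw [← act_treeElt_leaves t]
  exact (act_strictMono _).monotone hy

theorem act_treeElt_node_left (l r : BTree) {y : ℚ} (h0 : 0 ≤ y) (hy : y ≤ leaves l) :
    act (treeElt (node l r)) y = act (treeElt l) y / 2 := by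
  have h1 := act_treeElt_le_one l hy
  have h2 := act_nonneg (treeElt l) h0
  simp only [treeElt, map_mul, Equiv.Perm.mul_apply, act_shift_of_le_one _ h1]
  rw [act_x, contract_apply]
  push_cast
  split_ifs <;> linarith

theorem act_treeElt_node_right (l r : BTree) {y : ℚ} (h0 : 0 ≤ y) (hy : y ≤ leaves r) :
    act (treeElt (node l r)) (leaves l + y) = (act (treeElt r) y + 1) / 2 := by
  have h1 := act_treeElt_le_one r hy
  have h2 := act_nonneg (treeElt r) h0
  simp only [treeElt, map_mul, Equiv.Perm.mul_apply, act_treeElt_add l h0]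
  rw [add_comm 1, act_shift_add_one _ h0, act_x, contract_apply]
  push_cast
  split_ifs <;> linarith

/-- The depth of the `i`-th leaf of a tree. -/
def dep : BTree → ℕ → ℕ
  | leaf, _ => 0
  | node l r, i => if i < leaves l then dep l i + 1 else dep r (i - leaves l) + 1

theorem act_treeElt_leaf (t : BTree) {r : ℕ} (hr : r < leaves t) {s : ℚ} (h0 : 0 ≤ s)
    (h1 : s ≤ 1) :
    act (treeElt t) (r + s) = act (treeElt t) r + s / 2 ^ dep t r := by
  induction t generalizing r with
  | leaf =>
    simp [treeElt, dep]
  | node a b iha ihb =>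
    by_cases h : r < leaves a
    · have h' : (r : ℚ) + 1 ≤ leaves a := by exact_mod_cast h
      rw [act_treeElt_node_left a b (by positivity) (by linarith),
        act_treeElt_node_left a b (by positivity) (by linarith), iha h, dep, if_pos h]
      ring
    · obtain ⟨q, rfl⟩ := Nat.exists_eq_add_of_le (not_lt.1 h)
      have hq : q < leaves b := by simp only [leaves] at hr; omega
      have h' : (q : ℚ) + 1 ≤ leaves b := by exact_mod_cast hq
      rw [Nat.cast_add, add_assoc, act_treeElt_node_right a b (by positivity) (by linarith),
        act_treeElt_node_right a b (by positivity) (by linarith), ihb hq, dep, if_neg h,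
        Nat.add_sub_cancel_left]
      ring

theorem act_replicate (t : BTree) {M i : ℕ} (hi : i < M) {y : ℚ} (h0 : 0 ≤ y)
    (hy : y ≤ leaves t) :
    act (forestElt (List.replicate M t)) (i * leaves t + y) = i + act (treeElt t) y := by
  induction M generalizing i with
  | zero => omega
  | succ M ih =>
    rw [List.replicate_succ, forestElt, map_mul, Equiv.Perm.mul_apply]
    cases i with
    | zero =>
      simp only [Nat.cast_zero, zero_mul, zero_add]
      exact act_shift_of_le_one _ (act_treeElt_le_one t hy)
    | succ i =>
      have h1 : (0 : ℚ) ≤ i * leaves t + y := by positivity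
      rw [show ((i + 1 : ℕ) : ℚ) * leaves t + y = leaves t + (i * leaves t + y) by
        push_cast; ring, act_treeElt_add t h1, add_comm 1, act_shift_add_one _ h1, ih (by omega)]
      push_cast; ring

theorem act_replicate_add (t : BTree) (M : ℕ) {y : ℚ} (hy : 0 ≤ y) :
    act (forestElt (List.replicate M t)) (M * leaves t + y) = M + y := by
  induction M with
  | zero => simp [forestElt]
  | succ M ih =>
    have h1 : (0 : ℚ) ≤ M * leaves t + y := by positivity
    rw [List.replicate_succ, forestElt, map_mul, Equiv.Perm.mul_apply,
      show ((M + 1 : ℕ) : ℚ) * leaves t + y = leaves t + (M * leaves t + y) by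
        push_cast; ring, act_treeElt_add t h1, add_comm 1, act_shift_add_one _ h1, ih]
    push_cast; ring

theorem act_replicate_mul (t : BTree) {M j : ℕ} (hj : j ≤ M) :
    act (forestElt (List.replicate M t)) (j * leaves t) = j := by
  rcases hj.lt_or_eq with h | rfl
  · have := act_replicate t h le_rfl (y := 0) (by positivity)
    simpa [act_of_nonpos] using this
  · simpa using act_replicate_add t j le_rfl

/-! ### Integrality changes along a word -/

/-- The rational number `y` is an integer. -/
def IsInt (y : ℚ) : Prop := ∃ z : ℤ, y = z

theorem not_isInt_of_lt {i : ℕ} {y : ℚ} (h1 : (i : ℚ) < y) (h2 : y < i + 1) : ¬ IsInt y := by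
  rintro ⟨z, rfl⟩
  have h1' : (i : ℤ) < z := by exact_mod_cast h1
  have h2' : z < i + 1 := by exact_mod_cast h2
  omega

theorem isInt_natCast (j : ℕ) : IsInt j := ⟨j, by simp⟩

theorem isInt_contract_inv_iff {i : ℕ} {y : ℚ} (h : y ≠ i + 1 / 2) :
    IsInt y ↔ IsInt ((contract i)⁻¹ y) := by
  rw [contract_inv_apply]
  split_ifs with h1 h2
  · rfl
  · rcases h2.lt_or_eq with h2 | rfl
    · refine iff_of_false (not_isInt_of_lt (not_le.1 h1) h2) ?_
      push Not at h1
      rcases lt_or_gt_of_ne h with h3 | h3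
      · exact not_isInt_of_lt (i := i) (by linarith) (by linarith)
      · exact not_isInt_of_lt (i := i + 1) (by push_cast; linarith) (by push_cast; linarith)
    · exact iff_of_true ⟨i + 1, by push_cast; rfl⟩ ⟨i + 2, by push_cast; ring⟩
  · constructor
    · rintro ⟨z, rfl⟩
      exact ⟨z + 1, by push_cast; rfl⟩
    · rintro ⟨z, hz⟩
      exact ⟨z - 1, by push_cast; linarith⟩

theorem isInt_contract_iff {i : ℕ} {y : ℚ} (h : y ≠ i + 1) :
    IsInt y ↔ IsInt (contract i y) := by
  have h1 : contract i y ≠ i + 1 / 2 := by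
    intro h2
    have h3 : y = (contract i)⁻¹ (i + 1 / 2) := by rw [← h2]; simp
    rw [contract_inv_apply] at h3
    apply h
    rw [h3]
    split_ifs <;> linarith
  have h2 := isInt_contract_inv_iff h1
  rw [show (contract i)⁻¹ (contract i y) = y by simp] at h2
  exact h2.symm

theorem exists_change {a : ThompsonF} {n : ℕ} (ha : a ∈ Xset n ∨ a⁻¹ ∈ Xset n) :
    ∃ y₀ : ℚ, y₀ ≤ n + 1 ∧ ∀ y, ¬ (IsInt y ↔ IsInt ((act a)⁻¹ y)) → y = y₀ := by
  rcases ha with ⟨i, hi, rfl⟩ | ⟨i, hi, hai⟩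
  · have hi' : (i : ℚ) ≤ n := by exact_mod_cast hi
    refine ⟨i + 1 / 2, by linarith, fun y hy => ?_⟩
    by_contra h
    rw [act_x] at hy
    exact hy (isInt_contract_inv_iff h)
  · have hi' : (i : ℚ) ≤ n := by exact_mod_cast hi
    refine ⟨i + 1, by linarith, fun y hy => ?_⟩
    by_contra h
    rw [← map_inv, hai, act_x] at hy
    exact hy (isInt_contract_iff h)

/-- The inverse action of the prefix of length `k` of a word. -/
def track (l : List ThompsonF) (k : ℕ) : Equiv.Perm ℚ := (act (l.take k).prod)⁻¹

theorem track_strictMono (l : List ThompsonF) (k : ℕ) : StrictMono (track l k) := by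
  rw [track, ← map_inv]
  exact act_strictMono _

theorem track_pos (l : List ThompsonF) (k : ℕ) {y : ℚ} (hy : 0 < y) : 0 < track l k y := by
  rw [track, ← map_inv]
  exact act_pos _ hy

theorem track_zero (l : List ThompsonF) (y : ℚ) : track l 0 y = y := by simp [track]

theorem track_length (l : List ThompsonF) : track l l.length = (act l.prod)⁻¹ := by simp [track]

theorem track_succ {l : List ThompsonF} {k : ℕ} (hk : k < l.length) (y : ℚ) :
    track l (k + 1) y = (act l[k])⁻¹ (track l k y) := by
  rw [track, List.prod_take_succ l k hk, map_mul, mul_inv_rev, Equiv.Perm.mul_apply, track]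

open Classical in
/-- The times at which the integrality of the image of `y` changes along a word. -/
noncomputable def changes (l : List ThompsonF) (y : ℚ) : Finset ℕ :=
  {k ∈ Finset.range l.length | ¬ (IsInt (track l k y) ↔ IsInt (track l (k + 1) y))}

theorem mem_changes {l : List ThompsonF} {y : ℚ} {k : ℕ} : k ∈ changes l y ↔
    k < l.length ∧ ¬ (IsInt (track l k y) ↔ IsInt (track l (k + 1) y)) := by
  simp [changes]

theorem sum_card_changes_le {n : ℕ} {l : List ThompsonF}
    (hl : ∀ a ∈ l, a ∈ Xset n ∨ a⁻¹ ∈ Xset n) (Z : Finset ℚ) :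
    ∑ y ∈ Z, (changes l y).card ≤ l.length := by
  classical
  have h1 : ∑ y ∈ Z, (changes l y).card =
      ∑ k ∈ Finset.range l.length, {y ∈ Z | k ∈ changes l y}.card := by
    have := Finset.sum_card_bipartiteAbove_eq_sum_card_bipartiteBelow
      (s := Z) (t := Finset.range l.length) (fun y k => k ∈ changes l y)
    simp only [Finset.bipartiteAbove, Finset.bipartiteBelow] at this
    rw [← this]
    refine Finset.sum_congr rfl fun y _ => congrArg _ ?_
    ext k
    simp only [Finset.mem_filter, Finset.mem_range, mem_changes]
    tauto
  rw [h1]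
  refine (Finset.sum_le_card_nsmul _ _ 1 fun k hk => ?_).trans (by simp)
  rw [Finset.card_le_one]
  intro y hy z hz
  simp only [Finset.mem_filter, mem_changes] at hy hz
  obtain ⟨y₀, -, h⟩ := exists_change (hl l[k] (List.getElem_mem hy.2.1))
  have e1 := h _ (by rw [← track_succ hy.2.1]; exact hy.2.2)
  have e2 := h _ (by rw [← track_succ hy.2.1]; exact hz.2.2)
  exact (track l k).injective (e1.trans e2.symm)

theorem exists_step {s : ℕ → Prop} {a b : ℕ} (hab : a ≤ b) (h : ¬ (s a ↔ s b)) :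
    ∃ k, a ≤ k ∧ k < b ∧ ¬ (s k ↔ s (k + 1)) := by
  induction b, hab using Nat.le_induction with
  | base => exact absurd Iff.rfl h
  | succ b hab ih =>
    by_cases hb : s a ↔ s b
    · exact ⟨b, hab, by omega, by rwa [← hb]⟩
    · obtain ⟨k, h1, h2, h3⟩ := ih hb
      exact ⟨k, h1, by omega, h3⟩

theorem two_le_card_changes {l : List ThompsonF} {y : ℚ} {k : ℕ} (hk : k ≤ l.length)
    (h0 : ¬ (IsInt (track l 0 y) ↔ IsInt (track l k y)))
    (h1 : ¬ (IsInt (track l k y) ↔ IsInt (track l l.length y))) : 2 ≤ (changes l y).card := by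
  obtain ⟨a, -, ha, ha'⟩ := exists_step (s := fun k => IsInt (track l k y)) k.zero_le h0
  obtain ⟨b, hb, hb', hb''⟩ := exists_step (s := fun k => IsInt (track l k y)) hk h1
  have h : ({a, b} : Finset ℕ) ⊆ changes l y := by
    intro c hc
    simp only [Finset.mem_insert, Finset.mem_singleton] at hc
    rcases hc with rfl | rfl
    · exact mem_changes.2 ⟨by omega, ha'⟩
    · exact mem_changes.2 ⟨by omega, hb''⟩
  rw [← Finset.card_pair (show a ≠ b by omega)]
  exact Finset.card_le_card h

/-! ### Kinks -/

open Filter Topology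

/-- `f` is affine in a neighbourhood of `p`. -/
def AffineAt (f : ℚ → ℚ) (p : ℚ) : Prop := ∃ a b : ℚ, ∀ᶠ y in 𝓝 p, f y = a * y + b

theorem AffineAt.comp {f g : ℚ → ℚ} {p : ℚ} (hg : AffineAt g (f p)) (hf : AffineAt f p) :
    AffineAt (fun y => g (f y)) p := by
  obtain ⟨a, b, hf⟩ := hf
  obtain ⟨c, d, hg⟩ := hg
  have h1 : Tendsto f (𝓝 p) (𝓝 (f p)) := by
    have h2 : ContinuousAt (fun y : ℚ => a * y + b) p := by fun_prop
    exact h2.congr (hf.mono fun y hy => hy.symm)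
  refine ⟨c * a, c * b + d, ?_⟩
  filter_upwards [hf, h1.eventually hg] with y h2 h3
  rw [h3, h2]; ring

theorem affineAt_contract {i : ℕ} {y : ℚ} (hy : ¬ IsInt y) : AffineAt (contract i) y := by
  have h0 : y ≠ i := fun h => hy ⟨i, by rw [h]; simp⟩
  have h2 : y ≠ i + 2 := fun h => hy ⟨i + 2, by rw [h]; simp⟩
  rcases lt_or_gt_of_ne h0 with h | h
  · refine ⟨1, 0, ?_⟩
    filter_upwards [Iio_mem_nhds h] with z hz
    rw [Set.mem_Iio] at hz
    rw [contract_apply, if_pos hz.le]; ring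
  · rcases lt_or_gt_of_ne h2 with h' | h'
    · refine ⟨1 / 2, i / 2, ?_⟩
      filter_upwards [Ioi_mem_nhds h, Iio_mem_nhds h'] with z hz hz'
      rw [Set.mem_Ioi] at hz
      rw [Set.mem_Iio] at hz'
      rw [contract_apply, if_neg hz.not_ge, if_pos hz'.le]; ring
    · refine ⟨1, -1, ?_⟩
      filter_upwards [Ioi_mem_nhds h, Ioi_mem_nhds h'] with z hz hz'
      rw [Set.mem_Ioi] at hz hz'
      rw [contract_apply, if_neg hz.not_ge, if_neg hz'.not_ge]; ring

theorem affineAt_contract_inv {i : ℕ} {y : ℚ} (hy : ¬ IsInt y) :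
    AffineAt ((contract i)⁻¹ : Equiv.Perm ℚ) y := by
  have h0 : y ≠ i := fun h => hy ⟨i, by rw [h]; simp⟩
  have h2 : y ≠ i + 1 := fun h => hy ⟨i + 1, by rw [h]; simp⟩
  rcases lt_or_gt_of_ne h0 with h | h
  · refine ⟨1, 0, ?_⟩
    filter_upwards [Iio_mem_nhds h] with z hz
    rw [Set.mem_Iio] at hz
    rw [contract_inv_apply, if_pos hz.le]; ring
  · rcases lt_or_gt_of_ne h2 with h' | h'
    · refine ⟨2, -i, ?_⟩
      filter_upwards [Ioi_mem_nhds h, Iio_mem_nhds h'] with z hz hz'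
      rw [Set.mem_Ioi] at hz
      rw [Set.mem_Iio] at hz'
      rw [contract_inv_apply, if_neg hz.not_ge, if_pos hz'.le]; ring
    · refine ⟨1, 1, ?_⟩
      filter_upwards [Ioi_mem_nhds h, Ioi_mem_nhds h'] with z hz hz'
      rw [Set.mem_Ioi] at hz hz'
      rw [contract_inv_apply, if_neg hz.not_ge, if_neg hz'.not_ge]; ring

theorem affineAt_track {n : ℕ} {l : List ThompsonF} (hl : ∀ a ∈ l, a ∈ Xset n ∨ a⁻¹ ∈ Xset n)
    {p : ℚ} (hp : ∀ k ≤ l.length, ¬ IsInt (track l k p)) {k : ℕ} (hk : k ≤ l.length) :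
    AffineAt (track l k) p := by
  induction k with
  | zero =>
    refine ⟨1, 0, Eventually.of_forall fun y => ?_⟩
    rw [track_zero]; ring
  | succ k ih =>
    have hg : AffineAt ((act l[k])⁻¹ : Equiv.Perm ℚ) (track l k p) := by
      rcases hl l[k] (List.getElem_mem hk) with ⟨i, -, h⟩ | ⟨i, -, h⟩
      · rw [h, act_x]; exact affineAt_contract_inv (hp k (by omega))
      · rw [← map_inv, h, act_x]; exact affineAt_contract (hp k (by omega))
    have h := hg.comp (ih (by omega))
    rwa [← show (track l (k + 1) : ℚ → ℚ) = fun y => (act l[k])⁻¹ (track l k y) from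
      funext (track_succ hk)] at h

/-- If `f` is affine near `p`, and `f` sends the segment at `p` of slope `α` to one of slope `β`,
then the ratio of `β` and `α` is the slope of `f`. -/
theorem slope_eq {f : ℚ → ℚ} {p a b α β : ℚ} (h : ∀ᶠ y in 𝓝 p, f y = a * y + b)
    (hs : ∀ᶠ s in 𝓝[>] (0 : ℚ), f (p + s * α) = f p + s * β) : β = a * α := by
  have h1 : Tendsto (fun s : ℚ => p + s * α) (𝓝[>] 0) (𝓝 p) := by
    have h2 : ContinuousAt (fun s : ℚ => p + s * α) 0 := by fun_prop
    have h3 := h2.tendsto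
    simp only [zero_mul, add_zero] at h3
    exact h3.mono_left nhdsWithin_le_nhds
  obtain ⟨s, h2, h3, h4⟩ := ((h1.eventually h).and (hs.and self_mem_nhdsWithin)).exists
  have h5 := h.self_of_nhds
  rw [h3, h5] at h2
  have h6 : s * (β - a * α) = 0 := by linarith
  rcases mul_eq_zero.1 h6 with h7 | h7
  · exact absurd h7 (ne_of_gt h4)
  · linarith

/-! ### The lower bound -/

theorem act_treeElt_leaf_left (t : BTree) {r : ℕ} (hr : r < leaves t) {s : ℚ} (h0 : 0 ≤ s)
    (h1 : s ≤ 1) :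
    act (treeElt t) (r + 1 - s) = act (treeElt t) (r + 1) - s / 2 ^ dep t r := by
  rw [show (r : ℚ) + 1 - s = r + (1 - s) by ring,
    act_treeElt_leaf t hr (by linarith) (by linarith), act_treeElt_leaf t hr zero_le_one le_rfl]
  ring

theorem act_pocketElt_inv (N M : ℕ) (T : BTree) (y : ℚ) :
    (act (pocketElt N M T))⁻¹ y = act (forestElt (List.replicate M T))
      ((act (forestElt (List.replicate M (comb (carets T)))))⁻¹ ((contract N)⁻¹ y)) := by
  simp [pocketElt, mul_assoc]

theorem leaves_comb (T : BTree) : leaves (comb (carets T)) = leaves T := by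
  rw [leaves_eq, leaves_eq, carets_comb]

theorem act_pocketElt_inv_replicate {N M i : ℕ} (hMN : M ≤ N) (T : BTree) (hi : i < M) {y : ℚ}
    (h0 : 0 ≤ y) (hy : y ≤ leaves T) :
    (act (pocketElt N M T))⁻¹ (i + act (treeElt (comb (carets T))) y) =
      i + act (treeElt T) y := by
  have h1 : (i : ℚ) + 1 ≤ N := by exact_mod_cast (by omega : i + 1 ≤ N)
  have hy' : y ≤ leaves (comb (carets T)) := by rwa [leaves_comb]
  have h2 := act_treeElt_le_one _ hy'
  rw [act_pocketElt_inv, contract_inv_apply, if_pos (by linarith), ← act_replicate _ hi h0 hy',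
    ← act_replicate _ hi h0 hy, leaves_comb]
  simp

theorem not_affineAt_pocketElt {N M i r : ℕ} (hMN : M ≤ N) {T : BTree} (hi : i < M)
    (hr : r < carets T)
    (hdep : dep T (r + 1) + dep (comb (carets T)) r ≠ dep T r + dep (comb (carets T)) (r + 1)) :
    ¬ AffineAt ((act (pocketElt N M T))⁻¹ : Equiv.Perm ℚ)
      (i + act (treeElt (comb (carets T))) (r + 1)) := by
  rintro ⟨a, b, h⟩
  have hT : r + 1 < leaves T := by rw [leaves_eq]; omega
  have hT' : (r : ℚ) + 1 + 1 ≤ leaves T := by exact_mod_cast hT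
  have hC : r + 1 < leaves (comb (carets T)) := by rwa [leaves_comb]
  have hval := act_pocketElt_inv_replicate hMN T hi (y := r + 1) (by positivity) (by linarith)
  have hsmall : ∀ᶠ s in 𝓝[>] (0 : ℚ), 0 < s ∧ s < 1 :=
    Ioo_mem_nhdsGT one_pos
  have hR := slope_eq (α := 1 / 2 ^ dep (comb (carets T)) (r + 1))
    (β := 1 / 2 ^ dep T (r + 1)) h (by
      filter_upwards [hsmall] with s hs
      have h1 := act_pocketElt_inv_replicate hMN T hi (y := r + 1 + s)
        (by have := hs.1; positivity) (by linarith [hs.2])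
      have e1 := act_treeElt_leaf _ hC hs.1.le hs.2.le
      have e2 := act_treeElt_leaf _ hT hs.1.le hs.2.le
      push_cast at e1 e2
      rw [e1, e2] at h1
      rw [hval, mul_one_div, mul_one_div, add_assoc, h1, add_assoc])
  have hL := slope_eq (α := -(1 / 2 ^ dep (comb (carets T)) r))
    (β := -(1 / 2 ^ dep T r)) h (by
      filter_upwards [hsmall] with s hs
      have h1 := act_pocketElt_inv_replicate hMN T hi (y := r + 1 - s)
        (by have : (0 : ℚ) ≤ r := r.cast_nonneg
            linarith [hs.2]) (by linarith [hs.1])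
      rw [act_treeElt_leaf_left _ (by omega) hs.1.le hs.2.le,
        act_treeElt_leaf_left _ (by omega) hs.1.le hs.2.le] at h1
      rw [hval, mul_neg, mul_neg, mul_one_div, mul_one_div, add_assoc, ← sub_eq_add_neg, h1]
      ring)
  apply hdep
  have h2 : ((2 : ℚ) ^ (dep T (r + 1) + dep (comb (carets T)) r)) =
      2 ^ (dep T r + dep (comb (carets T)) (r + 1)) := by
    rw [mul_neg, neg_inj] at hL
    field_simp at hR hL
    rw [pow_add, pow_add, hR, hL]
    ring
  exact pow_right_injective₀ (by norm_num) (by norm_num) h2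

theorem dep_comb_zero (m : ℕ) : dep (comb m) 0 = m := by
  induction m with
  | zero => rfl
  | succ m ih => rw [comb, dep, if_pos (by rw [leaves_eq]; omega), ih]

theorem dep_comb_succ {m r : ℕ} (hr : r < m) : dep (comb m) (r + 1) = m - r := by
  induction m with
  | zero => omega
  | succ m ih =>
    rw [comb, dep, leaves_eq, carets_comb]
    split_ifs with h
    · rw [ih (by omega)]; omega
    · simp only [dep]; omega

/-- A tree none of whose inner gaps is smoothed out against a left comb. -/
def Kinked (T : BTree) : Prop :=
  dep T 1 ≠ dep T 0 ∧ ∀ i, i + 1 < leaves T → dep T (i + 1) + 1 ≠ dep T i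

theorem Kinked.dep_ne {T : BTree} (hT : Kinked T) {r : ℕ} (hr : r < carets T) :
    dep T (r + 1) + dep (comb (carets T)) r ≠ dep T r + dep (comb (carets T)) (r + 1) := by
  rw [dep_comb_succ hr]
  cases r with
  | zero =>
    rw [dep_comb_zero]
    have := hT.1
    simpa using this
  | succ r =>
    rw [dep_comb_succ (by omega)]
    have := hT.2 (r + 1) (by rw [leaves_eq]; omega)
    omega

theorem isInt_act_pocketElt_inv {N M j : ℕ} (T : BTree) (hj : j ≤ N) :
    IsInt ((act (pocketElt N M T))⁻¹ j) := by
  have hj' : (j : ℚ) ≤ N := by exact_mod_cast hj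
  refine ⟨j, ?_⟩
  rw [act_pocketElt_inv, contract_inv_apply, if_pos hj']
  rcases le_total j M with h | h
  · have h1 := act_replicate_mul (comb (carets T)) h
    have h2 := act_replicate_mul T h
    rw [leaves_comb] at h1
    rw [← Equiv.Perm.eq_inv_iff_eq] at h1
    rw [← h1, h2]; simp
  · obtain ⟨d, rfl⟩ := Nat.exists_eq_add_of_le h
    have h1 := act_replicate_add (comb (carets T)) M (y := d) (by positivity)
    have h2 := act_replicate_add T M (y := d) (by positivity)
    rw [leaves_comb] at h1
    rw [← Equiv.Perm.eq_inv_iff_eq] at h1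
    rw [Nat.cast_add, ← h1, h2]; simp

theorem isInt_act_pocketElt_inv_half {N M : ℕ} (hMN : M ≤ N) (T : BTree) :
    IsInt ((act (pocketElt N M T))⁻¹ (N + 1 / 2)) := by
  refine ⟨N + 1, ?_⟩
  rw [act_pocketElt_inv, contract_inv_apply, if_neg (by linarith), if_pos (by linarith)]
  obtain ⟨d, rfl⟩ := Nat.exists_eq_add_of_le hMN
  have h1 := act_replicate_add (comb (carets T)) M (y := d + 1) (by positivity)
  have h2 := act_replicate_add T M (y := d + 1) (by positivity)
  rw [leaves_comb] at h1
  rw [← Equiv.Perm.eq_inv_iff_eq] at h1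
  rw [show (2 : ℚ) * ((M + d : ℕ) + 1 / 2) - (M + d : ℕ) = M + (d + 1) by push_cast; ring,
    ← h1, h2]
  push_cast; ring

theorem not_isInt_add_act_treeElt (t : BTree) (i : ℕ) {r : ℕ} (hr : r < carets t) :
    ¬ IsInt (i + act (treeElt t) (r + 1)) := by
  have h1 := act_pos (treeElt t) (y := r + 1) (by positivity)
  have h2 : act (treeElt t) (r + 1) < 1 := by
    refine (act_strictMono _ ?_).trans_eq (act_treeElt_leaves t)
    rw [leaves_eq]
    exact_mod_cast (by omega : r + 1 < carets t + 1)
  exact not_isInt_of_lt (i := i) (by linarith) (by linarith)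

theorem two_le_card_changes_inner {n N M i r : ℕ} (hMN : M ≤ N) {T : BTree} (hT : Kinked T)
    {l : List ThompsonF} (hl : ∀ a ∈ l, a ∈ Xset n ∨ a⁻¹ ∈ Xset n)
    (hprod : l.prod = pocketElt N M T) (hi : i < M) (hr : r < carets T) :
    2 ≤ (changes l (i + act (treeElt (comb (carets T))) (r + 1))).card := by
  set p := i + act (treeElt (comb (carets T))) (r + 1) with hp
  have h0 : ¬ IsInt (track l 0 p) := by
    rw [track_zero, hp]
    exact not_isInt_add_act_treeElt _ i (by simpa using hr)
  have h1 : ¬ IsInt (track l l.length p) := by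
    rw [track_length, hprod, hp, act_pocketElt_inv_replicate hMN T hi (by positivity)
      (by rw [leaves_eq]; exact_mod_cast (by omega : r + 1 ≤ carets T + 1))]
    exact not_isInt_add_act_treeElt _ i hr
  obtain ⟨k, hk, hk'⟩ : ∃ k ≤ l.length, IsInt (track l k p) := by
    by_contra! hall
    have h2 := affineAt_track hl hall le_rfl
    rw [track_length, hprod] at h2
    exact not_affineAt_pocketElt hMN hi hr (hT.dep_ne hr) h2
  exact two_le_card_changes hk (by tauto) (by tauto)

theorem sum_card_changes_outer {n N M : ℕ} (hMN : M ≤ N) {T : BTree}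
    {l : List ThompsonF} (hl : ∀ a ∈ l, a ∈ Xset n ∨ a⁻¹ ∈ Xset n)
    (hprod : l.prod = pocketElt N M T) :
    2 * (N - n) + 1 ≤ (changes l (N + 1 / 2)).card +
      ∑ y ∈ (Finset.Icc 1 N).image (Nat.cast : ℕ → ℚ), (changes l y).card := by
  classical
  obtain ⟨k, -, hk, hk'⟩ := exists_step (s := fun k => IsInt (track l k (N + 1 / 2)))
    l.length.zero_le (by
      rw [track_zero, track_length, hprod]
      exact fun h => not_isInt_of_lt (i := N) (by linarith) (by linarith)
        (h.2 (isInt_act_pocketElt_inv_half hMN T)))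
  have hF : 1 ≤ (changes l (N + 1 / 2)).card :=
    Finset.card_pos.2 ⟨k, mem_changes.2 ⟨hk, hk'⟩⟩
  have hval : track l k (N + 1 / 2) ≤ n + 1 := by
    obtain ⟨y₀, h0, h⟩ := exists_change (hl l[k] (List.getElem_mem hk))
    exact (h _ (by rw [← track_succ hk]; exact hk')).trans_le h0
  rw [Finset.sum_image (fun a _ b _ h => by exact_mod_cast h)]
  have hint : {j ∈ Finset.Icc 1 N | IsInt (track l k (j : ℕ))}.card ≤ n := by
    have hnat : ∀ j ∈ {j ∈ Finset.Icc 1 N | IsInt (track l k (j : ℕ))},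
        ∃ z ∈ Finset.Icc 1 n, track l k j = (z : ℕ) := by
      intro j hj
      rw [Finset.mem_filter, Finset.mem_Icc] at hj
      obtain ⟨⟨h1, h2⟩, z, hz⟩ := hj
      have hpos : 0 < track l k j := track_pos l k (by exact_mod_cast h1)
      have hlt : track l k j < n + 1 := by
        refine (track_strictMono l k ?_).trans_le hval
        have : (j : ℚ) ≤ N := by exact_mod_cast h2
        linarith
      rw [hz] at hpos hlt
      have hpos' : 0 < z := by exact_mod_cast hpos
      have hlt' : z < n + 1 := by exact_mod_cast hlt
      lift z to ℕ using hpos'.le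
      exact ⟨z, by rw [Finset.mem_Icc]; omega, by simpa using hz⟩
    choose! z hz hz' using hnat
    refine (Finset.card_le_card_of_injOn z hz ?_).trans (by simp)
    intro a ha b hb hab
    have h := (hz' a ha).trans ((congrArg Nat.cast hab).trans (hz' b hb).symm)
    exact_mod_cast (track l k).injective h
  have hnot : N - n ≤ {j ∈ Finset.Icc 1 N | ¬ IsInt (track l k (j : ℕ))}.card := by
    have := Finset.card_filter_add_card_filter_not (s := Finset.Icc 1 N)
      (fun j : ℕ => IsInt (track l k j))
    rw [Nat.card_Icc] at this
    omega
  have hsum : {j ∈ Finset.Icc 1 N | ¬ IsInt (track l k (j : ℕ))}.card * 2 ≤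
      ∑ j ∈ Finset.Icc 1 N, (changes l (j : ℕ)).card := by
    refine le_trans ?_ (Finset.sum_le_sum_of_subset (Finset.filter_subset
      (fun j : ℕ => ¬ IsInt (track l k j)) _))
    refine Finset.card_nsmul_le_sum _ _ 2 fun j hj => ?_
    rw [Finset.mem_filter, Finset.mem_Icc] at hj
    have h0 : IsInt (track l 0 j) := by rw [track_zero]; exact isInt_natCast j
    have h1 : IsInt (track l l.length j) := by
      rw [track_length, hprod]; exact isInt_act_pocketElt_inv T hj.1.2
    exact two_le_card_changes hk.le (by tauto) (by tauto)
  omega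

theorem le_length_of_prod_eq_pocketElt {n N M : ℕ} (hMN : M ≤ N) {T : BTree} (hT : Kinked T)
    {l : List ThompsonF} (hl : ∀ a ∈ l, a ∈ Xset n ∨ a⁻¹ ∈ Xset n)
    (hprod : l.prod = pocketElt N M T) :
    2 * (M * carets T) + 2 * (N - n) + 1 ≤ l.length := by
  set c := comb (carets T) with hc
  have hcar : carets c = carets T := by rw [hc, carets_comb]
  set inner : Finset ℚ := (Finset.range M ×ˢ Finset.range (carets T)).image
    fun q => (q.1 : ℚ) + act (treeElt c) (q.2 + 1) with hinner
  set base : Finset ℚ := (Finset.Icc 1 N).image (Nat.cast : ℕ → ℚ) with hbase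
  have hlt : ∀ r < carets T, 0 < act (treeElt c) ((r : ℚ) + 1) ∧
      act (treeElt c) ((r : ℚ) + 1) < 1 := by
    intro r hr
    refine ⟨act_pos _ (by positivity),
      (act_strictMono _ ?_).trans_eq (act_treeElt_leaves c)⟩
    rw [leaves_eq, hcar]
    exact_mod_cast (by omega : r + 1 < carets T + 1)
  have hcard : inner.card = M * carets T := by
    rw [hinner, Finset.card_image_of_injOn, Finset.card_product, Finset.card_range,
      Finset.card_range]
    rintro ⟨i, r⟩ h ⟨i', r'⟩ h' heq
    simp only [Finset.coe_product, Finset.coe_range, Set.mem_prod, Set.mem_Iio] at h h' heq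
    obtain ⟨h1, h2⟩ := hlt r h.2
    obtain ⟨h1', h2'⟩ := hlt r' h'.2
    have e1 : i < i' + 1 := by
      have : (i : ℚ) < i' + 1 := by linarith
      exact_mod_cast this
    have e2 : i' < i + 1 := by
      have : (i' : ℚ) < i + 1 := by linarith
      exact_mod_cast this
    obtain rfl : i = i' := by omega
    have e3 := (act (treeElt c)).injective (add_left_cancel heq)
    have e4 : r = r' := by exact_mod_cast add_right_cancel e3
    rw [e4]
  have hdisj : Disjoint base inner := by
    rw [Finset.disjoint_left]
    intro y hy hy'
    obtain ⟨j, -, rfl⟩ := Finset.mem_image.1 hy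
    obtain ⟨⟨i, r⟩, h, h'⟩ := Finset.mem_image.1 hy'
    rw [Finset.mem_product, Finset.mem_range, Finset.mem_range] at h
    refine not_isInt_add_act_treeElt c i (r := r) (by rw [hcar]; exact h.2) ?_
    rw [h']
    exact isInt_natCast j
  have hnot : (N : ℚ) + 1 / 2 ∉ base ∪ inner := by
    intro hy
    rcases Finset.mem_union.1 hy with hy | hy
    · obtain ⟨j, -, hj⟩ := Finset.mem_image.1 hy
      refine not_isInt_of_lt (i := N) (y := N + 1 / 2) (by linarith) (by linarith) ?_
      rw [← hj]
      exact isInt_natCast j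
    · obtain ⟨⟨i, r⟩, h, h'⟩ := Finset.mem_image.1 hy
      rw [Finset.mem_product, Finset.mem_range, Finset.mem_range] at h
      have h1 : (i : ℚ) + 1 ≤ N := by exact_mod_cast (by omega : i + 1 ≤ N)
      have h2 := hlt r h.2
      dsimp only at h'
      linarith
  have htotal := sum_card_changes_le hl (insert ((N : ℚ) + 1 / 2) (base ∪ inner))
  rw [Finset.sum_insert hnot, Finset.sum_union hdisj] at htotal
  have houter := sum_card_changes_outer hMN hl hprod
  rw [← hbase] at houter
  have hin : inner.card * 2 ≤ ∑ y ∈ inner, (changes l y).card := by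
    refine Finset.card_nsmul_le_sum _ _ 2 fun y hy => ?_
    obtain ⟨⟨i, r⟩, h, rfl⟩ := Finset.mem_image.1 hy
    rw [Finset.mem_product, Finset.mem_range, Finset.mem_range] at h
    exact two_le_card_changes_inner hMN hT hl hprod h.1 h.2
  rw [hcard] at hin
  omega

/-! ### A deep kinked tree -/

/-- A kinked tree all of whose leaves have depth more than `d`. -/
def deepTree : ℕ → BTree
  | 0 => node (node leaf (node leaf leaf)) leaf
  | d + 1 => node (deepTree d) (deepTree d)

theorem lt_minDepth_deepTree (d : ℕ) : d < minDepth (deepTree d) := by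
  induction d with
  | zero => decide
  | succ d ih => simp only [deepTree, minDepth]; omega

theorem dep_deepTree (d : ℕ) : 4 ≤ leaves (deepTree d) ∧
    dep (deepTree d) 1 = dep (deepTree d) 0 + 1 ∧
    dep (deepTree d) 0 + 1 ≠ dep (deepTree d) (leaves (deepTree d) - 1) ∧
    ∀ i, i + 1 < leaves (deepTree d) → dep (deepTree d) (i + 1) + 1 ≠ dep (deepTree d) i := by
  induction d with
  | zero =>
    refine ⟨by decide, by decide, by decide, fun i hi => ?_⟩
    have hi' : i < 3 := by simp only [deepTree, leaves] at hi; omega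
    interval_cases i <;> decide
  | succ d ih =>
    obtain ⟨h1, h2, h3, h4⟩ := ih
    simp only [deepTree, leaves, dep]
    refine ⟨by omega, ?_, ?_, fun i hi => ?_⟩
    · rw [if_pos (by omega), if_pos (by omega), h2]
    · rw [if_pos (by omega), if_neg (by omega), show leaves (deepTree d) + leaves (deepTree d) - 1 -
        leaves (deepTree d) = leaves (deepTree d) - 1 by omega]
      omega
    · rcases lt_trichotomy (i + 1) (leaves (deepTree d)) with h | h | h
      · rw [if_pos h, if_pos (by omega)]
        have := h4 i h
        omega
      · rw [if_neg (by omega), if_pos (by omega), h, Nat.sub_self,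
          show i = leaves (deepTree d) - 1 by omega]
        omega
      · obtain ⟨j, rfl⟩ := Nat.exists_eq_add_of_le (by omega : leaves (deepTree d) ≤ i)
        rw [if_neg (by omega), if_neg (by omega), add_assoc (leaves _), Nat.add_sub_cancel_left,
          Nat.add_sub_cancel_left]
        have := h4 j (by omega)
        omega

theorem kinked_deepTree (d : ℕ) : Kinked (deepTree d) := by
  obtain ⟨-, h, -, h'⟩ := dep_deepTree d
  exact ⟨by omega, h'⟩

theorem exists_word_length_eq_ln {n : ℕ} (hn : 1 ≤ n) (g : ThompsonF) :
    ∃ l : List ThompsonF, l.length = ln n g ∧ (∀ a ∈ l, a ∈ Xset n ∨ a⁻¹ ∈ Xset n) ∧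
      l.prod = g := by
  obtain ⟨-, l, -, hl⟩ := exists_hasWord hn g
  exact Nat.sInf_mem (s := {m | ∃ l : List ThompsonF, l.length = m ∧
    (∀ a ∈ l, a ∈ Xset n ∨ a⁻¹ ∈ Xset n) ∧ l.prod = g}) ⟨l.length, l, rfl, hl⟩

end ThompsonPocket

open ThompsonPocket in
theorem pockets_of_depth_at_least_k (k n : ℕ) (hk : 1 ≤ k) (hn : 2 * k + 2 ≤ n) :
    ∃ g : ThompsonF, ∀ h : ThompsonF, dn n g h ≤ k → ln n h ≤ ln n g := by
  set M := n + k + 1 with hM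
  set T := deepTree k
  refine ⟨pocketElt (n + M) M T, fun h hh => ?_⟩
  obtain ⟨w, hwlen, hw, hwprod⟩ :=
    exists_word_length_eq_ln (by omega : 1 ≤ n) ((pocketElt (n + M) M T)⁻¹ * h)
  have hup := ln_pocketElt_mul_le hn (lt_minDepth_deepTree k).le hM w hw
    (by rw [hwlen]; exact hh)
  rw [hwprod, mul_inv_cancel_left] at hup
  obtain ⟨l, hllen, hl, hlprod⟩ :=
    exists_word_length_eq_ln (by omega : 1 ≤ n) (pocketElt (n + M) M T)
  have hlow := le_length_of_prod_eq_pocketElt (by omega : M ≤ n + M) (kinked_deepTree k) hl hlprod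
  rw [hllen, Nat.add_sub_cancel_left] at hlow
  exact hup.trans hlow
end
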